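/- Let n ≥ 5 and Ā = A[B_n]/Z(A[B_n]). Then Aut(Ā) is generated by the inner automorphisms together with τ̄ and μ̄; τ̄ and μ̄ are commuting involutions; the subgroup ⟨τ̄, μ̄⟩ intersects Inn(Ā) trivially; consequently Aut(Ā) is the internal semidirect product Inn(Ā) ⋊ ⟨τ̄, μ̄⟩, which is isomorphic to Ā ⋊ (ℤ/2ℤ × ℤ/2ℤ), and Out(Ā) is isomorphic to ℤ/2ℤ × ℤ/2ℤ. -/

import Mathlib

/-- The defining relators of the Artin group of type `Bₙ`, as elements of the free
group on `n` generators (0-indexed: generator `i` corresponds to `r_{i+1}`). -/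
def BnRels (n : ℕ) : Set (FreeGroup (Fin n)) :=
  {w | (∃ i j : Fin n, (i : ℕ) + 1 = (j : ℕ) ∧ (j : ℕ) + 1 < n ∧
          w = FreeGroup.of i * FreeGroup.of j * FreeGroup.of i *
              (FreeGroup.of j * FreeGroup.of i * FreeGroup.of j)⁻¹) ∨
       (∃ i j : Fin n, (i : ℕ) + 2 = n ∧ (j : ℕ) + 1 = n ∧
          w = FreeGroup.of i * FreeGroup.of j * FreeGroup.of i * FreeGroup.of j *
              (FreeGroup.of j * FreeGroup.of i * FreeGroup.of j * FreeGroup.of i)⁻¹) ∨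
       (∃ i j : Fin n, (i : ℕ) + 2 ≤ (j : ℕ) ∧
          w = FreeGroup.of i * FreeGroup.of j * (FreeGroup.of j * FreeGroup.of i)⁻¹)}

/-- The Artin group `A[Bₙ]` of type `Bₙ`. -/
abbrev ArtinB (n : ℕ) := PresentedGroup (BnRels n)

/-- The standard generator `r_i` (1-indexed, `1 ≤ i ≤ n`). -/
def rB (n i : ℕ) : ArtinB n :=
  if h : i - 1 < n then PresentedGroup.of ⟨i - 1, h⟩ else 1

/-- `ρ_B = r_1 r_2 ⋯ r_n`. -/
def ρB (n : ℕ) : ArtinB n := ((List.range n).map fun i => rB n (i + 1)).prod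

/-- `Δ_B = ρ_B ^ n`, the generator of the center. -/
def ΔB (n : ℕ) : ArtinB n := ρB n ^ n

/-- `t_i` for `i` read modulo `n`: `t_i = r_i` for `1 ≤ i ≤ n-1`,
and `t_0 = ρ_B r_{n-1} ρ_B⁻¹`. -/
def tB (n i : ℕ) : ArtinB n :=
  if i % n = 0 then ρB n * rB n (n - 1) * (ρB n)⁻¹ else rB n (i % n)

/-- `Δ_Y = (t_1⋯t_{n-1})(t_1⋯t_{n-2})⋯(t_1t_2)t_1`, the Garside element of the
parabolic subgroup of type `A_{n-1}`. -/
def ΔY (n : ℕ) : ArtinB n :=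
  ((List.range (n - 1)).map fun k =>
    ((List.range (n - 1 - k)).map fun i => rB n (i + 1)).prod).prod

/-- `ρ_0 = t_1 t_2 ⋯ t_{n-1}`. -/
def ρ₀B (n : ℕ) : ArtinB n := ((List.range (n - 1)).map fun i => rB n (i + 1)).prod

/-- `ρ_1 = t_1⁻¹ t_2⁻¹ ⋯ t_{n-1}⁻¹`. -/
def ρ₁B (n : ℕ) : ArtinB n := ((List.range (n - 1)).map fun i => (rB n (i + 1))⁻¹).prod

/-- `ρ_k` for `k ∈ {0,1}`. -/
def ρkB (n k : ℕ) : ArtinB n := if k = 0 then ρ₀B n else ρ₁B n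

/-- `v_k = ρ_k t_{n-1} ρ_k⁻¹` for `k ∈ {0,1}`. -/
def vB (n k : ℕ) : ArtinB n := ρkB n k * rB n (n - 1) * (ρkB n k)⁻¹

/-- `δ = r_{n-1} r_{n-2} ⋯ r_2 r_1² r_2 ⋯ r_{n-2} r_{n-1}`. -/
def δB (n : ℕ) : ArtinB n :=
  ((List.range (n - 2)).map fun i => rB n (n - 1 - i)).prod * rB n 1 ^ 2 *
  ((List.range (n - 2)).map fun i => rB n (i + 2)).prod

/-- The quotient `Ā = A[Bₙ]/Z(A[Bₙ])`. -/
abbrev AbarB (n : ℕ) := ArtinB n ⧸ Subgroup.center (ArtinB n)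

/-- The canonical projection `π : A[Bₙ] → Ā`. -/
def πB (n : ℕ) : ArtinB n →* AbarB n := QuotientGroup.mk' (Subgroup.center (ArtinB n))

/-- `t̄_i = π(t_i)`. -/
def tbar (n i : ℕ) : AbarB n := πB n (tB n i)

/-- `ρ̄_B = π(ρ_B)`. -/
def ρbar (n : ℕ) : AbarB n := πB n (ρB n)

/-- The composition `conj_x ∘ φ` of an endomorphism with an inner automorphism. -/
def conjComp {G : Type*} [Group G] (x : G) (φ : G →* G) : G →* G :=
  (MulAut.conj x).toMonoidHom.comp φ

/-- Type (1): there are commuting `g, h` with `φ(t_i) = g` for all `0 ≤ i ≤ n-1`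
and `φ(ρ_B) = h`. -/
def IsType1 (n : ℕ) (φ : ArtinB n →* ArtinB n) : Prop :=
  ∃ g h : ArtinB n, g * h = h * g ∧ (∀ i < n, φ (tB n i) = g) ∧ φ (ρB n) = h

/-- Type (2a) with parameters `ε ∈ {1,-1}`, `p q : ℤ`. -/
def IsType2a (n : ℕ) (ε p q : ℤ) (φ : ArtinB n →* ArtinB n) : Prop :=
  (ε = 1 ∨ ε = -1) ∧ (∀ i < n, φ (tB n i) = tB n i ^ ε * ΔB n ^ p) ∧
    φ (ρB n) = ρB n * ΔB n ^ q

/-- Type (2b) with parameters `ε ∈ {1,-1}`, `p q : ℤ`. -/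
def IsType2b (n : ℕ) (ε p q : ℤ) (φ : ArtinB n →* ArtinB n) : Prop :=
  (ε = 1 ∨ ε = -1) ∧ (∀ i < n, φ (tB n i) = tB n (n - i) ^ ε * ΔB n ^ p) ∧
    φ (ρB n) = (ρB n)⁻¹ * ΔB n ^ q

/-- Type (3) with parameters `ε ∈ {1,-1}`, `k ∈ {0,1}`, `p q r s : ℤ`. -/
def IsType3 (n : ℕ) (ε : ℤ) (k : ℕ) (p q r s : ℤ) (φ : ArtinB n →* ArtinB n) : Prop :=
  (ε = 1 ∨ ε = -1) ∧ (k = 0 ∨ k = 1) ∧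
    (∀ i, 1 ≤ i → i ≤ n - 1 → φ (tB n i) = tB n i ^ ε * ΔY n ^ (2 * p) * ΔB n ^ q) ∧
    φ (tB n 0) = vB n k ^ ε * ΔY n ^ (2 * p) * ΔB n ^ q ∧
    φ (ρB n) = ρkB n k * ΔY n ^ (2 * r) * ΔB n ^ s

namespace FreeGroup

variable {α : Type*}

theorem subsingleton_of_central {g : FreeGroup α} (hg : g ≠ 1) (hc : ∀ h, Commute g h) :
    Subsingleton α := by
  classical
  by_contra hns
  rw [not_subsingleton_iff_nontrivial] at hns
  have hne : g.toWord ≠ [] := by rwa [Ne, toWord_eq_nil_iff]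
  obtain ⟨b, hb⟩ := exists_ne (g.toWord.head hne).1
  obtain ⟨δ, hδ⟩ : ∃ δ, IsReduced (g.toWord ++ [(b, δ)]) := by
    refine ⟨(g.toWord.getLast hne).2, ?_⟩
    rw [IsReduced, List.isChain_append]
    refine ⟨isReduced_toWord, List.isChain_singleton _, ?_⟩
    intro x hx y hy
    rw [List.getLast?_eq_getLast_of_ne_nil hne] at hx
    simp at hx hy
    subst hx hy
    simp
  have h1 : (g * mk [(b, δ)]).toWord = g.toWord ++ [(b, δ)] := by
    rw [toWord_mul, toWord_mk, reduce_singleton, hδ.reduce_eq]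
  have hcons : IsReduced ((b, δ) :: g.toWord) := by
    rw [IsReduced, List.isChain_cons]
    refine ⟨?_, isReduced_toWord⟩
    intro y hy h
    rw [List.head?_eq_some_head hne] at hy
    simp at hy
    subst hy
    exact absurd h hb
  have h2 : (mk [(b, δ)] * g).toWord = (b, δ) :: g.toWord := by
    rw [toWord_mul, toWord_mk, reduce_singleton, List.singleton_append, hcons.reduce_eq]
  rw [← (hc (mk [(b, δ)])).eq, h1] at h2
  have := congrArg List.head? h2
  rw [List.head?_append, List.head?_eq_some_head hne] at this
  simp at this
  rw [this] at hb
  exact hb rfl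

theorem commute_trans {a b c : FreeGroup α} (ha : a ≠ 1) (hb : Commute a b) (hc : Commute a c) :
    Commute b c := by
  classical
  let C := Subgroup.centralizer ({a} : Set (FreeGroup α))
  have hmem : ∀ x, Commute a x → x ∈ C := by
    intro x hx
    rw [Subgroup.mem_centralizer_singleton_iff]
    exact hx.eq.symm
  let e := IsFreeGroup.toFreeGroup C
  have hss : Subsingleton (IsFreeGroup.Generators C) := by
    apply subsingleton_of_central (g := e ⟨a, hmem a (Commute.refl a)⟩)
    · intro h
      rw [map_eq_one_iff e e.injective] at h
      exact ha (congrArg Subtype.val h)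
    · intro h
      obtain ⟨y, rfl⟩ := e.surjective h
      refine Commute.map ?_ e
      have := (Subgroup.mem_centralizer_singleton_iff.mp y.2)
      exact Subtype.ext this.symm
  have key : ∀ x y : FreeGroup (IsFreeGroup.Generators C), Commute x y := by
    intro x y
    induction x using FreeGroup.induction_on with
    | C1 => exact Commute.one_left y
    | of i =>
      induction y using FreeGroup.induction_on with
      | C1 => exact Commute.one_right _
      | of j => rw [Subsingleton.elim i j]
      | inv_of j h => exact h.inv_right
      | mul x y hx hy => exact hx.mul_right hy
    | inv_of i h => exact h.inv_left
    | mul x y hx hy => exact hx.mul_left hy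
  have := (key (e ⟨b, hmem b hb⟩) (e ⟨c, hmem c hc⟩))
  have h2 := this.map (e.symm)
  simp only [MulEquiv.symm_apply_apply] at h2
  exact congrArg Subtype.val h2.eq

theorem commute_of_commute_zpow {a b : FreeGroup α} {k : ℤ} (hk : k ≠ 0)
    (h : Commute a (b ^ k)) : Commute a b := by
  by_cases hb : b = 1
  · subst hb; exact Commute.one_right a
  · refine commute_trans (a := b ^ k) ?_ h.symm (Commute.refl b |>.zpow_left k)
    intro h1
    exact hb ((IsMulTorsionFree.zpow_eq_one_iff_left hk).mp h1)

theorem mem_zpowers_of_commute (i : α) : ∀ {g : FreeGroup α}, Commute g (of i) →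
    g ∈ Subgroup.zpowers (of i) := by
  classical
  suffices H : ∀ n, ∀ g : FreeGroup α, norm g = n → Commute g (of i) →
      g ∈ Subgroup.zpowers (of i) from fun {g} h => H _ g rfl h
  intro n
  induction n using Nat.strong_induction_on with
  | _ n ih =>
  intro g hn hg
  rcases hw : g.toWord with _ | ⟨⟨j, ε⟩, t⟩
  · rw [toWord_eq_nil_iff] at hw
    rw [hw]; exact one_mem _
  · have hgw : g = mk [(j, ε)] * mk t := by
      rw [← mk_toWord (x := g), hw, mul_mk]; rfl
    have ht : IsReduced t := by
      have := isReduced_toWord (x := g)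
      rw [hw] at this
      exact (List.isChain_cons.mp this).2
    by_cases hij : j = i
    · subst hij
      have hl : mk [(j, ε)] ∈ Subgroup.zpowers (of j) := by
        cases ε
        · exact Subgroup.inv_mem _ (Subgroup.mem_zpowers (of j))
        · exact Subgroup.mem_zpowers (of j)
      rw [hgw]
      refine mul_mem hl (ih (norm (mk t)) ?_ _ rfl ?_)
      · rw [← hn, norm, norm, hw, toWord_mk, ht.reduce_eq]; simp
      · have : mk t = (mk [(j, ε)])⁻¹ * g := by rw [hgw]; group
        rw [this]
        refine Commute.mul_left (Commute.inv_left ?_) hg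
        obtain ⟨k, hk⟩ := hl
        rw [← hk]
        exact (Commute.refl _).zpow_left k
    · exfalso
      have hcons : IsReduced ((i, true) :: g.toWord) := by
        rw [IsReduced, List.isChain_cons]
        refine ⟨?_, isReduced_toWord⟩
        intro y hy h
        rw [hw] at hy
        simp at hy
        subst hy
        exact absurd h.symm hij
      have h2 : (of i * g).toWord = (i, true) :: g.toWord := by
        rw [toWord_mul, toWord_of, List.singleton_append, hcons.reduce_eq]
      have h3 : (g * of i).toWord.Sublist (g.toWord ++ [(i, true)]) := by
        have := toWord_mul_sublist g (of i)
        rwa [toWord_of] at this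
      rw [hg.eq, h2] at h3
      have h4 := h3.eq_of_length (by simp)
      rw [hw] at h4
      simp at h4
      exact hij h4.1.1.symm

theorem norm_mk_of_isReduced [DecidableEq α] {L : List (α × Bool)} (h : IsReduced L) :
    norm (mk L) = L.length := by
  rw [norm, toWord_mk, h.reduce_eq]

end FreeGroup

namespace FreeGroup

variable {α : Type*}

section Fox

variable [DecidableEq α] (N : Subgroup (FreeGroup α)) [N.Normal] (x : α)

/-- Left translation of finitely supported functions on the quotient. -/
noncomputable def foxTrans (c : FreeGroup α ⧸ N) :
    ((FreeGroup α ⧸ N) →₀ ℤ) ≃+ ((FreeGroup α ⧸ N) →₀ ℤ) :=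
  Finsupp.domCongr (Equiv.mulLeft c)

omit [DecidableEq α] in
theorem foxTrans_apply (c d : FreeGroup α ⧸ N) (f : (FreeGroup α ⧸ N) →₀ ℤ) :
    foxTrans N c f d = f (c⁻¹ * d) := rfl

/-- The affine action encoding the Fox derivative with respect to the letter `x`,
with coefficients in the group ring of the quotient. -/
noncomputable def foxAffine : FreeGroup α →* Equiv.Perm ((FreeGroup α ⧸ N) →₀ ℤ) :=
  FreeGroup.lift fun y => (foxTrans N (QuotientGroup.mk' N (of y))).toEquiv.trans
    (Equiv.addLeft (if y = x then Finsupp.single 1 1 else 0))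

/-- The Fox derivative with respect to `x`, reduced modulo `N`. -/
noncomputable def fox (g : FreeGroup α) : (FreeGroup α ⧸ N) →₀ ℤ := foxAffine N x g 0

theorem foxAffine_of (y : α) (f : (FreeGroup α ⧸ N) →₀ ℤ) :
    foxAffine N x (of y) f = (if y = x then Finsupp.single 1 1 else 0) +
      foxTrans N (of y : FreeGroup α) f := by
  simp [foxAffine]

theorem foxAffine_apply (g : FreeGroup α) : ∀ f : (FreeGroup α ⧸ N) →₀ ℤ,
    foxAffine N x g f = fox N x g + foxTrans N (g : FreeGroup α ⧸ N) f := by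
  induction g using FreeGroup.induction_on with
  | C1 => intro f; ext d; simp [fox, foxTrans_apply]
  | of y => intro f; rw [fox, foxAffine_of, foxAffine_of]; simp
  | inv_of y h =>
    intro f
    rw [fox, _root_.map_inv]
    rw [Equiv.Perm.inv_eq_iff_eq]
    rw [h, map_add]
    ext d
    have h2 := DFunLike.congr_fun (h ((foxAffine N x (of y))⁻¹ 0)) d
    simp [foxTrans_apply] at h2 ⊢
    linarith
  | mul g h hg hh =>
    intro f
    rw [_root_.map_mul, Equiv.Perm.mul_apply, hh, hg, map_add]
    have : fox N x (g * h) = fox N x g + foxTrans N (g : FreeGroup α ⧸ N) (fox N x h) := by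
      rw [← hg]; simp [fox]
    rw [this]
    ext d
    simp [foxTrans_apply, mul_assoc]
    ring

theorem fox_mul (g h : FreeGroup α) :
    fox N x (g * h) = fox N x g + foxTrans N (g : FreeGroup α ⧸ N) (fox N x h) := by
  rw [← foxAffine_apply]; simp [fox]

theorem fox_one : fox N x 1 = 0 := by simp [fox]

theorem fox_of (y : α) : fox N x (of y) = if y = x then Finsupp.single 1 1 else 0 := by
  rw [fox, foxAffine_of]; simp

theorem fox_mul_apply (g h : FreeGroup α) (c : FreeGroup α ⧸ N) :
    fox N x (g * h) c = fox N x g c + fox N x h ((g : FreeGroup α ⧸ N)⁻¹ * c) := by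
  rw [fox_mul]; rfl

theorem fox_inv_apply (g : FreeGroup α) (c : FreeGroup α ⧸ N) :
    fox N x g⁻¹ c = - fox N x g ((g : FreeGroup α ⧸ N) * c) := by
  have := fox_mul_apply N x g⁻¹ g c
  simp [fox_one] at this
  linarith

open Classical in
theorem fox_letter_apply (y : α) (ε : Bool) (c : FreeGroup α ⧸ N) :
    fox N x (mk [(y, ε)]) c = if y = x then
      (if ε then (if c = 1 then 1 else 0) else
        (if c = (QuotientGroup.mk (mk [(y, ε)]) : FreeGroup α ⧸ N) then -1 else 0)) else 0 := by
  cases ε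
  · have : (mk [(y, false)]) = (of y)⁻¹ := rfl
    rw [this, fox_inv_apply, fox_of]
    by_cases h : y = x
    · simp only [h, if_true, Finsupp.single_apply]
      by_cases hc : c = ((of x)⁻¹ : FreeGroup α)
      · simp [hc]
      · have : ¬ (1 : FreeGroup α ⧸ N) = (of x : FreeGroup α) * c := by
          intro h'
          apply hc
          rw [QuotientGroup.mk_inv, eq_inv_iff_mul_eq_one]
          rw [eq_comm, mul_eq_one_iff_eq_inv] at h'
          rw [h']; simp
        rw [QuotientGroup.mk_inv] at hc
        simp [hc, this]
    · simp [h]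
  · have : (mk [(y, true)]) = of y := rfl
    rw [this, fox_of]
    by_cases h : y = x
    · simp [h, Finsupp.single_apply, eq_comm]
    · simp [h]

theorem exists_prefix_of_fox_ne_zero (L : List (α × Bool)) : ∀ c : FreeGroup α ⧸ N,
    fox N x (mk L) c ≠ 0 → (∃ A B, L = A ++ (x, true) :: B ∧ (mk A : FreeGroup α) = c) ∨
      ∃ A B, L = A ++ (x, false) :: B ∧ (mk (A ++ [(x, false)]) : FreeGroup α) = c := by
  induction L with
  | nil => intro c h; exact absurd (by rw [← one_eq_mk, fox_one]; rfl) h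
  | cons l t ih =>
    intro c h
    obtain ⟨y, ε⟩ := l
    have hm : (mk ((y, ε) :: t) : FreeGroup α) = mk [(y, ε)] * mk t := by rw [mul_mk]; rfl
    rw [hm, fox_mul_apply] at h
    by_cases h2 : fox N x (mk t) ((QuotientGroup.mk (mk [(y, ε)]) : FreeGroup α ⧸ N)⁻¹ * c) = 0
    · rw [h2, add_zero, fox_letter_apply] at h
      by_cases hy : y = x
      · subst hy
        cases ε
        · right
          refine ⟨[], t, rfl, ?_⟩
          by_contra hc
          rw [eq_comm] at hc
          simp at h
          exact hc h
        · left
          refine ⟨[], t, rfl, ?_⟩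
          by_contra hc
          have : (mk [] : FreeGroup α) = 1 := rfl
          rw [this, QuotientGroup.mk_one, eq_comm] at hc
          simp [hc] at h
      · simp [hy] at h
    · rcases ih _ h2 with ⟨A, B, rfl, hA⟩ | ⟨A, B, rfl, hA⟩
      · left
        refine ⟨(y, ε) :: A, B, rfl, ?_⟩
        have : (mk ((y, ε) :: A) : FreeGroup α) = mk [(y, ε)] * mk A := by rw [mul_mk]; rfl
        rw [this, QuotientGroup.mk_mul, hA]; group
      · right
        refine ⟨(y, ε) :: A, B, rfl, ?_⟩
        have : (mk ((y, ε) :: A ++ [(x, false)]) : FreeGroup α) =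
          mk [(y, ε)] * mk (A ++ [(x, false)]) := by rw [mul_mk]; rfl
        rw [this, QuotientGroup.mk_mul, hA]; group

theorem exists_fox_ne_zero (hN : N ≠ ⊥) : ∃ w ∈ N, ∃ x c, fox N x w c ≠ 0 := by
  classical
  have hex : ∃ k, ∃ w ∈ N, w ≠ 1 ∧ norm w = k := by
    obtain ⟨w, h1⟩ := Subgroup.ne_bot_iff_exists_ne_one.mp hN
    exact ⟨_, w, w.2, fun h' => h1 (Subtype.ext h'), rfl⟩
  obtain ⟨w, hw, h1, hk⟩ := Nat.find_spec hex
  have hmin : ∀ v ∈ N, v ≠ 1 → norm w ≤ norm v := by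
    intro v hv hv1
    rw [hk]
    exact Nat.find_min' hex ⟨v, hv, hv1, rfl⟩
  have hminL : ∀ L : List (α × Bool), IsReduced L → L ≠ [] → mk L ∈ N →
      w.toWord.length ≤ L.length := by
    intro L hL hne hLN
    rw [← norm_mk_of_isReduced hL]
    refine hmin _ hLN ?_
    intro h
    have := norm_mk_of_isReduced hL
    rw [h, norm_one] at this
    exact hne (List.length_eq_zero_iff.mp this.symm)
  have hred := isReduced_toWord (x := w)
  refine ⟨w, hw, ?_⟩
  rcases hL : w.toWord with _ | ⟨⟨x, ε⟩, t⟩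
  · exact absurd (toWord_eq_nil_iff.mp hL) h1
  rw [hL] at hred hminL
  have hm : w = mk [(x, ε)] * mk t := by rw [mul_mk, ← mk_toWord (x := w), hL]; rfl
  have segment_red : ∀ L : List (α × Bool), L <:+: (x, ε) :: t → IsReduced L := by
    rintro L ⟨a, b, e⟩
    rw [← e] at hred
    exact (List.IsChain.left_of_append hred).right_of_append
  cases ε
  · refine ⟨x, QuotientGroup.mk (mk [(x, false)]), ?_⟩
    rw [hm, fox_mul_apply, fox_letter_apply]
    simp only [inv_mul_cancel, if_true]
    intro h0
    have h2 : fox N x (mk t) 1 ≠ 0 := by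
      intro h; rw [h] at h0; simp at h0
    rcases exists_prefix_of_fox_ne_zero N x t 1 h2 with ⟨A, B, rfl, hA⟩ | ⟨A, B, rfl, hA⟩
    · rw [QuotientGroup.eq_one_iff] at hA
      by_cases hAe : A = []
      · subst hAe
        simp [IsReduced] at hred
      · have := hminL A (segment_red _ ⟨[(x, false)], (x, true) :: B, by simp⟩) hAe hA
        simp at this
    · rw [QuotientGroup.eq_one_iff] at hA
      have := hminL _ (segment_red _ ⟨[(x, false)], B, by simp⟩) (by simp) hA
      simp at this
  · refine ⟨x, 1, ?_⟩
    rw [hm, fox_mul_apply, fox_letter_apply]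
    intro h0
    have h2 : fox N x (mk t) ((QuotientGroup.mk (mk [(x, true)]) : FreeGroup α ⧸ N)⁻¹) ≠ 0 := by
      intro h; rw [mul_one, h] at h0; simp at h0
    rcases exists_prefix_of_fox_ne_zero N x t _ h2 with ⟨A, B, rfl, hA⟩ | ⟨A, B, rfl, hA⟩
    · rw [eq_inv_iff_mul_eq_one, ← QuotientGroup.mk_mul, QuotientGroup.eq_one_iff,
        (inferInstance : N.Normal).mem_comm_iff, mul_mk] at hA
      have := hminL _ (segment_red _ ⟨[], (x, true) :: B, by simp⟩) (by simp) hA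
      simp at this
    · rw [eq_inv_iff_mul_eq_one, ← QuotientGroup.mk_mul, QuotientGroup.eq_one_iff,
        (inferInstance : N.Normal).mem_comm_iff, mul_mk] at hA
      have h3 := hminL _ (segment_red _ ⟨[], B, by simp⟩) (by simp) hA
      have hB : B = [] := by
        simpa using h3
      subst hB
      have hA2 : mk A ∈ N := by
        have : mk ([(x, true)] ++ (A ++ [(x, false)])) = of x * mk A * (of x)⁻¹ := by
          rw [← mul_mk, ← mul_mk]; simp [of, inv_mk, invRev]
        rw [this] at hA
        have := (inferInstance : N.Normal).conj_mem _ hA (of x)⁻¹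
        simpa [mul_assoc] using this
      by_cases hAe : A = []
      · subst hAe
        simp [IsReduced] at hred
      · have := hminL A (segment_red _ ⟨[(x, true)], [(x, false)], by simp⟩) hAe hA2
        simp at this

/-- A nontrivial finitely generated normal subgroup of a free group contains a nontrivial
power of every element. -/
theorem exists_zpow_mem_of_fg (hfg : N.FG) (hN : N ≠ ⊥) (g : FreeGroup α) :
    ∃ M : ℤ, M ≠ 0 ∧ g ^ M ∈ N := by
  classical
  obtain ⟨w, hw, x, c, hc⟩ := exists_fox_ne_zero N hN
  obtain ⟨S, hS⟩ := hfg
  have hmul : ∀ u ∈ N, ∀ v, fox N x (u * v) = fox N x u + fox N x v := by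
    intro u hu v
    ext d
    rw [fox_mul_apply, (QuotientGroup.eq_one_iff u).mpr hu]
    simp
  let E := S.biUnion fun s => (fox N x s).support
  have hE : ∀ u ∈ N, (fox N x u).support ⊆ E := by
    intro u hu
    rw [← hS] at hu
    induction hu using Subgroup.closure_induction with
    | mem s hs => exact Finset.subset_biUnion_of_mem (fun s => (fox N x s).support) hs
    | one => simp [fox_one]
    | mul u v hu hv ihu ihv =>
      rw [hS] at hu hv
      rw [hmul u hu]
      exact Finsupp.support_add.trans (Finset.union_subset ihu ihv)
    | inv u hu ihu =>
      rw [hS] at hu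
      have : fox N x u⁻¹ = - fox N x u := by
        have := hmul u hu u⁻¹
        rw [mul_inv_cancel, fox_one] at this
        exact (neg_eq_of_add_eq_zero_right this.symm).symm
      rw [this, Finsupp.support_neg]
      exact ihu
  have hmemE : ∀ k : ℤ, ((g ^ k : FreeGroup α) : FreeGroup α ⧸ N) * c ∈ E := by
    intro k
    apply hE (g ^ k * w * (g ^ k)⁻¹) ((inferInstance : N.Normal).conj_mem _ hw _)
    rw [Finsupp.mem_support_iff, fox_mul_apply, fox_mul_apply, fox_inv_apply,
      QuotientGroup.mk_mul, (QuotientGroup.eq_one_iff w).mpr hw]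
    simpa using hc
  have hninj : ¬ Function.Injective fun k : ℤ => (⟨_, hmemE k⟩ : E) :=
    not_injective_infinite_finite _
  rw [Function.Injective] at hninj
  push Not at hninj
  obtain ⟨k, l, hkl, hne⟩ := hninj
  refine ⟨l - k, sub_ne_zero.mpr hne.symm, ?_⟩
  have := mul_right_cancel (Subtype.ext_iff.mp hkl)
  rw [zpow_sub, (inferInstance : N.Normal).mem_comm_iff]
  exact QuotientGroup.eq.mp this

end Fox

theorem eq_bot_of_fg_le_ker {N : Subgroup (FreeGroup α)} (hn : N.Normal) (hfg : N.FG)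
    {G : Type*} [Group G] [IsMulTorsionFree G] (ψ : FreeGroup α →* G) (hψ : ψ ≠ 1)
    (hle : N ≤ ψ.ker) : N = ⊥ := by
  classical
  by_contra hN
  apply hψ
  ext g
  obtain ⟨M, hM, hg⟩ := exists_zpow_mem_of_fg N hfg hN (of g)
  have := hle hg
  rw [MonoidHom.mem_ker, _root_.map_zpow, IsMulTorsionFree.zpow_eq_one_iff_left hM] at this
  simpa using this

end FreeGroup

namespace ArtinBAut

/-- A sequence `s 0, …, s (N-1)` satisfying the braid relations. -/
structure IsBraid {G : Type*} [Group G] (N : ℕ) (s : ℕ → G) : Prop where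
  braid : ∀ i, i + 1 < N → s i * s (i + 1) * s i = s (i + 1) * s i * s (i + 1)
  comm : ∀ i j, i + 2 ≤ j → j < N → Commute (s i) (s j)

section Generic

variable {G : Type*} [Group G]

theorem IsBraid.mono {N M : ℕ} {s : ℕ → G} (h : IsBraid N s) (hM : M ≤ N) : IsBraid M s :=
  ⟨fun i hi => h.braid i (by omega), fun i j hij hj => h.comm i j hij (by omega)⟩

theorem IsBraid.map {N : ℕ} {s : ℕ → G} (h : IsBraid N s) {H : Type*} [Group H] (f : G →* H) :
    IsBraid N fun i => f (s i) :=
  ⟨fun i hi => by simp only [← map_mul, h.braid i hi],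
    fun i j hij hj => (h.comm i j hij hj).map f⟩

/-- The descending product `s (k-1) ⋯ s j`. -/
def desc (s : ℕ → G) (j : ℕ) : ℕ → G
  | 0 => 1
  | k + 1 => if j ≤ k then s k * desc s j k else 1

theorem desc_succ (s : ℕ → G) {j k : ℕ} (h : j ≤ k) : desc s j (k + 1) = s k * desc s j k := by
  simp [desc, h]

theorem desc_of_le (s : ℕ → G) {j k : ℕ} (h : k ≤ j) : desc s j k = 1 := by
  cases k with
  | zero => rfl
  | succ k => simp [desc, show ¬ j ≤ k by omega]

theorem desc_mul (s : ℕ → G) {j l k : ℕ} (h1 : j ≤ l) (h2 : l ≤ k) :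
    desc s l k * desc s j l = desc s j k := by
  induction k, h2 using Nat.le_induction with
  | base => rw [desc_of_le s le_rfl, one_mul]
  | succ k hk ih => rw [desc_succ s hk, desc_succ s (h1.trans hk), mul_assoc, ih]

theorem desc_left (s : ℕ → G) {j k : ℕ} (h : j < k) : desc s j k = desc s (j + 1) k * s j := by
  rw [← desc_mul s (Nat.le_succ j) h, desc_succ s le_rfl, desc_of_le s le_rfl, mul_one]

theorem commute_desc {s : ℕ → G} {g : G} {j k : ℕ}
    (h : ∀ i, j ≤ i → i < k → Commute g (s i)) : Commute g (desc s j k) := by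
  induction k with
  | zero => exact Commute.one_right g
  | succ k ih =>
    by_cases hjk : j ≤ k
    · rw [desc_succ s hjk]
      exact (h k hjk k.lt_succ_self).mul_right (ih fun i hi hk => h i hi (by omega))
    · rw [desc_of_le s (by omega)]; exact Commute.one_right g

theorem IsBraid.map_conj {N : ℕ} {s : ℕ → G} (h : IsBraid N s) {i : ℕ} (hi : i + 1 < N) :
    s i * s (i + 1) * s i * (s i * s (i + 1))⁻¹ = s (i + 1) := by
  rw [h.braid i hi]; group

/-- Data of a braid sequence together with an element completing it to type `B`. -/
structure IsBraidB (M : ℕ) (s : ℕ → G) (z : G) : Prop where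
  isBraid : IsBraid M s
  comm : ∀ i, i + 2 ≤ M → Commute (s i) z
  four : ∀ i, i + 1 = M → s i * z * s i * z = z * s i * z * s i

/-- The conjugates `s j⁻¹ ⋯ s (M-1)⁻¹ z s (M-1) ⋯ s j`. -/
def tuple (s : ℕ → G) (z : G) (M j : ℕ) : G := (desc s j M)⁻¹ * z * desc s j M

theorem tuple_self (s : ℕ → G) (z : G) (M : ℕ) : tuple s z M M = z := by
  simp [tuple, desc_of_le s le_rfl]

theorem tuple_eq (s : ℕ → G) (z : G) {M j : ℕ} (h : j < M) :
    tuple s z M j = (s j)⁻¹ * tuple s z M (j + 1) * s j := by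
  rw [tuple, tuple, desc_left s h]; group

namespace IsBraidB

variable {M : ℕ} {s : ℕ → G} {z : G} (h : IsBraidB M s z)

include h

theorem commute_gt {i j : ℕ} (hij : i + 2 ≤ j) (hj : j ≤ M) : Commute (s i) (tuple s z M j) := by
  have h1 : Commute (s i) (desc s j M) :=
    commute_desc fun k hk hk2 => h.isBraid.comm i k (by omega) hk2
  exact (h1.inv_right.mul_right (h.comm i (by omega))).mul_right h1

theorem commute_lt {i j : ℕ} (hij : j < i) (hi : i < M) : Commute (s i) (tuple s z M j) := by
  obtain ⟨i, rfl⟩ : ∃ k, i = k + 1 := ⟨i - 1, by omega⟩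
  have key : Commute (s (i + 1)) (tuple s z M i) := by
    have h1 := h.commute_gt (i := i) (j := i + 2) le_rfl (by omega)
    rw [tuple_eq s z (show i < M by omega), tuple_eq s z (show i + 1 < M by omega)]
    have e1 : s (i + 1) = (s (i + 1) * s i)⁻¹ * s i * (s (i + 1) * s i) := by
      have := h.isBraid.braid i hi
      rw [mul_assoc, inv_mul_eq_iff_eq_mul.mpr]
      rw [← mul_assoc, this]
    have e2 : (s i)⁻¹ * ((s (i + 1))⁻¹ * tuple s z M (i + 1 + 1) * s (i + 1)) * s i =
      (s (i + 1) * s i)⁻¹ * tuple s z M (i + 1 + 1) * (s (i + 1) * s i) := by group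
    rw [e2]
    nth_rewrite 1 [e1]
    have := (Commute.conj_iff (s (i + 1) * s i)⁻¹).mpr h1
    rwa [inv_inv] at this
  have h2 : tuple s z M j = (desc s j i)⁻¹ * tuple s z M i * desc s j i := by
    rw [tuple, tuple, ← desc_mul s (show j ≤ i by omega) (show i ≤ M by omega)]; group
  rw [h2]
  have h3 : Commute (s (i + 1)) (desc s j i) :=
    commute_desc fun k _ hk => (h.isBraid.comm k (i + 1) (by omega) hi).symm
  exact (h3.inv_right.mul_right key).mul_right h3

theorem four_tuple {i : ℕ} (hi : i < M) :
    s i * tuple s z M (i + 1) * s i * tuple s z M (i + 1) =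
      tuple s z M (i + 1) * s i * tuple s z M (i + 1) * s i := by
  obtain ⟨d, hd⟩ : ∃ d, M = i + 1 + d := ⟨M - (i + 1), by omega⟩
  induction d generalizing i with
  | zero =>
    have : M = i + 1 := hd
    have h4 := h.four i this.symm
    rw [← this, tuple_self]
    exact h4
  | succ d ih =>
    have h1 := ih (i := i + 1) (by omega) (by omega)
    have h2 := h.commute_gt (i := i) (j := i + 2) le_rfl (by omega)
    set c := (s i * s (i + 1))⁻¹ with hc
    have e1 : s i = c * s (i + 1) * c⁻¹ := by
      have := h.isBraid.map_conj (i := i) (by omega)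
      calc s i = c * (s i * s (i + 1) * s i * (s i * s (i + 1))⁻¹) * c⁻¹ := by rw [hc]; group
        _ = _ := by rw [this]
    have e2 : tuple s z M (i + 1) = c * tuple s z M (i + 1 + 1) * c⁻¹ := by
      rw [tuple_eq s z (show i + 1 < M by omega), hc, inv_inv, mul_inv_rev]
      have h2' : tuple s z M (i + 1 + 1) = (s i)⁻¹ * tuple s z M (i + 1 + 1) * s i := by
        rw [mul_assoc, ← h2.eq, inv_mul_cancel_left]
      nth_rewrite 1 [h2']
      group
    have e3 : ∀ a b : G, (c * a * c⁻¹) * (c * b * c⁻¹) * (c * a * c⁻¹) * (c * b * c⁻¹) =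
      c * (a * b * a * b) * c⁻¹ := by intro a b; group
    rw [e2]
    nth_rewrite 1 [e1]
    nth_rewrite 1 [e1]
    rw [e3, h1, ← e3, ← e1]

theorem conj_succ {i : ℕ} (hi : i < M) : s i * tuple s z M (i + 1) * (s i)⁻¹ =
    (tuple s z M (i + 1))⁻¹ * tuple s z M i * tuple s z M (i + 1) := by
  have := h.four_tuple hi
  rw [tuple_eq s z hi]
  generalize tuple s z M (i + 1) = y at *
  rw [mul_inv_eq_iff_eq_mul, ← mul_right_inj y, ← mul_right_inj (s i)]
  calc s i * (y * (s i * y)) = s i * y * s i * y := by group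
    _ = y * s i * y * s i := this
    _ = _ := by group

theorem conj_tuple {i j : ℕ} (hi : i < M) (hj : j ≤ M) : s i * tuple s z M j * (s i)⁻¹ =
    if j = i then tuple s z M (i + 1) else
    if j = i + 1 then (tuple s z M (i + 1))⁻¹ * tuple s z M i * tuple s z M (i + 1) else
    tuple s z M j := by
  split_ifs with h1 h2
  · subst h1
    rw [tuple_eq s z hi]; group
  · subst h2
    exact h.conj_succ hi
  · rw [mul_inv_eq_iff_eq_mul]
    rcases Nat.lt_or_ge j i with h3 | h3
    · exact h.commute_lt h3 hi
    · exact h.commute_gt (by omega) hj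

end IsBraidB

namespace IsBraid

variable {N : ℕ} {s : ℕ → G} (h : IsBraid N s)

include h

theorem isBraidB {m : ℕ} (hm : m < N) : IsBraidB m s (s m ^ 2) where
  isBraid := h.mono hm.le
  comm i hi := (h.comm i m hi hm).pow_right 2
  four i hi := by
    subst hi
    have hb := h.braid i hm
    generalize s i = a at *
    generalize s (i + 1) = b at *
    have key : a * b * b * a * b = b * (a * b * b * a) := by
      calc a * b * b * a * b = a * b * (b * a * b) := by group
        _ = a * b * a * (b * a) := by rw [← hb]; group
        _ = b * (a * b * b * a) := by rw [hb]; group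
    calc a * b ^ 2 * a * b ^ 2 = (a * b * b * a * b) * b := by simp only [pow_two, mul_assoc]
      _ = b * (a * b * b * a * b) := by nth_rewrite 1 [key]; simp only [mul_assoc]
      _ = b ^ 2 * a * b ^ 2 * a := by rw [key]; simp only [pow_two, mul_assoc]

/-- The standard generators `a_j` of the free normal subgroup at level `m+1`. -/
theorem desc_conj_sq {k m : ℕ} (hk : k ≤ m) (hm : m < N) :
    desc s k (m + 1) * s k ^ 2 * (desc s k (m + 1))⁻¹ = tuple s (s m ^ 2) m k := by
  obtain ⟨d, rfl⟩ := Nat.exists_eq_add_of_le hk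
  induction d generalizing k with
  | zero =>
    simp only [Nat.add_zero]
    rw [tuple_self, desc_succ s le_rfl, desc_of_le s le_rfl]; group
  | succ d ih =>
    have h1 := ih (k := k + 1) (by omega) (by omega)
    rw [show k + 1 + d = k + (d + 1) by omega] at h1
    have e0 : desc s (k + 1) (k + (d + 1) + 1) = desc s (k + 2) (k + (d + 1) + 1) * s (k + 1) :=
      desc_left s (by omega)
    have hcomm : Commute (s k) (desc s (k + 2) (k + (d + 1) + 1)) :=
      commute_desc fun i hi hi2 => h.comm k i hi (by omega)
    rw [tuple_eq s _ (by omega), ← h1, desc_left s (by omega : k < k + (d + 1) + 1), e0]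
    have hb := h.braid k (by omega)
    generalize desc s (k + 2) (k + (d + 1) + 1) = D at *
    generalize s k = a at *
    generalize s (k + 1) = b at *
    have e1 : b * a * a ^ 2 * (b * a)⁻¹ = a⁻¹ * b ^ 2 * a := by
      have e2 : (a * b) * a * (a * b)⁻¹ = b := by rw [hb]; group
      have e3 : b ^ 2 = (a * b) * a ^ 2 * (a * b)⁻¹ := by
        nth_rewrite 1 [← e2]; simp only [pow_two]; group
      rw [e3]; group
    have e4 : D * a⁻¹ = a⁻¹ * D := hcomm.inv_left.eq.symm
    calc D * b * a * a ^ 2 * (D * b * a)⁻¹ = D * (b * a * a ^ 2 * (b * a)⁻¹) * D⁻¹ := by group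
      _ = (D * a⁻¹) * b ^ 2 * (D * a⁻¹)⁻¹ := by rw [e1]; group
      _ = a⁻¹ * (D * b * b ^ 2 * (D * b)⁻¹) * a := by rw [e4]; group

theorem desc_mul_of_gt {k i m : ℕ} (hk : k ≤ i) (hi : i + 1 < m) (hm : m ≤ N) :
    desc s k m * s (i + 1) = s i * desc s k m := by
  have e1 : desc s k m = desc s (i + 2) m * (s (i + 1) * s i * desc s k i) := by
    rw [← desc_mul s (show k ≤ i + 2 by omega) (show i + 2 ≤ m by omega),
      desc_succ s (by omega), desc_succ s (by omega), mul_assoc (s (i + 1))]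
  have c1 : Commute (s (i + 1)) (desc s k i) :=
    commute_desc fun j _ hj => (h.comm j (i + 1) (by omega) (by omega)).symm
  have c2 : Commute (s i) (desc s (i + 2) m) :=
    commute_desc fun j hj hj2 => h.comm i j hj (by omega)
  rw [e1]
  calc desc s (i + 2) m * (s (i + 1) * s i * desc s k i) * s (i + 1)
      = desc s (i + 2) m * (s (i + 1) * s i) * (desc s k i * s (i + 1)) := by group
    _ = desc s (i + 2) m * (s (i + 1) * s i * s (i + 1)) * desc s k i := by rw [← c1.eq]; group
    _ = (desc s (i + 2) m * s i) * (s (i + 1) * s i) * desc s k i := by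
        rw [← h.braid i (by omega)]; group
    _ = _ := by rw [← c2.eq]; group

end IsBraid

/-- The subgroup generated by the first `m - 1` elements of a sequence. -/
def braidSub (s : ℕ → G) (m : ℕ) : Subgroup G := Subgroup.closure {g | ∃ i, i + 1 < m ∧ g = s i}

theorem mem_braidSub (s : ℕ → G) {i m : ℕ} (h : i + 1 < m) : s i ∈ braidSub s m :=
  Subgroup.subset_closure ⟨i, h, rfl⟩

theorem desc_mem_braidSub (s : ℕ → G) {j k m : ℕ} (h : k < m) : desc s j k ∈ braidSub s m := by
  induction k with
  | zero => exact one_mem _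
  | succ k ih =>
    by_cases hj : j ≤ k
    · rw [desc_succ s hj]
      exact mul_mem (mem_braidSub s h) (ih (by omega))
    · rw [desc_of_le s (by omega)]; exact one_mem _

theorem closure_induction_right_pm {S : Set G} {p : G → Prop} (one : p 1)
    (mul : ∀ g, p g → ∀ t ∈ S, p (g * t)) (inv : ∀ g, p g → ∀ t ∈ S, p (g * t⁻¹))
    {g : G} (hg : g ∈ Subgroup.closure S) : p g := by
  induction hg using Subgroup.closure_induction_right with
  | one => exact one
  | mul_right x _ y hy h => exact mul x h y hy
  | mul_inv_cancel x _ y hy h => exact inv x h y hy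

/-- The free normal subgroup of the pure braid group at level `m + 1`. -/
def topSub (s : ℕ → G) (m : ℕ) : Subgroup G :=
  Subgroup.closure {g | ∃ j, j ≤ m ∧ g = tuple s (s m ^ 2) m j}

theorem IsBraid.conj_mem_topSub {N : ℕ} {s : ℕ → G} (h : IsBraid N s) {m : ℕ} (hm : m < N)
    {b : G} (hb : b ∈ braidSub s (m + 1)) {u : G} (hu : u ∈ topSub s m) :
    b * u * b⁻¹ ∈ topSub s m := by
  have hT := h.isBraidB hm
  have hmem : ∀ j, j ≤ m → tuple s (s m ^ 2) m j ∈ topSub s m := fun j hj =>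
    Subgroup.subset_closure ⟨j, hj, rfl⟩
  have hgen : ∀ g, (∀ j ≤ m, g * tuple s (s m ^ 2) m j * g⁻¹ ∈ topSub s m) →
      ∀ u ∈ topSub s m, g * u * g⁻¹ ∈ topSub s m := by
    intro g hg
    have : topSub s m ≤ (topSub s m).comap (MulAut.conj g).toMonoidHom := by
      rw [topSub, Subgroup.closure_le]
      rintro _ ⟨j, hj, rfl⟩
      exact hg j hj
    exact fun u hu => this hu
  suffices ∀ u ∈ topSub s m, b * u * b⁻¹ ∈ topSub s m from this u hu
  refine closure_induction_right_pm (p := fun b => ∀ u ∈ topSub s m, b * u * b⁻¹ ∈ topSub s m)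
    (by simp) ?_ ?_ hb
  · rintro g hg _ ⟨i, hi, rfl⟩ u hu
    have := hg _ (hgen (s i) ?_ u hu)
    · simpa [mul_assoc] using this
    · intro j hj
      rw [hT.conj_tuple (by omega) hj]
      split_ifs
      · exact hmem _ (by omega)
      · exact mul_mem (mul_mem (inv_mem (hmem _ (by omega))) (hmem _ (by omega)))
          (hmem _ (by omega))
      · exact hmem _ hj
  · rintro g hg _ ⟨i, hi, rfl⟩ u hu
    have := hg _ (hgen (s i)⁻¹ ?_ u hu)
    · simpa [mul_assoc] using this
    · intro j hj
      have e0 := hT.conj_tuple (i := i) (j := i) (by omega) (by omega)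
      have e1 := hT.conj_tuple (i := i) (j := i + 1) (by omega) (by omega)
      simp at e0 e1
      rw [inv_inv]
      by_cases h1 : j = i + 1
      · subst h1
        rw [← e0]
        have : (s i)⁻¹ * (s i * tuple s (s m ^ 2) m i * (s i)⁻¹) * s i =
          tuple s (s m ^ 2) m i := by group
        rw [this]
        exact hmem _ (by omega)
      by_cases h2 : j = i
      · subst h2
        have : (s j)⁻¹ * tuple s (s m ^ 2) m j * s j =
            tuple s (s m ^ 2) m j * tuple s (s m ^ 2) m (j + 1) * (tuple s (s m ^ 2) m j)⁻¹ := by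
          have e3 : tuple s (s m ^ 2) m j = tuple s (s m ^ 2) m (j + 1) *
            (s j * tuple s (s m ^ 2) m (j + 1) * (s j)⁻¹) * (tuple s (s m ^ 2) m (j + 1))⁻¹ := by
            rw [e1]; group
          nth_rewrite 1 [e3]
          rw [← e0]; group
        rw [this]
        exact mul_mem (mul_mem (hmem _ hj) (hmem _ (by omega))) (inv_mem (hmem _ hj))
      · have e2 := hT.conj_tuple (i := i) (j := j) (by omega) (by omega)
        rw [if_neg h2, if_neg h1] at e2
        rw [← e2]
        have : (s i)⁻¹ * (s i * tuple s (s m ^ 2) m j * (s i)⁻¹) * s i =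
          tuple s (s m ^ 2) m j := by group
        rw [this]
        exact hmem _ hj

theorem IsBraid.combing {N : ℕ} {s : ℕ → G} (h : IsBraid N s) {m : ℕ} (hm : m < N) {β : G}
    (hβ : β ∈ braidSub s (m + 2)) : ∃ u ∈ topSub s m, ∃ b ∈ braidSub s (m + 1), ∃ k ≤ m + 1,
      β = u * b * desc s k (m + 1) := by
  have hmem : ∀ j, j ≤ m → tuple s (s m ^ 2) m j ∈ topSub s m := fun j hj =>
    Subgroup.subset_closure ⟨j, hj, rfl⟩
  have hsq : ∀ k, k ≤ m → desc s k (m + 1) * s k =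
      tuple s (s m ^ 2) m k * desc s (k + 1) (m + 1) := by
    intro k hk
    rw [← h.desc_conj_sq hk hm]
    have e := desc_left s (show k < m + 1 by omega)
    generalize desc s k (m + 1) = D at *
    subst e
    rw [pow_two]
    group
  have move : ∀ b ∈ braidSub s (m + 1), ∀ v ∈ topSub s m, ∃ v' ∈ topSub s m, b * v = v' * b :=
    fun b hb v hv => ⟨_, h.conj_mem_topSub hm hb hv, by group⟩
  refine closure_induction_right_pm (p := fun β => ∃ u ∈ topSub s m, ∃ b ∈ braidSub s (m + 1),
    ∃ k ≤ m + 1, β = u * b * desc s k (m + 1)) ?_ ?_ ?_ hβ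
  · exact ⟨1, one_mem _, 1, one_mem _, m + 1, le_rfl, by rw [desc_of_le s le_rfl]; simp⟩
  · rintro _ ⟨u, hu, b, hb, k, hk, rfl⟩ _ ⟨i, hi, rfl⟩
    rcases lt_trichotomy (i + 1) k with h1 | h1 | h1
    · refine ⟨u, hu, b * s i, mul_mem hb (mem_braidSub s (by omega)), k, hk, ?_⟩
      have : Commute (s i) (desc s k (m + 1)) :=
        commute_desc fun j hj hj2 => h.comm i j (by omega) (by omega)
      rw [mul_assoc, ← this.eq]; group
    · subst h1
      exact ⟨u, hu, b, hb, i, by omega, by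
        rw [desc_left s (show i < m + 1 by omega)]; group⟩
    · by_cases h2 : i = k
      · subst h2
        obtain ⟨v, hv, e⟩ := move b hb _ (hmem i (by omega))
        refine ⟨u * v, mul_mem hu hv, b, hb, i + 1, by omega, ?_⟩
        rw [mul_assoc, hsq i (by omega), ← mul_assoc, mul_assoc u b, e]; group
      · obtain ⟨i, rfl⟩ : ∃ k, i = k + 1 := ⟨i - 1, by omega⟩
        refine ⟨u, hu, b * s i, mul_mem hb (mem_braidSub s (by omega)), k, hk, ?_⟩
        rw [mul_assoc, h.desc_mul_of_gt (by omega) (by omega) (by omega)]; group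
  · rintro _ ⟨u, hu, b, hb, k, hk, rfl⟩ _ ⟨i, hi, rfl⟩
    rcases lt_trichotomy (i + 1) k with h1 | h1 | h1
    · refine ⟨u, hu, b * (s i)⁻¹, mul_mem hb (inv_mem (mem_braidSub s (by omega))), k, hk, ?_⟩
      have : Commute (s i) (desc s k (m + 1)) :=
        commute_desc fun j hj hj2 => h.comm i j (by omega) (by omega)
      rw [mul_assoc, ← this.inv_left.eq]; group
    · subst h1
      obtain ⟨v, hv, e⟩ := move b hb _ (inv_mem (hmem i (by omega)))
      refine ⟨u * v, mul_mem hu hv, b, hb, i, by omega, ?_⟩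
      have e1 : desc s (i + 1) (m + 1) * (s i)⁻¹ =
          (tuple s (s m ^ 2) m i)⁻¹ * desc s i (m + 1) := by
        rw [eq_inv_mul_iff_mul_eq, ← mul_assoc, ← hsq i (by omega)]; group
      rw [mul_assoc, e1, ← mul_assoc, mul_assoc u b, e]; group
    · by_cases h2 : i = k
      · subst h2
        refine ⟨u, hu, b, hb, i + 1, by omega, ?_⟩
        rw [desc_left s (show i < m + 1 by omega)]; group
      · obtain ⟨i, rfl⟩ : ∃ k, i = k + 1 := ⟨i - 1, by omega⟩
        refine ⟨u, hu, b * (s i)⁻¹, mul_mem hb (inv_mem (mem_braidSub s (by omega))), k, hk, ?_⟩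
        have e1 := h.desc_mul_of_gt (k := k) (i := i) (m := m + 1) (by omega) (by omega) (by omega)
        have e2 : desc s k (m + 1) * (s (i + 1))⁻¹ = (s i)⁻¹ * desc s k (m + 1) := by
          rw [mul_inv_eq_iff_eq_mul, mul_assoc, e1]; group
        rw [mul_assoc, e2]; group

end Generic

end ArtinBAut

namespace ArtinBAut

open FreeGroup (of)

/-- The letters of the free group, extended by `1` beyond the rank. -/
def X (n i : ℕ) : FreeGroup (Fin n) := if h : i < n then of ⟨i, h⟩ else 1

section Letters

variable {n : ℕ}

theorem X_of_lt {i : ℕ} (h : i < n) : X n i = of ⟨i, h⟩ := by simp [X, h]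

theorem X_of_le {i : ℕ} (h : n ≤ i) : X n i = 1 := by simp [X, not_lt.mpr h]

theorem of_eq_X (i : Fin n) : of i = X n i := by simp [X]

theorem X_ne_one {i : ℕ} (h : i < n) : X n i ≠ 1 := by
  rw [X_of_lt h]; exact FreeGroup.of_ne_one _

/-- The homomorphism with prescribed values on the letters. -/
def liftX (n : ℕ) {G : Type*} [Group G] (y : ℕ → G) : FreeGroup (Fin n) →* G :=
  FreeGroup.lift fun i => y i

theorem liftX_X {G : Type*} [Group G] (y : ℕ → G) {i : ℕ} (h : i < n) :
    liftX n y (X n i) = y i := by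
  rw [X_of_lt h, liftX, FreeGroup.lift_apply_of]

theorem hom_ext {G : Type*} [Group G] {f g : FreeGroup (Fin n) →* G}
    (h : ∀ i < n, f (X n i) = g (X n i)) : f = g := by
  ext i
  have := h i i.2
  rwa [← of_eq_X] at this

theorem aut_ext {f g : MulAut (FreeGroup (Fin n))}
    (h : ∀ i < n, f (X n i) = g (X n i)) : f = g := by
  have : f.toMonoidHom = g.toMonoidHom := hom_ext h
  ext x
  exact DFunLike.congr_fun this x

/-- The value of the braid automorphism `σ i` on the letters. -/
def sigmaVal (n i j : ℕ) : FreeGroup (Fin n) :=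
  if j = i then X n (i + 1) else
  if j = i + 1 then (X n (i + 1))⁻¹ * X n i * X n (i + 1) else X n j

/-- The value of the inverse of `σ i` on the letters. -/
def sigmaInvVal (n i j : ℕ) : FreeGroup (Fin n) :=
  if j = i then X n i * X n (i + 1) * (X n i)⁻¹ else
  if j = i + 1 then X n i else X n j

theorem liftX_sigmaVal {i : ℕ} (hi : i + 1 < n) (j : ℕ) :
    liftX n (sigmaVal n i) (X n j) = sigmaVal n i j := by
  by_cases hj : j < n
  · exact liftX_X _ hj
  · rw [X_of_le (by omega), _root_.map_one, sigmaVal, if_neg (by omega), if_neg (by omega),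
      X_of_le (by omega)]

theorem liftX_sigmaInvVal {i : ℕ} (hi : i + 1 < n) (j : ℕ) :
    liftX n (sigmaInvVal n i) (X n j) = sigmaInvVal n i j := by
  by_cases hj : j < n
  · exact liftX_X _ hj
  · rw [X_of_le (by omega), _root_.map_one, sigmaInvVal, if_neg (by omega), if_neg (by omega),
      X_of_le (by omega)]

/-- The Artin automorphism attached to the `i`-th standard braid generator. -/
def sigma (n i : ℕ) : MulAut (FreeGroup (Fin n)) :=
  if hi : i + 1 < n then
    MonoidHom.toMulEquiv (liftX n (sigmaVal n i)) (liftX n (sigmaInvVal n i))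
      (hom_ext fun j _ => by
        rw [MonoidHom.comp_apply, liftX_sigmaVal hi, sigmaVal]
        split_ifs with h1 h2
        · rw [liftX_sigmaInvVal hi, sigmaInvVal, if_neg (by omega), if_pos rfl, h1]; rfl
        · simp only [_root_.map_mul, _root_.map_inv, liftX_sigmaInvVal hi]
          rw [h2]; simp [sigmaInvVal]; group
        · rw [liftX_sigmaInvVal hi, sigmaInvVal, if_neg h1, if_neg h2]; rfl)
      (hom_ext fun j _ => by
        rw [MonoidHom.comp_apply, liftX_sigmaInvVal hi, sigmaInvVal]
        split_ifs with h1 h2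
        · simp only [_root_.map_mul, _root_.map_inv, liftX_sigmaVal hi]
          rw [h1]; simp [sigmaVal]; group
        · rw [liftX_sigmaVal hi, sigmaVal, if_pos rfl, h2]; rfl
        · rw [liftX_sigmaVal hi, sigmaVal, if_neg h1, if_neg h2]; rfl)
  else 1

theorem sigma_X {i : ℕ} (hi : i + 1 < n) (j : ℕ) : sigma n i (X n j) =
    if j = i then X n (i + 1) else
    if j = i + 1 then (X n (i + 1))⁻¹ * X n i * X n (i + 1) else X n j := by
  rw [sigma, dif_pos hi]
  exact liftX_sigmaVal hi j

theorem sigma_inv_X {i : ℕ} (hi : i + 1 < n) (j : ℕ) : (sigma n i)⁻¹ (X n j) =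
    if j = i then X n i * X n (i + 1) * (X n i)⁻¹ else
    if j = i + 1 then X n i else X n j := by
  rw [sigma, dif_pos hi]
  exact liftX_sigmaInvVal hi j

theorem sigma_X_self {i : ℕ} (hi : i + 1 < n) : sigma n i (X n i) = X n (i + 1) := by
  simp [sigma_X hi]

theorem sigma_X_succ {i : ℕ} (hi : i + 1 < n) : sigma n i (X n (i + 1)) =
    (X n (i + 1))⁻¹ * X n i * X n (i + 1) := by
  simp [sigma_X hi]

theorem sigma_X_ne {i : ℕ} (hi : i + 1 < n) {j : ℕ} (h1 : j ≠ i) (h2 : j ≠ i + 1) :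
    sigma n i (X n j) = X n j := by
  simp [sigma_X hi, h1, h2]

theorem isBraid_sigma (n : ℕ) : IsBraid (n - 1) (sigma n) where
  braid i hi := by
    have h1 : i + 1 < n := by omega
    have h2 : i + 1 + 1 < n := by omega
    refine aut_ext fun j _ => ?_
    simp only [MulAut.mul_apply]
    by_cases e1 : j = i
    · subst e1
      rw [sigma_X_self h1, sigma_X_self h2, sigma_X_ne h2 (by omega) (by omega), sigma_X_self h1,
        sigma_X_self h2, sigma_X_ne h1 (by omega) (by omega)]
    by_cases e2 : j = i + 1
    · subst e2
      simp only [sigma_X_self h1, sigma_X_succ h1, _root_.map_mul, _root_.map_inv,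
        sigma_X_self h2, sigma_X_ne h2 (show i ≠ i + 1 by omega) (show i ≠ i + 1 + 1 by omega),
        sigma_X_ne h1 (show i + 1 + 1 ≠ i by omega) (show i + 1 + 1 ≠ i + 1 by omega)]
      rw [sigma_X_succ h2]
    by_cases e3 : j = i + 1 + 1
    · subst e3
      simp only [sigma_X_succ h1, _root_.map_mul, _root_.map_inv, sigma_X_succ h2,
        sigma_X_self h2, sigma_X_ne h2 (show i ≠ i + 1 by omega) (show i ≠ i + 1 + 1 by omega),
        sigma_X_ne h1 (show i + 1 + 1 ≠ i by omega) (show i + 1 + 1 ≠ i + 1 by omega)]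
      group
    simp only [sigma_X_ne h1 e1 e2, sigma_X_ne h2 e2 e3]
  comm i k hik hk := by
    have h1 : i + 1 < n := by omega
    have h2 : k + 1 < n := by omega
    refine aut_ext fun j _ => ?_
    simp only [MulAut.mul_apply]
    have a1 := sigma_X_ne h1 (show k ≠ i by omega) (show k ≠ i + 1 by omega)
    have a2 := sigma_X_ne h1 (show k + 1 ≠ i by omega) (show k + 1 ≠ i + 1 by omega)
    have a3 := sigma_X_ne h2 (show i ≠ k by omega) (show i ≠ k + 1 by omega)
    have a4 := sigma_X_ne h2 (show i + 1 ≠ k by omega) (show i + 1 ≠ k + 1 by omega)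
    by_cases e1 : j = i
    · subst e1; simp only [sigma_X_self h1, a3, a4]
    by_cases e2 : j = i + 1
    · subst e2; simp only [sigma_X_succ h1, a3, a4, _root_.map_mul, _root_.map_inv]
    by_cases e3 : j = k
    · subst e3; simp only [sigma_X_self h2, a1, a2]
    by_cases e4 : j = k + 1
    · subst e4; simp only [sigma_X_succ h2, a1, a2, _root_.map_mul, _root_.map_inv]
    simp only [sigma_X_ne h1 e1 e2, sigma_X_ne h2 e3 e4]

theorem mul_conj_eq {G : Type*} [Group G] (g : MulAut G) (x : G) :
    g * MulAut.conj x * g⁻¹ = MulAut.conj (g x) := by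
  ext y
  simp [MulAut.mul_apply]

theorem isBraidB_sigma (n : ℕ) : IsBraidB (n - 1) (sigma n) (MulAut.conj (X n (n - 1))) where
  isBraid := isBraid_sigma n
  comm i hi := by
    rw [commute_iff_eq, ← mul_inv_eq_iff_eq_mul, mul_conj_eq,
      sigma_X_ne (by omega) (by omega) (by omega)]
  four i hi := by
    have hi' : i + 1 < n := by omega
    rw [show n - 1 = i + 1 by omega]
    have e1 := mul_conj_eq (sigma n i) (X n (i + 1))
    have e2 := mul_conj_eq (sigma n i) (sigma n i (X n (i + 1)))
    have e3 : MulAut.conj (sigma n i (X n (i + 1))) *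
        MulAut.conj (sigma n i (sigma n i (X n (i + 1)))) =
        MulAut.conj (X n (i + 1)) * MulAut.conj (sigma n i (X n (i + 1))) := by
      rw [← _root_.map_mul, ← _root_.map_mul]
      simp only [sigma_X_succ hi', sigma_X_self hi', _root_.map_mul, _root_.map_inv]
      group
    rw [← e2, ← e1] at e3
    generalize sigma n i = s at *
    generalize MulAut.conj (X n (i + 1)) = z at *
    calc s * z * s * z = s * z * s⁻¹ * (s * (s * z * s⁻¹) * s⁻¹) * (s * s) := by group
      _ = z * s * z * s := by rw [e3]; group

/-- The product of the first `m` letters. -/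
def W (n : ℕ) : ℕ → FreeGroup (Fin n)
  | 0 => 1
  | m + 1 => W n m * X n m

theorem W_succ (m : ℕ) : W n (m + 1) = W n m * X n m := rfl

theorem sigma_W_of_le {i m : ℕ} (hi : i + 1 < n) (hm : m ≤ i) : sigma n i (W n m) = W n m := by
  induction m with
  | zero => simp [W]
  | succ m ih => rw [W_succ, _root_.map_mul, ih (by omega), sigma_X_ne hi (by omega) (by omega)]

theorem sigma_W_of_gt {i m : ℕ} (hi : i + 1 < n) (hm : i + 1 < m) : sigma n i (W n m) = W n m := by
  induction m, hm using Nat.le_induction with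
  | base =>
    rw [W_succ, W_succ, _root_.map_mul, _root_.map_mul, sigma_W_of_le hi le_rfl, sigma_X_self hi,
      sigma_X_succ hi]
    group
  | succ m hm ih =>
    have : i + 1 + 1 ≤ m := hm
    rw [W_succ, _root_.map_mul, ih, sigma_X_ne hi (by omega) (by omega)]

end Letters

section Action

variable (n : ℕ)

/-- The standard generators `r_{i+1}` of the Artin group, in 0-based numbering. -/
def sA (i : ℕ) : ArtinB n := rB n (i + 1)

variable {n}

theorem sA_of_lt {i : ℕ} (h : i < n) : sA n i = PresentedGroup.of ⟨i, h⟩ := by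
  simp [sA, rB, h]

theorem relB {w : FreeGroup (Fin n)} (h : w ∈ BnRels n) : PresentedGroup.mk (BnRels n) w = 1 :=
  PresentedGroup.one_of_mem h

theorem isBraidB_sA (hn : 2 ≤ n) : IsBraidB (n - 1) (sA n) (sA n (n - 1)) where
  isBraid :=
    { braid := fun i hi => by
        rw [sA_of_lt (show i < n by omega), sA_of_lt (show i + 1 < n by omega)]
        have := relB (n := n) (Or.inl ⟨⟨i, by omega⟩, ⟨i + 1, by omega⟩, rfl,
          (show i + 1 + 1 < n by omega), rfl⟩)
        rw [_root_.map_mul, _root_.map_inv, mul_inv_eq_one] at this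
        exact this
      comm := fun i j hij hj => by
        rw [sA_of_lt (show i < n by omega), sA_of_lt (show j < n by omega)]
        have := relB (n := n) (Or.inr (Or.inr ⟨⟨i, by omega⟩, ⟨j, by omega⟩, hij, rfl⟩))
        rw [_root_.map_mul, _root_.map_inv, mul_inv_eq_one] at this
        exact this }
  comm i hi := by
    rw [sA_of_lt (show i < n by omega), sA_of_lt (show n - 1 < n by omega)]
    have := relB (n := n) (Or.inr (Or.inr ⟨⟨i, by omega⟩, ⟨n - 1, by omega⟩,
      (show i + 2 ≤ n - 1 by omega), rfl⟩))
    rw [_root_.map_mul, _root_.map_inv, mul_inv_eq_one] at this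
    exact this
  four i hi := by
    rw [sA_of_lt (show i < n by omega), sA_of_lt (show n - 1 < n by omega)]
    have := relB (n := n) (Or.inr (Or.inl ⟨⟨i, by omega⟩, ⟨n - 1, by omega⟩,
      (show i + 2 = n by omega), (show n - 1 + 1 = n by omega), rfl⟩))
    rw [_root_.map_mul, _root_.map_inv, mul_inv_eq_one] at this
    exact this

variable (n) in
/-- The automorphism attached to the `i`-th generator of the Artin group of type `B`. -/
def genAct (i : ℕ) : MulAut (FreeGroup (Fin n)) :=
  if i + 1 < n then sigma n i else MulAut.conj (X n (n - 1))

theorem genAct_rel (w : FreeGroup (Fin n)) (hw : w ∈ BnRels n) :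
    FreeGroup.lift (fun i : Fin n => genAct n i) w = 1 := by
  rcases hw with ⟨i, j, h1, h2, rfl⟩ | ⟨i, j, h1, h2, rfl⟩ | ⟨i, j, h1, rfl⟩
  · simp only [_root_.map_mul, _root_.map_inv, FreeGroup.lift_apply_of, mul_inv_eq_one]
    rw [genAct, genAct, if_pos (by omega), if_pos h2, ← h1]
    exact (isBraid_sigma n).braid i (by omega)
  · simp only [_root_.map_mul, _root_.map_inv, FreeGroup.lift_apply_of, mul_inv_eq_one]
    rw [genAct, genAct, if_pos (by omega), if_neg (by omega)]
    exact (isBraidB_sigma n).four i (by omega)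
  · simp only [_root_.map_mul, _root_.map_inv, FreeGroup.lift_apply_of, mul_inv_eq_one]
    have := j.2
    by_cases hj : (j : ℕ) + 1 < n
    · rw [genAct, genAct, if_pos (by omega), if_pos hj]
      exact (isBraid_sigma n).comm i j h1 (by omega)
    · rw [genAct, genAct, if_pos (by omega), if_neg hj]
      exact (isBraidB_sigma n).comm i (by omega)

variable (n) in
/-- The action of the Artin group of type `B` on the free group. -/
def act : ArtinB n →* MulAut (FreeGroup (Fin n)) := PresentedGroup.toGroup genAct_rel

theorem act_sA {i : ℕ} (hi : i + 1 < n) : act n (sA n i) = sigma n i := by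
  rw [sA_of_lt (by omega), act, PresentedGroup.toGroup.of]
  simp [genAct, hi]

theorem act_sA_last (hn : 0 < n) : act n (sA n (n - 1)) = MulAut.conj (X n (n - 1)) := by
  rw [sA_of_lt (by omega), act, PresentedGroup.toGroup.of]
  simp only [genAct]
  rw [if_neg (by omega)]

theorem artinB_induction {p : Subgroup (ArtinB n)} (h : ∀ i < n, sA n i ∈ p) : p = ⊤ := by
  rw [eq_top_iff, ← PresentedGroup.closure_range_of, Subgroup.closure_le]
  rintro _ ⟨i, rfl⟩
  have := h i i.2
  rwa [sA_of_lt i.2] at this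

end Action

end ArtinBAut

namespace ArtinBAut

open FreeGroup (of)

section Basics

variable {n : ℕ}

/-- The endomorphism killing all letters of index at least `m`. -/
def q (n m : ℕ) : FreeGroup (Fin n) →* FreeGroup (Fin n) :=
  liftX n fun i => if i < m then X n i else 1

theorem q_X (m i : ℕ) : q n m (X n i) = if i < m then X n i else 1 := by
  by_cases hi : i < n
  · exact liftX_X _ hi
  · rw [X_of_le (by omega), _root_.map_one]; simp

theorem q_X_of_lt {m i : ℕ} (h : i < m) : q n m (X n i) = X n i := by rw [q_X, if_pos h]

theorem q_X_of_le {m i : ℕ} (h : m ≤ i) : q n m (X n i) = 1 := by rw [q_X, if_neg (by omega)]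

theorem q_W {m k : ℕ} (h : k ≤ m) : q n m (W n k) = W n k := by
  induction k with
  | zero => simp [W]
  | succ k ih => rw [W_succ, _root_.map_mul, ih (by omega), q_X_of_lt (by omega)]

theorem q_q {m k : ℕ} (h : m ≤ k) (x : FreeGroup (Fin n)) : q n m (q n k x) = q n m x := by
  have : (q n m).comp (q n k) = q n m := by
    refine hom_ext fun i _ => ?_
    rw [MonoidHom.comp_apply, q_X, q_X]
    split_ifs
    · rw [q_X_of_lt (by omega)]
    · rw [q_X_of_le (by omega)]
    · omega
    · simp
  exact DFunLike.congr_fun this x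

/-- The exponent sum of the letter `i`. -/
def expo (n i : ℕ) : FreeGroup (Fin n) →* Multiplicative ℤ :=
  liftX n fun j => if j = i then Multiplicative.ofAdd 1 else 1

theorem expo_X {i j : ℕ} (hj : j < n) :
    expo n i (X n j) = if j = i then Multiplicative.ofAdd 1 else 1 := liftX_X _ hj

theorem expo_X_self {i : ℕ} (hi : i < n) : expo n i (X n i) = Multiplicative.ofAdd 1 := by
  rw [expo_X hi, if_pos rfl]

theorem expo_X_ne {i j : ℕ} (h : j ≠ i) : expo n i (X n j) = 1 := by
  by_cases hj : j < n
  · rw [expo_X hj, if_neg h]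
  · rw [X_of_le (by omega), _root_.map_one]

theorem map_isConj_eq {G C : Type*} [Group G] [CommGroup C] (f : G →* C) {x y : G}
    (h : IsConj x y) : f x = f y := by
  obtain ⟨c, rfl⟩ := isConj_iff.mp h
  simp

theorem isConj_X {i j : ℕ} (hi : i < n) (h : IsConj (X n i) (X n j)) : i = j := by
  by_contra hij
  have := map_isConj_eq (expo n i) h
  rw [expo_X_self hi, expo_X_ne (Ne.symm hij)] at this
  exact absurd this (by decide)

theorem mem_zpowers_X {g : FreeGroup (Fin n)} {i : ℕ} (hi : i < n) (h : Commute g (X n i)) :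
    g ∈ Subgroup.zpowers (X n i) := by
  rw [X_of_lt hi] at *
  exact FreeGroup.mem_zpowers_of_commute _ h

theorem not_commute_X {i j : ℕ} (hi : i < n) (hj : j < n) (hij : i ≠ j) :
    ¬ Commute (X n i) (X n j) := by
  intro h
  obtain ⟨k, hk⟩ := mem_zpowers_X hj h
  have := congrArg (expo n i) hk
  simp only [map_zpow, expo_X_self hi, expo_X_ne (Ne.symm hij), one_zpow] at this
  exact absurd this (by decide)

theorem eq_one_of_commute_X {g : FreeGroup (Fin n)} {i j : ℕ} (hi : i < n) (hj : j < n)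
    (hij : i ≠ j) (h1 : Commute g (X n i)) (h2 : Commute g (X n j)) : g = 1 := by
  by_contra hg
  exact not_commute_X hi hj hij (FreeGroup.commute_trans hg h1 h2)

theorem conj_injective (hn : 2 ≤ n) :
    Function.Injective (MulAut.conj : FreeGroup (Fin n) →* MulAut (FreeGroup (Fin n))) := by
  rw [injective_iff_map_eq_one]
  intro g hg
  have : ∀ x, Commute g x := fun x => by
    have := DFunLike.congr_fun hg x
    rw [MulAut.conj_apply, MulAut.one_apply, mul_inv_eq_iff_eq_mul] at this
    exact this
  exact eq_one_of_commute_X (i := 0) (j := 1) (by omega) (by omega) (by omega) (this _) (this _)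

/-- The change of basis replacing the letter `0` by the product of the first `m` letters. -/
theorem exists_basisW {m : ℕ} (hm : 1 ≤ m) (hn : m ≤ n) : ∃ θ : MulAut (FreeGroup (Fin n)),
    θ (X n 0) = W n m ∧ ∀ i, i ≠ 0 → θ (X n i) = X n i := by
  have key : ∀ f : FreeGroup (Fin n) →* FreeGroup (Fin n), (∀ i, i ≠ 0 → f (X n i) = X n i) →
      f ((X n 0)⁻¹ * W n m) = (X n 0)⁻¹ * W n m := by
    intro f hf
    induction m, hm using Nat.le_induction with
    | base => simp [W]
    | succ k hk ih =>
      rw [W_succ, ← mul_assoc, _root_.map_mul, ih (by omega), hf k (by omega)]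
  set a : ℕ → FreeGroup (Fin n) := fun i => if i = 0 then W n m else X n i with ha
  set b : ℕ → FreeGroup (Fin n) := fun i => if i = 0 then X n 0 * ((X n 0)⁻¹ * W n m)⁻¹ else X n i
    with hb
  have ha' : ∀ i, i ≠ 0 → liftX n a (X n i) = X n i := fun i hi => by
    by_cases h : i < n
    · rw [liftX_X _ h, ha]; simp [hi]
    · rw [X_of_le (by omega), _root_.map_one]
  have hb' : ∀ i, i ≠ 0 → liftX n b (X n i) = X n i := fun i hi => by
    by_cases h : i < n
    · rw [liftX_X _ h, hb]; simp [hi]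
    · rw [X_of_le (by omega), _root_.map_one]
  have ha0 : liftX n a (X n 0) = W n m := by rw [liftX_X _ (by omega), ha]; simp
  have hb0 : liftX n b (X n 0) = X n 0 * ((X n 0)⁻¹ * W n m)⁻¹ := by
    rw [liftX_X _ (by omega), hb]; simp
  refine ⟨MonoidHom.toMulEquiv (liftX n a) (liftX n b) (hom_ext fun i _ => ?_)
    (hom_ext fun i _ => ?_), ha0, ha'⟩
  · rw [MonoidHom.comp_apply]
    by_cases hi : i = 0
    · subst hi
      have := key _ hb'
      rw [_root_.map_mul, _root_.map_inv, hb0] at this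
      rw [ha0]
      calc liftX n b (W n m) = X n 0 * ((X n 0)⁻¹ * W n m)⁻¹ *
          ((X n 0 * ((X n 0)⁻¹ * W n m)⁻¹)⁻¹ * liftX n b (W n m)) := by group
        _ = X n 0 := by rw [this]; group
    · rw [ha' i hi, hb' i hi]; rfl
  · rw [MonoidHom.comp_apply]
    by_cases hi : i = 0
    · subst hi
      have := key _ ha'
      rw [hb0, _root_.map_mul, _root_.map_inv, this, ha0]
      simp
    · rw [hb' i hi, ha' i hi]; rfl

theorem mem_zpowers_W {g : FreeGroup (Fin n)} {m : ℕ} (hm : 1 ≤ m) (hn : m ≤ n)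
    (h : Commute g (W n m)) : g ∈ Subgroup.zpowers (W n m) := by
  obtain ⟨θ, h0, -⟩ := exists_basisW hm hn
  have h1 : Commute (θ.symm g) (X n 0) := by
    have := h.map θ.symm
    rwa [← h0, θ.symm_apply_apply] at this
  obtain ⟨k, hk⟩ := mem_zpowers_X (by omega) h1
  refine ⟨k, ?_⟩
  have := congrArg θ hk
  simpa [h0] using this

end Basics

end ArtinBAut

namespace ArtinBAut

open FreeGroup (of)

section Iota

variable {n : ℕ} {G : Type*} [Group G]

/-- The homomorphism sending the first letters to the conjugates `tuple s z M j`. -/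
def iota (n : ℕ) (s : ℕ → G) (z : G) (M : ℕ) : FreeGroup (Fin n) →* G :=
  liftX n fun j => if j ≤ M then tuple s z M j else 1

theorem iota_X (s : ℕ → G) (z : G) {M : ℕ} (j : ℕ) (hM : M < n) :
    iota n s z M (X n j) = if j ≤ M then tuple s z M j else 1 := by
  by_cases hj : j < n
  · exact liftX_X _ hj
  · rw [X_of_le (by omega), _root_.map_one, if_neg (by omega)]

theorem map_desc {H : Type*} [Group H] (f : G →* H) (s : ℕ → G) (j k : ℕ) :
    f (desc s j k) = desc (fun i => f (s i)) j k := by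
  induction k with
  | zero => simp [desc]
  | succ k ih =>
    by_cases h : j ≤ k
    · rw [desc_succ s h, desc_succ _ h, _root_.map_mul, ih]
    · rw [desc_of_le s (by omega), desc_of_le _ (by omega), _root_.map_one]

theorem desc_congr {s t : ℕ → G} {j k : ℕ} (h : ∀ i < k, s i = t i) : desc s j k = desc t j k := by
  induction k with
  | zero => rfl
  | succ k ih =>
    by_cases hk : j ≤ k
    · rw [desc_succ s hk, desc_succ t hk, ih fun i hi => h i (by omega), h k (by omega)]
    · rw [desc_of_le s (by omega), desc_of_le t (by omega)]

theorem map_iota {H : Type*} [Group H] (f : G →* H) {s : ℕ → G} {t : ℕ → H} {z : G} {M : ℕ}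
    (h : ∀ i < M, f (s i) = t i) (hM : M < n) (y : FreeGroup (Fin n)) :
    f (iota n s z M y) = iota n t (f z) M y := by
  have : f.comp (iota n s z M) = iota n t (f z) M := by
    refine hom_ext fun j _ => ?_
    rw [MonoidHom.comp_apply, iota_X _ _ _ hM, iota_X _ _ _ hM]
    split_ifs
    · rw [tuple, tuple, _root_.map_mul, _root_.map_mul, _root_.map_inv, map_desc, desc_congr h]
    · exact _root_.map_one f
  exact DFunLike.congr_fun this y

theorem IsBraidB.iota_sigma {s : ℕ → G} {z : G} {M : ℕ} (h : IsBraidB M s z) (hM : M < n) {i : ℕ}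
    (hi : i < M) (y : FreeGroup (Fin n)) :
    s i * iota n s z M y * (s i)⁻¹ = iota n s z M (sigma n i y) := by
  have : (MulAut.conj (s i)).toMonoidHom.comp (iota n s z M) =
      (iota n s z M).comp (sigma n i).toMonoidHom := by
    refine hom_ext fun j _ => ?_
    change s i * iota n s z M (X n j) * (s i)⁻¹ = iota n s z M (sigma n i (X n j))
    rw [sigma_X (by omega), iota_X _ _ _ hM]
    by_cases hj : j ≤ M
    · rw [if_pos hj, h.conj_tuple hi hj]
      split_ifs
      · rw [iota_X _ _ _ hM, if_pos (by omega)]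
      · simp only [_root_.map_mul, _root_.map_inv]
        rw [iota_X _ _ _ hM, if_pos (by omega), iota_X _ _ _ hM, if_pos (by omega)]
      · rw [iota_X _ _ _ hM, if_pos (by omega)]
    · rw [if_neg hj, if_neg (by omega), if_neg (by omega), iota_X _ _ _ hM, if_neg hj]
      simp
  exact DFunLike.congr_fun this y

/-- The elements `g` through which a homomorphism from the free group is equivariant for `A`. -/
def equivSub (f : FreeGroup (Fin n) →* G) (A : G →* MulAut (FreeGroup (Fin n))) : Subgroup G where
  carrier := {g | ∀ y, g * f y * g⁻¹ = f (A g y)}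
  one_mem' := by simp
  mul_mem' {a b} ha hb y := by
    rw [_root_.map_mul, MulAut.mul_apply, ← ha, ← hb]; group
  inv_mem' {a} ha y := by
    have := ha (A a⁻¹ y)
    rw [← MulAut.mul_apply, ← _root_.map_mul, mul_inv_cancel, _root_.map_one, MulAut.one_apply]
      at this
    rw [← this]; group

end Iota

section BraidSub

variable {n : ℕ}

theorem braidSub_induction {G : Type*} [Group G] {s : ℕ → G} {m : ℕ} {p : Subgroup G}
    (h : ∀ i, i + 1 < m → s i ∈ p) : braidSub s m ≤ p := by
  rw [braidSub, Subgroup.closure_le]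
  rintro _ ⟨i, hi, rfl⟩
  exact h i hi

theorem braidSub_fix {x : FreeGroup (Fin n)} {m : ℕ}
    (h : ∀ i, i + 1 < m → sigma n i x = x) {b : MulAut (FreeGroup (Fin n))}
    (hb : b ∈ braidSub (sigma n) m) : b x = x :=
  (braidSub_induction (p := MulAction.stabilizer (MulAut (FreeGroup (Fin n))) x) h) hb

theorem braidSub_X {m i : ℕ} (hm : m ≤ n) (hi : m ≤ i) {b : MulAut (FreeGroup (Fin n))}
    (hb : b ∈ braidSub (sigma n) m) : b (X n i) = X n i :=
  braidSub_fix (fun j hj => sigma_X_ne (by omega) (by omega) (by omega)) hb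

theorem braidSub_W {m k : ℕ} (hm : m ≤ n) (hk : m ≤ k) {b : MulAut (FreeGroup (Fin n))}
    (hb : b ∈ braidSub (sigma n) m) : b (W n k) = W n k :=
  braidSub_fix (fun j hj => sigma_W_of_gt (by omega) (by omega)) hb

/-- The automorphisms commuting with an endomorphism. -/
def commSub (f : FreeGroup (Fin n) →* FreeGroup (Fin n)) :
    Subgroup (MulAut (FreeGroup (Fin n))) where
  carrier := {g | ∀ x, f (g x) = g (f x)}
  one_mem' := by simp
  mul_mem' {a b} ha hb x := by rw [MulAut.mul_apply, ha, hb, MulAut.mul_apply]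
  inv_mem' {a} ha x := by
    have := ha (a⁻¹ x)
    rw [MulAut.apply_inv_self] at this
    rw [this, MulAut.inv_apply_self]

theorem q_sigma {i m : ℕ} (hi : i + 1 < m) (hm : m ≤ n) (x : FreeGroup (Fin n)) :
    q n m (sigma n i x) = sigma n i (q n m x) := by
  have : (q n m).comp (sigma n i).toMonoidHom = (sigma n i).toMonoidHom.comp (q n m) := by
    refine hom_ext fun j _ => ?_
    change q n m (sigma n i (X n j)) = sigma n i (q n m (X n j))
    rw [sigma_X (by omega), q_X]
    split_ifs with h1 h2 h3 h4 h5
    · rw [q_X_of_lt hi, h1, sigma_X_self (by omega)]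
    · omega
    · rw [_root_.map_mul, _root_.map_mul, _root_.map_inv, q_X_of_lt (by omega),
        q_X_of_lt (by omega), h3, sigma_X_succ (by omega)]
    · omega
    · rw [q_X_of_lt (by omega), sigma_X_ne (by omega) h1 h3]
    · rw [q_X_of_le (by omega), _root_.map_one]
  exact DFunLike.congr_fun this x

theorem braidSub_q {m k : ℕ} (hm : m ≤ k) (hk : k ≤ n) {b : MulAut (FreeGroup (Fin n))}
    (hb : b ∈ braidSub (sigma n) m) (x : FreeGroup (Fin n)) : q n k (b x) = b (q n k x) :=
  (braidSub_induction (p := commSub (q n k)) fun i hi x => q_sigma (by omega) hk x) hb x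

theorem desc_sigma_X {j k : ℕ} (hjk : j ≤ k) (hk : k < n) :
    desc (sigma n) j k (X n j) = X n k := by
  induction k, hjk using Nat.le_induction with
  | base => rw [desc_of_le _ le_rfl]; rfl
  | succ k h ih => rw [desc_succ _ h, MulAut.mul_apply, ih (by omega), sigma_X_self hk]

theorem q_sigma_sq {p : ℕ} (hp : p + 1 < n) (x : FreeGroup (Fin n)) :
    q n (p + 1) ((sigma n p ^ 2) x) = q n (p + 1) x := by
  have : (q n (p + 1)).comp (sigma n p ^ 2).toMonoidHom = q n (p + 1) := by
    refine hom_ext fun j _ => ?_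
    change q n (p + 1) ((sigma n p ^ 2) (X n j)) = q n (p + 1) (X n j)
    rw [pow_two, MulAut.mul_apply]
    by_cases h1 : j = p
    · subst h1
      rw [sigma_X_self hp, sigma_X_succ hp]
      simp [q_X]
    by_cases h2 : j = p + 1
    · subst h2
      rw [sigma_X_succ hp]
      simp only [_root_.map_mul, _root_.map_inv, sigma_X_self hp, sigma_X_succ hp]
      simp [q_X]
    rw [sigma_X_ne hp h1 h2, sigma_X_ne hp h1 h2]
  exact DFunLike.congr_fun this x

/-- `g` conjugates the letter `p` by an element with image `y` after killing the letters
from `p` on, and is trivial modulo those letters. -/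
def PushesTo (p : ℕ) (g : MulAut (FreeGroup (Fin n))) (y : FreeGroup (Fin n)) : Prop :=
  (∃ v, g (X n p) = v⁻¹ * X n p * v ∧ q n p v = q n p y) ∧ ∀ x, q n p (g x) = q n p x

theorem PushesTo.one (p : ℕ) : PushesTo (n := n) p 1 1 :=
  ⟨⟨1, by simp, rfl⟩, fun _ => rfl⟩

theorem PushesTo.mul {p : ℕ} {g h : MulAut (FreeGroup (Fin n))} {x y : FreeGroup (Fin n)}
    (hg : PushesTo p g x) (hh : PushesTo p h y) : PushesTo p (g * h) (x * y) := by
  obtain ⟨⟨v, h1, h2⟩, h3⟩ := hg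
  obtain ⟨⟨w, h4, h5⟩, h6⟩ := hh
  refine ⟨⟨v * g w, ?_, ?_⟩, fun x => ?_⟩
  · rw [MulAut.mul_apply, h4, _root_.map_mul, _root_.map_mul, h1, _root_.map_inv]; group
  · rw [_root_.map_mul, _root_.map_mul, h2, h3, h5]
  · rw [MulAut.mul_apply, h3, h6]

theorem PushesTo.inv {p : ℕ} {g : MulAut (FreeGroup (Fin n))} {x : FreeGroup (Fin n)}
    (hg : PushesTo p g x) : PushesTo p g⁻¹ x⁻¹ := by
  obtain ⟨⟨v, h1, h2⟩, h3⟩ := hg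
  have h4 : ∀ x, q n p (g⁻¹ x) = q n p x := fun x => by
    rw [← h3, MulAut.apply_inv_self]
  refine ⟨⟨(g⁻¹ v)⁻¹, ?_, ?_⟩, h4⟩
  · have := congrArg (g⁻¹ : MulAut (FreeGroup (Fin n))) h1
    rw [MulAut.inv_apply_self, _root_.map_mul, _root_.map_mul, _root_.map_inv] at this
    conv_rhs => rw [this]
    group
  · rw [_root_.map_inv, _root_.map_inv, h4, h2]

theorem pushesTo_tuple {p j : ℕ} (hp : p + 1 < n) (hj : j ≤ p) :
    (tuple (sigma n) (sigma n p ^ 2) p j) (X n (p + 1)) =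
        (X n j * X n (p + 1))⁻¹ * X n (p + 1) * (X n j * X n (p + 1)) ∧
      ∀ x, q n (p + 1) ((tuple (sigma n) (sigma n p ^ 2) p j) x) = q n (p + 1) x := by
  have hd := desc_mem_braidSub (sigma n) (j := j) (show p < p + 1 by omega)
  constructor
  · rw [tuple, MulAut.mul_apply, MulAut.mul_apply, braidSub_X (by omega) le_rfl hd, pow_two,
      MulAut.mul_apply, sigma_X_succ hp]
    simp only [_root_.map_mul, _root_.map_inv, sigma_X_succ hp, sigma_X_self hp]
    rw [braidSub_X (by omega) le_rfl (inv_mem hd)]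
    have : (desc (sigma n) j p)⁻¹ (X n p) = X n j := by
      rw [← desc_sigma_X hj (by omega), MulAut.inv_apply_self]
    rw [this]; group
  · intro x
    rw [tuple, MulAut.mul_apply, MulAut.mul_apply, braidSub_q le_rfl (by omega) (inv_mem hd),
      q_sigma_sq hp, braidSub_q le_rfl (by omega) hd, MulAut.inv_apply_self]

theorem pushesTo_iota {p : ℕ} (hp : p + 1 < n) (y : FreeGroup (Fin n)) :
    PushesTo (p + 1) (iota n (sigma n) (sigma n p ^ 2) p y) y := by
  induction y using FreeGroup.induction_on with
  | C1 => rw [_root_.map_one]; exact PushesTo.one _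
  | of i =>
    rw [of_eq_X, iota_X _ _ _ (by omega)]
    split_ifs with h
    · obtain ⟨h1, h2⟩ := pushesTo_tuple hp h
      refine ⟨⟨_, h1, ?_⟩, h2⟩
      rw [_root_.map_mul, q_X_of_le le_rfl, mul_one]
    · exact ⟨⟨1, by simp, by rw [_root_.map_one, q_X_of_le (by omega)]⟩, fun _ => rfl⟩
  | inv_of i ih => rw [_root_.map_inv]; exact ih.inv
  | mul x y hx hy => rw [_root_.map_mul]; exact hx.mul hy

theorem iota_q {G : Type*} [Group G] {s : ℕ → G} {z : G} {M : ℕ} (hM : M < n)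
    (y : FreeGroup (Fin n)) : iota n s z M (q n (M + 1) y) = iota n s z M y := by
  have : (iota n s z M).comp (q n (M + 1)) = iota n s z M := by
    refine hom_ext fun j _ => ?_
    rw [MonoidHom.comp_apply, q_X]
    split_ifs with h
    · rfl
    · rw [_root_.map_one, iota_X _ _ _ hM, if_neg (by omega)]
  exact DFunLike.congr_fun this y

theorem topSub_le_range {G : Type*} [Group G] (s : ℕ → G) {p : ℕ} (hp : p < n) :
    topSub s p ≤ (iota n s (s p ^ 2) p).range := by
  rw [topSub, Subgroup.closure_le]
  rintro _ ⟨j, hj, rfl⟩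
  exact ⟨X n j, by rw [iota_X _ _ _ hp, if_pos hj]⟩

theorem act_braidSub {m : ℕ} (hm : m ≤ n) {b : ArtinB n} (hb : b ∈ braidSub (sA n) m) :
    act n b ∈ braidSub (sigma n) m := by
  refine (braidSub_induction (p := (braidSub (sigma n) m).comap (act n)) fun i hi => ?_) hb
  rw [Subgroup.mem_comap, act_sA (by omega)]
  exact mem_braidSub _ hi

theorem act_faithful {m : ℕ} (hm : m ≤ n) {b : ArtinB n} (hb : b ∈ braidSub (sA n) m)
    (h : act n b = 1) : b = 1 := by
  induction m generalizing b with
  | zero =>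
    have : braidSub (sA n) 0 ≤ ⊥ := braidSub_induction fun i hi => by omega
    exact Subgroup.mem_bot.mp (this hb)
  | succ m ih =>
    rcases Nat.eq_zero_or_pos m with h0 | h0
    · have : braidSub (sA n) (m + 1) ≤ ⊥ := braidSub_induction fun i hi => by omega
      exact Subgroup.mem_bot.mp (this hb)
    obtain ⟨p, rfl⟩ : ∃ p, m = p + 1 := ⟨m - 1, by omega⟩
    have hB := isBraidB_sA (n := n) (by omega)
    obtain ⟨u, hu, c, hc, k, hk, rfl⟩ := hB.isBraid.combing (m := p) (by omega) hb
    obtain ⟨y, rfl⟩ := topSub_le_range (n := n) (sA n) (show p < n by omega) hu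
    have hact := map_iota (act n) (s := sA n) (t := sigma n) (z := sA n p ^ 2) (M := p)
      (fun i hi => act_sA (by omega)) (by omega) y
    rw [_root_.map_pow, act_sA (by omega)] at hact
    obtain ⟨⟨v, hv1, hv2⟩, -⟩ := pushesTo_iota (n := n) (p := p) (by omega) y
    have hc' := act_braidSub (by omega) hc
    have hdesc : act n (desc (sA n) k (p + 1)) = desc (sigma n) k (p + 1) := by
      rw [map_desc]
      exact desc_congr fun i hi => act_sA (by omega)
    have hX : act n (iota n (sA n) (sA n p ^ 2) p y * c * desc (sA n) k (p + 1)) (X n k) =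
        v⁻¹ * X n (p + 1) * v := by
      rw [_root_.map_mul, _root_.map_mul, hdesc, MulAut.mul_apply, MulAut.mul_apply,
        desc_sigma_X hk (by omega), braidSub_X (by omega) le_rfl hc', hact, hv1]
    rw [h, MulAut.one_apply] at hX
    have hkp : k = p + 1 := isConj_X (n := n) (by omega) (isConj_iff.mpr ⟨v, by rw [hX]; group⟩)
    subst hkp
    have hcomm : Commute v (X n (p + 1)) := by
      rw [commute_iff_eq]; nth_rewrite 1 [hX]; group
    obtain ⟨k, rfl⟩ := mem_zpowers_X (by omega) hcomm
    have hy : iota n (sA n) (sA n p ^ 2) p y = 1 := by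
      rw [← iota_q (by omega), ← hv2]
      simp [q_X]
    rw [desc_of_le _ le_rfl, hy, one_mul, mul_one] at h ⊢
    exact ih (by omega) hc h

end BraidSub

section Center

variable {n : ℕ}

theorem tuple_sigma_conj {j : ℕ} (hj : j < n) :
    tuple (sigma n) (MulAut.conj (X n (n - 1))) (n - 1) j = MulAut.conj (X n j) := by
  have key : (desc (sigma n) j (n - 1))⁻¹ (X n (n - 1)) = X n j := by
    rw [← desc_sigma_X (show j ≤ n - 1 by omega) (by omega), MulAut.inv_apply_self]
  have := mul_conj_eq (desc (sigma n) j (n - 1))⁻¹ (X n (n - 1))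
  rw [key, inv_inv] at this
  exact this

/-- The embedding of the free group in the Artin group of type `B`. -/
abbrev iotaA (n : ℕ) : FreeGroup (Fin n) →* ArtinB n := iota n (sA n) (sA n (n - 1)) (n - 1)

theorem act_iotaA (hn : 2 ≤ n) (y : FreeGroup (Fin n)) : act n (iotaA n y) = MulAut.conj y := by
  rw [map_iota (act n) (t := sigma n) (fun i hi => act_sA (by omega)) (by omega),
    act_sA_last (by omega)]
  have : iota n (sigma n) (MulAut.conj (X n (n - 1))) (n - 1) = MulAut.conj :=
    hom_ext fun j hj => by
      rw [iota_X _ _ _ (by omega), if_pos (by omega), tuple_sigma_conj hj]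
  rw [this]

theorem iotaA_equivariant (hn : 2 ≤ n) (g : ArtinB n) (y : FreeGroup (Fin n)) :
    g * iotaA n y * g⁻¹ = iotaA n (act n g y) := by
  have : equivSub (iotaA n) (act n) = ⊤ := artinB_induction fun i hi y => by
    by_cases h : i + 1 < n
    · rw [act_sA h]
      exact (isBraidB_sA hn).iota_sigma (by omega) (by omega) y
    · have hi : i = n - 1 := by omega
      have e : iotaA n (X n (n - 1)) = sA n (n - 1) := by
        rw [iotaA, iota_X _ _ _ (by omega), if_pos le_rfl, tuple_self]
      rw [hi, act_sA_last (by omega), MulAut.conj_apply, _root_.map_mul, _root_.map_mul,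
        _root_.map_inv, e]
  exact (this ▸ Subgroup.mem_top g : g ∈ equivSub (iotaA n) (act n)) y

theorem exists_iotaA_mul (hn : 2 ≤ n) (g : ArtinB n) :
    ∃ y, ∃ b ∈ braidSub (sA n) n, g = iotaA n y * b := by
  have e : iotaA n (X n (n - 1)) = sA n (n - 1) := by
    rw [iotaA, iota_X _ _ _ (by omega), if_pos le_rfl, tuple_self]
  have hg : g ∈ Subgroup.closure {g | ∃ i < n, g = sA n i} := by
    have : Subgroup.closure {g | ∃ i < n, g = sA n i} = ⊤ :=
      artinB_induction fun i hi => Subgroup.subset_closure ⟨i, hi, rfl⟩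
    rw [this]; trivial
  refine closure_induction_right_pm
    (p := fun g => ∃ y, ∃ b ∈ braidSub (sA n) n, g = iotaA n y * b)
    ⟨1, 1, one_mem _, by simp⟩ ?_ ?_ hg
  · rintro _ ⟨y, b, hb, rfl⟩ _ ⟨i, hi, rfl⟩
    by_cases h : i + 1 < n
    · exact ⟨y, b * sA n i, mul_mem hb (mem_braidSub _ h), by group⟩
    · refine ⟨y * act n b (X n (n - 1)), b, hb, ?_⟩
      rw [_root_.map_mul, ← iotaA_equivariant hn, e, show i = n - 1 by omega]; group
  · rintro _ ⟨y, b, hb, rfl⟩ _ ⟨i, hi, rfl⟩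
    by_cases h : i + 1 < n
    · exact ⟨y, b * (sA n i)⁻¹, mul_mem hb (inv_mem (mem_braidSub _ h)), by group⟩
    · refine ⟨y * (act n b (X n (n - 1)))⁻¹, b, hb, ?_⟩
      rw [_root_.map_mul, _root_.map_inv, ← iotaA_equivariant hn, e, show i = n - 1 by omega]
      group

theorem ker_act (hn : 2 ≤ n) : (act n).ker = Subgroup.center (ArtinB n) := by
  ext g
  rw [MonoidHom.mem_ker]
  constructor
  · intro h
    obtain ⟨x, b, hb, rfl⟩ := exists_iotaA_mul hn g
    have hb' : act n b = MulAut.conj x⁻¹ := by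
      rw [_root_.map_mul, act_iotaA hn] at h
      rw [_root_.map_inv]
      exact eq_inv_of_mul_eq_one_right h
    have hx : Commute x (W n n) := by
      have := braidSub_W le_rfl le_rfl (act_braidSub le_rfl hb)
      rw [hb', MulAut.conj_apply, inv_inv, mul_assoc, inv_mul_eq_iff_eq_mul] at this
      exact this.symm
    obtain ⟨k, rfl⟩ := mem_zpowers_W (by omega) le_rfl hx
    have hgen : ∀ i < n, iotaA n (W n n ^ k) * b ∈ Subgroup.centralizer {sA n i} := by
      intro i hi
      rw [Subgroup.mem_centralizer_singleton_iff]
      by_cases h1 : i + 1 < n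
      · have hfix : sigma n i (W n n ^ k) = W n n ^ k := by
          rw [map_zpow, sigma_W_of_gt h1 h1]
        have e1 : Commute (sA n i) (iotaA n (W n n ^ k)) := by
          have := iotaA_equivariant hn (sA n i) (W n n ^ k)
          rw [act_sA h1, hfix] at this
          exact mul_inv_eq_iff_eq_mul.mp this
        have e2 : sA n i * b * (sA n i)⁻¹ * b⁻¹ = 1 := by
          refine act_faithful le_rfl (mul_mem (mul_mem (mul_mem (mem_braidSub _ h1) hb)
            (inv_mem (mem_braidSub _ h1))) (inv_mem hb)) ?_
          simp only [_root_.map_mul, _root_.map_inv]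
          rw [hb', act_sA h1, mul_conj_eq, _root_.map_inv, hfix, ← _root_.map_inv]
          simp
        have e3 : Commute (sA n i) b := by
          rw [commute_iff_eq, ← mul_inv_eq_iff_eq_mul, ← mul_inv_eq_one, e2]
        exact (e1.mul_right e3).eq.symm
      · have e : iotaA n (X n (n - 1)) = sA n (n - 1) := by
          rw [iotaA, iota_X _ _ _ (by omega), if_pos le_rfl, tuple_self]
        have := iotaA_equivariant hn (iotaA n (W n n ^ k) * b) (X n (n - 1))
        rw [h, e, MulAut.one_apply, e, show n - 1 = i by omega] at this
        exact mul_inv_eq_iff_eq_mul.mp this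
    rw [Subgroup.mem_center_iff]
    intro c
    have : Subgroup.centralizer {iotaA n (W n n ^ k) * b} = ⊤ := artinB_induction fun i hi => by
      rw [Subgroup.mem_centralizer_singleton_iff]
      exact (Subgroup.mem_centralizer_singleton_iff.mp (hgen i hi)).symm
    exact Subgroup.mem_centralizer_singleton_iff.mp (this ▸ Subgroup.mem_top c)
  · intro h
    ext y
    rw [MulAut.one_apply]
    apply conj_injective hn
    rw [← act_iotaA hn, ← act_iotaA hn, ← iotaA_equivariant hn,
      ← Subgroup.mem_center_iff.mp h, mul_inv_cancel_right]

end Center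

end ArtinBAut

namespace FreeGroup

variable {α : Type*} [DecidableEq α]

/-- The product of `a` and `b` involves no cancellation. -/
def NoCancel (a b : FreeGroup α) : Prop := norm (a * b) = norm a + norm b

theorem noCancel_iff {a b : FreeGroup α} :
    NoCancel a b ↔ (a * b).toWord = a.toWord ++ b.toWord := by
  constructor
  · intro h
    exact (toWord_mul_sublist a b).eq_of_length (by rw [List.length_append]; exact h)
  · intro h
    rw [NoCancel, norm, h, List.length_append]; rfl

theorem noCancel_iff_isReduced {a b : FreeGroup α} :
    NoCancel a b ↔ IsReduced (a.toWord ++ b.toWord) := by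
  rw [noCancel_iff, isReduced_iff_reduce_eq, toWord_mul]

theorem NoCancel.mul_left {a b c : FreeGroup α} (h1 : NoCancel a b) (h2 : NoCancel b c)
    (hb : b ≠ 1) : NoCancel (a * b) c := by
  have h := noCancel_iff.mp h1
  rw [noCancel_iff_isReduced] at *
  rw [h]
  exact h1.append_overlap h2 (by simpa using hb)

theorem NoCancel.inv {a b : FreeGroup α} (h : NoCancel a b) : NoCancel b⁻¹ a⁻¹ := by
  rw [NoCancel, ← mul_inv_rev, norm_inv_eq, norm_inv_eq, norm_inv_eq, h, add_comm]

theorem noCancel_of_of (i j : α) : NoCancel (of i) (of j) := by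
  rw [noCancel_iff_isReduced, toWord_of, toWord_of]
  simp [IsReduced]

theorem noCancel_mk_or (i : α) (ε : Bool) (g : FreeGroup α) :
    NoCancel (mk [(i, ε)]) g ∨ NoCancel (mk [(i, ε)])⁻¹ (mk [(i, ε)] * g) := by
  by_cases h : NoCancel (mk [(i, ε)]) g
  · exact Or.inl h
  right
  rw [noCancel_iff_isReduced] at h
  have hred := isReduced_toWord (x := g)
  rw [toWord_mk, IsReduced.reduce_eq IsReduced.singleton, List.singleton_append, IsReduced,
    List.isChain_cons] at h
  rcases hw : g.toWord with _ | ⟨⟨j, δ⟩, t⟩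
  · rw [hw] at h; simp at h
  · rw [hw] at h hred
    have h' : i = j ∧ ¬ ε = δ := by
      by_contra hc
      exact h ⟨fun y hy => by simp at hy; subst hy; simpa using hc, hred⟩
    obtain ⟨rfl, hne⟩ := h'
    have hδ : δ = !ε := by cases ε <;> cases δ <;> simp_all
    have hg : g = (mk [(i, ε)])⁻¹ * mk t := by
      rw [← mk_toWord (x := g), hw, inv_mk, mul_mk, hδ]; rfl
    have ht : IsReduced t := (List.isChain_cons.mp hred).2
    rw [NoCancel, inv_mul_cancel_left, hg, mul_inv_cancel_left, ← hg, norm_inv_eq,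
      norm_mk_of_isReduced ht, norm_mk_of_isReduced IsReduced.singleton, norm, hw]
    simp [add_comm]

theorem noCancel_of_or (i : α) (g : FreeGroup α) :
    NoCancel (of i) g ∨ NoCancel (of i)⁻¹ (of i * g) := noCancel_mk_or i true g

theorem noCancel_inv_of_or (i : α) (g : FreeGroup α) :
    NoCancel (of i)⁻¹ g ∨ NoCancel (of i) ((of i)⁻¹ * g) := by
  have := noCancel_mk_or i false g
  have e : (of i)⁻¹ = mk [(i, false)] := rfl
  rw [← e, inv_inv] at this
  exact this

/-- A conjugate of a letter has a reduced presentation. -/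
theorem exists_reduced_conj {y : FreeGroup α} {i : α} (h : IsConj (of i) y) :
    ∃ u, y = u * of i * u⁻¹ ∧ NoCancel u (of i) ∧ NoCancel (of i) u⁻¹ := by
  have hex : ∃ k, ∃ u, y = u * of i * u⁻¹ ∧ norm u = k := by
    obtain ⟨c, hc⟩ := isConj_iff.mp h
    exact ⟨_, c, hc.symm, rfl⟩
  classical
  obtain ⟨u, hu, hk⟩ := Nat.find_spec hex
  have hmin : ∀ v, y = v * of i * v⁻¹ → norm u ≤ norm v := fun v hv => by
    rw [hk]; exact Nat.find_min' hex ⟨v, hv, rfl⟩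
  refine ⟨u, hu, ?_, ?_⟩
  · rcases noCancel_inv_of_or i u⁻¹ with h1 | h1
    · have := h1.inv; simpa using this
    · exfalso
      have h2 := hmin (u * of i) (by rw [hu]; group)
      rw [NoCancel, mul_inv_cancel_left, norm_inv_eq, norm_of] at h1
      have h3 : norm (u * of i) = norm ((of i)⁻¹ * u⁻¹) := by rw [← norm_inv_eq, mul_inv_rev]
      omega
  · rcases noCancel_of_or i u⁻¹ with h1 | h1
    · exact h1
    · exfalso
      have h2 := hmin (u * (of i)⁻¹) (by rw [hu]; group)
      rw [NoCancel, inv_mul_cancel_left, norm_inv_eq, norm_inv_eq, norm_of] at h1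
      have h3 : norm (u * (of i)⁻¹) = norm (of i * u⁻¹) := by
        rw [← norm_inv_eq, mul_inv_rev, inv_inv]
      omega

theorem norm_reduced_conj {u : FreeGroup α} {i : α} (h1 : NoCancel u (of i))
    (h2 : NoCancel (of i) u⁻¹) : norm (u * of i * u⁻¹) = 2 * norm u + 1 := by
  have := h1.mul_left h2 (of_ne_one i)
  rw [NoCancel, h1, norm_inv_eq, norm_of] at this
  omega

theorem norm_conj_le (u : FreeGroup α) (i : α) : norm (u * of i * u⁻¹) ≤ 2 * norm u + 1 := by
  have h1 := norm_mul_le (u * of i) u⁻¹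
  have h2 := norm_mul_le u (of i)
  rw [norm_inv_eq] at h1
  rw [norm_of] at h2
  omega

/-- The product of the first `k` terms of a sequence. -/
def prodN {G : Type*} [Group G] (y : ℕ → G) : ℕ → G
  | 0 => 1
  | k + 1 => prodN y k * y k

theorem map_prodN {G H : Type*} [Group G] [Group H] (f : G →* H) (y : ℕ → G) (k : ℕ) :
    f (prodN y k) = prodN (fun i => f (y i)) k := by
  induction k with
  | zero => exact _root_.map_one f
  | succ k ih => rw [prodN, prodN, _root_.map_mul, ih]

theorem prodN_congr {G : Type*} [Group G] {y z : ℕ → G} {k : ℕ} (h : ∀ i < k, y i = z i) :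
    prodN y k = prodN z k := by
  induction k with
  | zero => rfl
  | succ k ih => rw [prodN, prodN, ih fun i hi => h i (by omega), h k (by omega)]

theorem toWord_prodN_of (z : ℕ → α) (k : ℕ) :
    (prodN (fun i => of (z i)) k).toWord = (List.range k).map fun i => (z i, true) := by
  induction k with
  | zero => simp [prodN]
  | succ k ih =>
    rw [prodN, toWord_mul, ih, toWord_of, List.range_succ, List.map_append, List.map_singleton]
    refine IsReduced.reduce_eq ?_
    have : (List.range k).map (fun i => (z i, true)) ++ [(z k, true)] =
        (List.range (k + 1)).map fun i => (z i, true) := by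
      rw [List.range_succ, List.map_append, List.map_singleton]
    rw [this]
    refine List.Pairwise.isChain ?_
    rw [List.pairwise_map]
    exact List.pairwise_of_forall fun _ _ _ => rfl

theorem prodN_of_injective {z z' : ℕ → α} {k : ℕ}
    (h : prodN (fun i => of (z i)) k = prodN (fun i => of (z' i)) k) {i : ℕ} (hi : i < k) :
    z i = z' i := by
  have := congrArg toWord h
  rw [toWord_prodN_of, toWord_prodN_of] at this
  have h2 := List.map_inj_left.mp this i (List.mem_range.mpr hi)
  exact congrArg Prod.fst h2

theorem noCancel_prodN {u : ℕ → FreeGroup α} {z : ℕ → α} {N : ℕ}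
    (h0 : ∀ i < N, NoCancel (u i) (of (z i)))
    (h1 : ∀ i, i + 1 < N → NoCancel (of (z i)) ((u i)⁻¹ * u (i + 1)))
    (h2 : ∀ i, i + 1 < N → NoCancel ((u i)⁻¹ * u (i + 1)) (of (z (i + 1)))) {k : ℕ} (hk : k < N) :
    NoCancel (prodN (fun i => u i * of (z i) * (u i)⁻¹) k * u k) (of (z k)) ∧
      k ≤ norm (prodN (fun i => u i * of (z i) * (u i)⁻¹) k * u k) ∧
      (norm (prodN (fun i => u i * of (z i) * (u i)⁻¹) k * u k) ≤ k → ∀ i ≤ k, u i = 1) := by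
  induction k with
  | zero =>
    rw [prodN, one_mul]
    refine ⟨h0 0 hk, Nat.zero_le _, fun h i hi => ?_⟩
    rw [Nat.le_zero.mp hi]
    exact norm_eq_zero.mp (Nat.le_zero.mp h)
  | succ k ih =>
    obtain ⟨a1, a2, a3⟩ := ih (by omega)
    have b1 := h1 k hk
    have b2 := h2 k hk
    rw [show prodN (fun i => u i * of (z i) * (u i)⁻¹) (k + 1) * u (k + 1) =
      prodN (fun i => u i * of (z i) * (u i)⁻¹) k * u k * of (z k) * ((u k)⁻¹ * u (k + 1)) by
        rw [prodN]; group]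
    generalize prodN (fun i => u i * of (z i) * (u i)⁻¹) k * u k = P at *
    have c1 := a1.mul_left b1 (of_ne_one _)
    have c2 := c1
    rw [NoCancel, a1, norm_of] at c2
    refine ⟨?_, by omega, fun h i hi => ?_⟩
    · by_cases hg : (u k)⁻¹ * u (k + 1) = 1
      · rw [hg, mul_one]
        exact a1.mul_left (noCancel_of_of _ _) (of_ne_one _)
      · exact c1.mul_left b2 hg
    · rw [c2] at h
      have hu := a3 (by omega)
      rcases Nat.lt_or_ge i (k + 1) with h3 | h3
      · exact hu i (by omega)
      · have : norm ((u k)⁻¹ * u (k + 1)) = 0 := by omega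
        rw [norm_eq_zero, hu k le_rfl] at this
        rw [show i = k + 1 by omega]
        simpa using this

end FreeGroup

namespace ArtinBAut

open FreeGroup (of norm prodN NoCancel)

variable {n : ℕ}

theorem W_eq_prodN (m : ℕ) : W n m = prodN (X n) m := by
  induction m with
  | zero => rfl
  | succ m ih => rw [W_succ, ih]; rfl

theorem norm_W_le (m : ℕ) : norm (W n m) ≤ m := by
  induction m with
  | zero => simp [W]
  | succ m ih =>
    have h1 := FreeGroup.norm_mul_le (W n m) (X n m)
    have h2 : norm (X n m) ≤ 1 := by
      by_cases h : m < n
      · rw [X_of_lt h, FreeGroup.norm_of]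
      · rw [X_of_le (by omega), FreeGroup.norm_one]; omega
    rw [W_succ]; omega

/-- Artin's characterization of braid automorphisms. -/
theorem mem_braidSub_of_fix {g : MulAut (FreeGroup (Fin n))}
    (h1 : ∀ i < n, ∃ j < n, IsConj (X n j) (g (X n i))) (h2 : g (W n n) = W n n) :
    g ∈ braidSub (sigma n) n := by
  obtain ⟨L, hL⟩ : ∃ L, ∑ i ∈ Finset.range n, norm (g (X n i)) = L := ⟨_, rfl⟩
  induction L using Nat.strong_induction_on generalizing g with
  | _ L ih =>
  rcases Nat.eq_zero_or_pos n with hn | hn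
  · subst hn
    have : g = 1 := aut_ext fun i hi => by omega
    rw [this]; exact one_mem _
  have hex : ∀ i, ∃ (u : FreeGroup (Fin n)) (z : Fin n), i < n →
      g (X n i) = u * of z * u⁻¹ ∧ NoCancel u (of z) ∧ NoCancel (of z) u⁻¹ := by
    intro i
    by_cases hi : i < n
    · obtain ⟨j, hj, hc⟩ := h1 i hi
      rw [X_of_lt hj] at hc
      obtain ⟨u, hu⟩ := FreeGroup.exists_reduced_conj hc
      exact ⟨u, ⟨j, hj⟩, fun _ => hu⟩
    · exact ⟨1, ⟨0, hn⟩, fun h => absurd h hi⟩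
  choose u z huz using hex
  have hstep : ∀ i, i + 1 < n → ∀ s : MulAut (FreeGroup (Fin n)), s ∈ braidSub (sigma n) n →
      (∀ j, j ≠ i → j ≠ i + 1 → s (X n j) = X n j) → s (W n n) = W n n →
      (∃ j < n, IsConj (X n j) (g (s (X n i)))) →
      (∃ j < n, IsConj (X n j) (g (s (X n (i + 1))))) →
      norm (g (s (X n i))) + norm (g (s (X n (i + 1)))) <
        norm (g (X n i)) + norm (g (X n (i + 1))) → g ∈ braidSub (sigma n) n := by
    intro i hi s hs hfix hW hc1 hc2 hlt
    have hlt' : ∑ j ∈ Finset.range n, norm ((g * s) (X n j)) < L := by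
      rw [← hL]
      have hs1 : i ∈ Finset.range n := Finset.mem_range.mpr (by omega)
      have hs2 : i + 1 ∈ (Finset.range n).erase i :=
        Finset.mem_erase.mpr ⟨by omega, Finset.mem_range.mpr hi⟩
      rw [← Finset.add_sum_erase _ _ hs1, ← Finset.add_sum_erase _ _ hs2,
        ← Finset.add_sum_erase (Finset.range n) _ hs1, ← Finset.add_sum_erase _ _ hs2]
      have : ∑ x ∈ ((Finset.range n).erase i).erase (i + 1), norm ((g * s) (X n x)) =
          ∑ x ∈ ((Finset.range n).erase i).erase (i + 1), norm (g (X n x)) := by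
        refine Finset.sum_congr rfl fun x hx => ?_
        simp only [Finset.mem_erase] at hx
        rw [MulAut.mul_apply, hfix x hx.2.1 hx.1]
      rw [this]
      simp only [MulAut.mul_apply]
      omega
    have := ih _ hlt' (g := g * s) (fun j hj => by
      by_cases e1 : j = i
      · subst e1; exact hc1
      by_cases e2 : j = i + 1
      · subst e2; exact hc2
      rw [MulAut.mul_apply, hfix j e1 e2]; exact h1 j hj) (by rw [MulAut.mul_apply, hW, h2]) rfl
    exact (Subgroup.mul_mem_cancel_right _ hs).mp this
  by_cases hA : ∀ i, i + 1 < n → NoCancel (of (z i)) ((u i)⁻¹ * u (i + 1))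
  · by_cases hB : ∀ i, i + 1 < n → NoCancel ((u i)⁻¹ * u (i + 1)) (of (z (i + 1)))
    · obtain ⟨K, rfl⟩ : ∃ K, n = K + 1 := ⟨n - 1, by omega⟩
      obtain ⟨a1, -, a3⟩ := FreeGroup.noCancel_prodN (fun i hi => (huz i hi).2.1) hA hB
        (show K < K + 1 by omega)
      have hW : W (K + 1) (K + 1) = prodN (fun i => u i * of (z i) * (u i)⁻¹) K * u K *
          of (z K) * (u K)⁻¹ := by
        rw [← h2, W_eq_prodN]
        have hm : g (prodN (X (K + 1)) (K + 1)) = prodN (fun i => g (X (K + 1) i)) (K + 1) :=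
          FreeGroup.map_prodN g.toMonoidHom _ _
        rw [hm, FreeGroup.prodN_congr fun i hi => (huz i hi).1, prodN]
        group
      have hnorm := norm_W_le (n := K + 1) (K + 1)
      have := a1.mul_left (huz K (by omega)).2.2 (FreeGroup.of_ne_one _)
      rw [hW, this, a1, FreeGroup.norm_of] at hnorm
      have hu := a3 (by omega)
      have hz : ∀ i < K + 1, g (X (K + 1) i) = of (z i) := fun i hi => by
        rw [(huz i hi).1, hu i (by omega)]; simp
      have hz' : ∀ i < K + 1, ((z i : Fin (K + 1)) : ℕ) = i := by
        have e1 : prodN (fun i => of (z i)) (K + 1) =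
            prodN (fun i => of (Fin.ofNat (K + 1) i)) (K + 1) := by
          rw [← FreeGroup.prodN_congr hz]
          refine (FreeGroup.map_prodN g.toMonoidHom (X (K + 1)) (K + 1)).symm.trans ?_
          rw [← W_eq_prodN]
          refine h2.trans ?_
          rw [W_eq_prodN]
          refine FreeGroup.prodN_congr fun i hi => ?_
          rw [X_of_lt hi]
          congr 1
          ext; simp [Nat.mod_eq_of_lt hi]
        intro i hi
        rw [FreeGroup.prodN_of_injective e1 hi]
        simp [Nat.mod_eq_of_lt hi]
      have : g = 1 := aut_ext fun i hi => by
        rw [hz i hi, MulAut.one_apply, of_eq_X, hz' i hi]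
      rw [this]; exact one_mem _
    · push Not at hB
      obtain ⟨i, hi, hnc⟩ := hB
      obtain ⟨e1, n1, n2⟩ := huz i (by omega)
      obtain ⟨e2, n3, n4⟩ := huz (i + 1) hi
      have key := FreeGroup.noCancel_inv_of_or (z (i + 1)) ((u i)⁻¹ * u (i + 1))⁻¹
      refine hstep i hi (sigma n i) (mem_braidSub _ hi) (fun j h h' => sigma_X_ne hi h h')
        (sigma_W_of_gt hi hi) ?_ ?_ ?_
      · rw [sigma_X_self hi]; exact h1 _ hi
      · obtain ⟨j, hj, hc⟩ := h1 i (by omega)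
        refine ⟨j, hj, hc.trans (isConj_iff.mpr ⟨g (X n (i + 1))⁻¹, ?_⟩)⟩
        rw [sigma_X_succ hi]; simp
      · rw [sigma_X_self hi, sigma_X_succ hi, add_comm]
        refine Nat.add_lt_add_right ?_ _
        simp only [_root_.map_mul, _root_.map_inv]
        have hkey : NoCancel (of (z (i + 1))) ((of (z (i + 1)))⁻¹ * ((u i)⁻¹ * u (i + 1))⁻¹) := by
          rcases key with h | h
          · exact absurd (by simpa using h.inv) hnc
          · exact h
        rw [e1, e2]
        have hui : u i = u (i + 1) * of (z (i + 1)) *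
            ((of (z (i + 1)))⁻¹ * ((u i)⁻¹ * u (i + 1))⁻¹) := by group
        generalize (of (z (i + 1)))⁻¹ * ((u i)⁻¹ * u (i + 1))⁻¹ = d at *
        have hnu := n3.mul_left hkey (FreeGroup.of_ne_one _)
        rw [NoCancel, ← hui, n3, FreeGroup.norm_of] at hnu
        have h5 := FreeGroup.norm_conj_le (u (i + 1) * d) (z i)
        have h6 := FreeGroup.norm_mul_le (u (i + 1)) d
        have h7 := FreeGroup.norm_reduced_conj n1 n2
        have : (u (i + 1) * of (z (i + 1)) * (u (i + 1))⁻¹)⁻¹ * (u i * of (z i) * (u i)⁻¹) *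
            (u (i + 1) * of (z (i + 1)) * (u (i + 1))⁻¹) =
            u (i + 1) * d * of (z i) * (u (i + 1) * d)⁻¹ := by
          rw [hui]; group
        rw [this]
        omega
  · push Not at hA
    obtain ⟨i, hi, hnc⟩ := hA
    obtain ⟨e1, n1, n2⟩ := huz i (by omega)
    obtain ⟨e2, n3, n4⟩ := huz (i + 1) hi
    have hkey : NoCancel (of (z i))⁻¹ (of (z i) * ((u i)⁻¹ * u (i + 1))) := by
      rcases FreeGroup.noCancel_of_or (z i) ((u i)⁻¹ * u (i + 1)) with h | h
      · exact absurd h hnc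
      · exact h
    have s1 : (sigma n i)⁻¹ (X n i) = X n i * X n (i + 1) * (X n i)⁻¹ := by simp [sigma_inv_X hi]
    have s2 : (sigma n i)⁻¹ (X n (i + 1)) = X n i := by simp [sigma_inv_X hi]
    refine hstep i hi (sigma n i)⁻¹ (inv_mem (mem_braidSub _ hi)) (fun j h h' => ?_) ?_ ?_ ?_ ?_
    · simp [sigma_inv_X hi, h, h']
    · nth_rewrite 1 [← sigma_W_of_gt hi hi]
      rw [MulAut.inv_apply_self]
    · obtain ⟨j, hj, hc⟩ := h1 (i + 1) hi
      refine ⟨j, hj, hc.trans (isConj_iff.mpr ⟨g (X n i), ?_⟩)⟩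
      rw [s1]; simp
    · rw [s2]; exact h1 _ (by omega)
    · rw [s1, s2, add_comm]
      refine Nat.add_lt_add_left ?_ _
      simp only [_root_.map_mul, _root_.map_inv]
      rw [e1, e2]
      have hui : u (i + 1) = u i * (of (z i))⁻¹ * (of (z i) * ((u i)⁻¹ * u (i + 1))) := by group
      generalize of (z i) * ((u i)⁻¹ * u (i + 1)) = d at *
      have n5 : NoCancel (u i) (of (z i))⁻¹ := by simpa using n2.inv
      have hnu := n5.mul_left hkey (inv_ne_one.mpr (FreeGroup.of_ne_one _))
      rw [NoCancel, ← hui, n5, FreeGroup.norm_inv_eq, FreeGroup.norm_of] at hnu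
      have h5 := FreeGroup.norm_conj_le (u i * d) (z (i + 1))
      have h6 := FreeGroup.norm_mul_le (u i) d
      have h7 := FreeGroup.norm_reduced_conj n3 n4
      have : u i * of (z i) * (u i)⁻¹ * (u (i + 1) * of (z (i + 1)) * (u (i + 1))⁻¹) *
          (u i * of (z i) * (u i)⁻¹)⁻¹ = u i * d * of (z (i + 1)) * (u i * d)⁻¹ := by
        rw [hui]; group
      rw [this]
      omega

end ArtinBAut

namespace ArtinBAut

open FreeGroup (of)

section Quotient

variable {n : ℕ}

theorem IsBraidB.map {G H : Type*} [Group G] [Group H] {M : ℕ} {s : ℕ → G} {z : G}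
    (h : IsBraidB M s z) (f : G →* H) : IsBraidB M (fun i => f (s i)) (f z) where
  isBraid := h.isBraid.map f
  comm i hi := (h.comm i hi).map f
  four i hi := by simpa using congrArg f (h.four i hi)

/-- The images of the standard generators in the central quotient. -/
def sb (n i : ℕ) : AbarB n := πB n (sA n i)

/-- The action of the central quotient on the free group. -/
def ev (n : ℕ) : AbarB n →* MulAut (FreeGroup (Fin n)) :=
  if h : 2 ≤ n then QuotientGroup.lift _ (act n) (ker_act h).ge else 1

/-- The free normal subgroup acting by inner automorphisms. -/
def inn (n : ℕ) : FreeGroup (Fin n) →* AbarB n := (πB n).comp (iotaA n)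

theorem ev_πB (hn : 2 ≤ n) (a : ArtinB n) : ev n (πB n a) = act n a := by
  rw [ev, dif_pos hn]; rfl

theorem πB_surjective : Function.Surjective (πB n) := QuotientGroup.mk'_surjective _

theorem ev_injective (hn : 2 ≤ n) : Function.Injective (ev n) := by
  rw [injective_iff_map_eq_one]
  intro a ha
  obtain ⟨b, rfl⟩ := πB_surjective a
  rw [ev_πB hn] at ha
  have : b ∈ (act n).ker := ha
  rw [ker_act hn] at this
  exact (QuotientGroup.eq_one_iff b).mpr this

theorem ev_inn (hn : 2 ≤ n) (y : FreeGroup (Fin n)) : ev n (inn n y) = MulAut.conj y := by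
  rw [inn, MonoidHom.comp_apply, ev_πB hn, act_iotaA hn]

theorem ev_sb {i : ℕ} (hi : i + 1 < n) : ev n (sb n i) = sigma n i := by
  rw [sb, ev_πB (by omega), act_sA hi]

theorem sb_last (hn : 2 ≤ n) : sb n (n - 1) = inn n (X n (n - 1)) := by
  apply ev_injective hn
  rw [ev_inn hn, sb, ev_πB hn, act_sA_last (by omega)]

theorem inn_equivariant (hn : 2 ≤ n) (g : AbarB n) (y : FreeGroup (Fin n)) :
    g * inn n y * g⁻¹ = inn n (ev n g y) := by
  apply ev_injective hn
  simp only [_root_.map_mul, _root_.map_inv, ev_inn hn]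
  exact mul_conj_eq _ _

theorem inn_injective (hn : 2 ≤ n) : Function.Injective (inn n) := by
  intro x y h
  apply conj_injective hn
  rw [← ev_inn hn, h, ev_inn hn]

theorem isBraidB_sb (hn : 2 ≤ n) : IsBraidB (n - 1) (sb n) (sb n (n - 1)) :=
  (isBraidB_sA hn).map (πB n)

theorem isBraid_sb (hn : 2 ≤ n) : IsBraid (n - 1) (sb n) := (isBraidB_sb hn).isBraid

theorem map_braidSub {G H : Type*} [Group G] [Group H] (f : G →* H) (s : ℕ → G) (m : ℕ) :
    (braidSub s m).map f = braidSub (fun i => f (s i)) m := by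
  rw [braidSub, braidSub, MonoidHom.map_closure]
  congr 1
  ext x
  simp only [Set.mem_image, Set.mem_ofPred_eq]
  exact ⟨by rintro ⟨_, ⟨i, hi, rfl⟩, rfl⟩; exact ⟨i, hi, rfl⟩,
    by rintro ⟨i, hi, rfl⟩; exact ⟨_, ⟨i, hi, rfl⟩, rfl⟩⟩

theorem braidSub_congr {G : Type*} [Group G] {s t : ℕ → G} {m : ℕ}
    (h : ∀ i, i + 1 < m → s i = t i) : braidSub s m = braidSub t m := by
  rw [braidSub, braidSub]
  congr 1
  ext x
  exact ⟨by rintro ⟨i, hi, rfl⟩; exact ⟨i, hi, h i hi⟩,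
    by rintro ⟨i, hi, rfl⟩; exact ⟨i, hi, (h i hi).symm⟩⟩

theorem map_ev_braidSub {m : ℕ} (hm : m ≤ n) :
    (braidSub (sb n) m).map (ev n) = braidSub (sigma n) m := by
  rw [map_braidSub]
  exact braidSub_congr fun i hi => ev_sb (by omega)

theorem ev_mem_braidSub {m : ℕ} (hm : m ≤ n) {b : AbarB n} (hb : b ∈ braidSub (sb n) m) :
    ev n b ∈ braidSub (sigma n) m := by
  rw [← map_ev_braidSub hm]; exact Subgroup.mem_map_of_mem _ hb

theorem exists_inn_mul (hn : 2 ≤ n) (g : AbarB n) :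
    ∃ y, ∃ b ∈ braidSub (sb n) n, g = inn n y * b := by
  obtain ⟨a, rfl⟩ := πB_surjective g
  obtain ⟨y, b, hb, rfl⟩ := exists_iotaA_mul hn a
  refine ⟨y, πB n b, ?_, by simp [inn]⟩
  have := map_braidSub (πB n) (sA n) n
  change _ ∈ braidSub (fun i => πB n (sA n i)) n
  rw [← this]; exact Subgroup.mem_map_of_mem _ hb

/-- Automorphisms permuting the conjugacy classes of the letters. -/
def permSub (n : ℕ) : Submonoid (MulAut (FreeGroup (Fin n))) where
  carrier := {g | ∀ i < n, ∃ j < n, IsConj (X n j) (g (X n i))}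
  one_mem' i hi := ⟨i, hi, IsConj.refl _⟩
  mul_mem' := by
    intro g h hg hh i hi
    obtain ⟨j, hj, h1⟩ := hh i hi
    obtain ⟨k, hk, h2⟩ := hg j hj
    exact ⟨k, hk, h2.trans (g.toMonoidHom.map_isConj h1)⟩

theorem sigma_permutes {i : ℕ} (hi : i + 1 < n) : sigma n i ∈ permSub n := by
  intro j hj
  by_cases h1 : j = i
  · subst h1; exact ⟨j + 1, hi, by rw [sigma_X_self hi]⟩
  by_cases h2 : j = i + 1
  · subst h2
    exact ⟨i, by omega, isConj_iff.mpr ⟨(X n (i + 1))⁻¹, by rw [sigma_X_succ hi, inv_inv]⟩⟩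
  · exact ⟨j, hj, by rw [sigma_X_ne hi h1 h2]⟩

theorem sigma_inv_permutes {i : ℕ} (hi : i + 1 < n) : (sigma n i)⁻¹ ∈ permSub n := by
  intro j hj
  rw [sigma_inv_X hi]
  split_ifs with h1 h2
  · exact ⟨i + 1, hi, isConj_iff.mpr ⟨X n i, rfl⟩⟩
  · exact ⟨i, by omega, IsConj.refl _⟩
  · exact ⟨j, hj, IsConj.refl _⟩

theorem braidSub_permutes {b : MulAut (FreeGroup (Fin n))} (hb : b ∈ braidSub (sigma n) n) :
    b ∈ permSub n :=
  closure_induction_right_pm (one_mem _)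
    (fun g hg t ht => by
      obtain ⟨i, hi, rfl⟩ := ht; exact mul_mem hg (sigma_permutes hi))
    (fun g hg t ht => by
      obtain ⟨i, hi, rfl⟩ := ht; exact mul_mem hg (sigma_inv_permutes hi)) hb

theorem isConj_conj_apply {G : Type*} [Group G] (y x : G) : IsConj x (MulAut.conj y x) :=
  isConj_iff.mpr ⟨y, rfl⟩

theorem ev_permutes (hn : 2 ≤ n) (g : AbarB n) : ev n g ∈ permSub n := by
  obtain ⟨y, b, hb, rfl⟩ := exists_inn_mul hn g
  rw [_root_.map_mul]
  refine mul_mem ?_ (braidSub_permutes (ev_mem_braidSub le_rfl hb))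
  intro i hi
  exact ⟨i, hi, by rw [ev_inn hn]; exact isConj_conj_apply _ _⟩

theorem ev_W (hn : 2 ≤ n) (g : AbarB n) : IsConj (W n n) (ev n g (W n n)) := by
  obtain ⟨y, b, hb, rfl⟩ := exists_inn_mul hn g
  rw [_root_.map_mul, MulAut.mul_apply, braidSub_W le_rfl le_rfl (ev_mem_braidSub le_rfl hb),
    ev_inn hn]
  exact isConj_conj_apply _ _

theorem mem_range_ev (hn : 2 ≤ n) {g : MulAut (FreeGroup (Fin n))} (hg : g ∈ permSub n)
    (hW : IsConj (W n n) (g (W n n))) : g ∈ (ev n).range := by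
  obtain ⟨c, hc⟩ := isConj_iff.mp hW
  have h1 : MulAut.conj c⁻¹ * g ∈ braidSub (sigma n) n := by
    apply mem_braidSub_of_fix
    · refine (permSub n).mul_mem ?_ hg
      exact fun i hi => ⟨i, hi, isConj_conj_apply _ _⟩
    · rw [MulAut.mul_apply, ← hc]; simp [mul_assoc]
  rw [← map_ev_braidSub le_rfl] at h1
  obtain ⟨b, -, hb⟩ := h1
  refine ⟨inn n c * b, ?_⟩
  rw [_root_.map_mul, hb, ev_inn hn, ← mul_assoc, ← _root_.map_mul]
  simp

theorem exists_of_isConj_ev (hn : 2 ≤ n) (g : AbarB n) (i : Fin n) :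
    ∃ j : Fin n, IsConj (of j) (ev n g (of i)) := by
  obtain ⟨j, hj, h⟩ := ev_permutes hn g i i.2
  exact ⟨⟨j, hj⟩, by rwa [of_eq_X, of_eq_X]⟩

theorem of_isConj {i j : Fin n} (h : IsConj (of i) (of j)) : i = j := by
  rw [of_eq_X, of_eq_X] at h
  exact Fin.ext (isConj_X i.2 h)

open Classical in
/-- The permutation of the conjugacy classes of the letters. -/
noncomputable def permFun (n : ℕ) (g : AbarB n) : Function.End (Fin n) := fun i =>
  if h : ∃ j : Fin n, IsConj (of j) (ev n g (of i)) then h.choose else i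

theorem permFun_spec (hn : 2 ≤ n) (g : AbarB n) (i : Fin n) :
    IsConj (of (permFun n g i)) (ev n g (of i)) := by
  rw [permFun, dif_pos (exists_of_isConj_ev hn g i)]
  exact (exists_of_isConj_ev hn g i).choose_spec

theorem permFun_eq (hn : 2 ≤ n) {g : AbarB n} {i j : Fin n} (h : IsConj (of j) (ev n g (of i))) :
    permFun n g i = j := of_isConj ((permFun_spec hn g i).trans h.symm)

/-- The permutation of the letters induced by an element of the central quotient. -/
noncomputable def perm (hn : 2 ≤ n) : AbarB n →* Equiv.Perm (Fin n) :=
  MonoidHom.toHomPerm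
    { toFun := permFun n
      map_one' := funext fun i => permFun_eq hn (by rw [_root_.map_one]; exact IsConj.refl _)
      map_mul' := fun g h => funext fun i => permFun_eq hn (by
        rw [_root_.map_mul]
        exact (permFun_spec hn g _).trans ((ev n g).toMonoidHom.map_isConj (permFun_spec hn h i))) }

theorem perm_spec (hn : 2 ≤ n) (g : AbarB n) (i : Fin n) :
    IsConj (X n (perm hn g i)) (ev n g (X n i)) := by
  rw [← of_eq_X, ← of_eq_X]
  exact permFun_spec hn g i

theorem perm_eq (hn : 2 ≤ n) {g : AbarB n} {i j : Fin n} (h : IsConj (X n j) (ev n g (X n i))) :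
    perm hn g i = j := by
  rw [← of_eq_X, ← of_eq_X] at h
  exact permFun_eq hn h

theorem perm_sb (hn : 2 ≤ n) {i : ℕ} (hi : i + 1 < n) :
    perm hn (sb n i) = Equiv.swap ⟨i, by omega⟩ ⟨i + 1, hi⟩ := by
  ext1 k
  apply perm_eq hn
  rw [ev_sb hi]
  by_cases h1 : k = ⟨i, by omega⟩
  · subst h1; rw [Equiv.swap_apply_left, sigma_X_self hi]
  by_cases h2 : k = ⟨i + 1, hi⟩
  · subst h2; rw [Equiv.swap_apply_right, sigma_X_succ hi]
    exact isConj_iff.mpr ⟨(X n (i + 1))⁻¹, by simp⟩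
  · rw [Equiv.swap_apply_of_ne_of_ne h1 h2, sigma_X_ne hi]
    · exact fun h => h1 (Fin.ext h)
    · exact fun h => h2 (Fin.ext h)

theorem perm_surjective (hn : 2 ≤ n) : Function.Surjective (perm hn) := by
  obtain ⟨k, rfl⟩ : ∃ k, n = k + 1 := ⟨n - 1, by omega⟩
  rw [← MonoidHom.range_eq_top, eq_top_iff]
  have h := Equiv.Perm.mclosure_swap_castSucc_succ k
  intro g _
  have hg : g ∈ Submonoid.closure (Set.range fun i : Fin k => Equiv.swap i.castSucc i.succ) := by
    rw [h]; trivial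
  have : Submonoid.closure (Set.range fun i : Fin k => Equiv.swap i.castSucc i.succ) ≤
      (perm hn).range.toSubmonoid := by
    rw [Submonoid.closure_le]
    rintro _ ⟨i, rfl⟩
    exact ⟨sb (k + 1) i, perm_sb hn (by omega)⟩
  exact this hg

/-- The subgroup of elements preserving all conjugacy classes of letters. -/
noncomputable def pure (hn : 2 ≤ n) : Subgroup (AbarB n) := (perm hn).ker

instance (hn : 2 ≤ n) : (pure hn).Normal := by rw [pure]; infer_instance

theorem mem_pure (hn : 2 ≤ n) {g : AbarB n} :
    g ∈ pure hn ↔ ∀ i < n, IsConj (X n i) (ev n g (X n i)) := by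
  constructor
  · intro h i hi
    have := perm_spec hn g ⟨i, hi⟩
    rwa [show perm hn g = 1 from h] at this
  · intro h
    refine MonoidHom.mem_ker.mpr (Equiv.ext fun i => perm_eq hn (h i i.2))

theorem inn_mem_pure (hn : 2 ≤ n) (y : FreeGroup (Fin n)) : inn n y ∈ pure hn := by
  rw [mem_pure]
  intro i hi
  rw [ev_inn hn]
  exact isConj_conj_apply _ _

theorem sb_sq_mem_pure (hn : 2 ≤ n) {i : ℕ} (hi : i + 1 < n) : sb n i ^ 2 ∈ pure hn := by
  rw [pure, MonoidHom.mem_ker, _root_.map_pow, perm_sb hn hi, pow_two, Equiv.swap_mul_self]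

theorem topSub_le {G : Type*} [Group G] {s : ℕ → G} {m : ℕ} {N : Subgroup G} [N.Normal]
    (h : s m ^ 2 ∈ N) : topSub s m ≤ N := by
  rw [topSub, Subgroup.closure_le]
  rintro _ ⟨j, -, rfl⟩
  have := Subgroup.Normal.conj_mem ‹N.Normal› _ h (desc s j m)⁻¹
  rwa [inv_inv] at this

theorem exists_combing_pure (hn : 2 ≤ n) {m : ℕ} (hm : m + 1 < n) {b : AbarB n}
    (hb : b ∈ braidSub (sb n) (m + 2)) (hp : b ∈ pure hn) :
    ∃ u ∈ topSub (sb n) m, ∃ b' ∈ braidSub (sb n) (m + 1), b' ∈ pure hn ∧ b = u * b' := by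
  obtain ⟨u, hu, b', hb', k, hk, rfl⟩ := (isBraid_sb hn).combing (by omega) hb
  have hu' : u ∈ pure hn := topSub_le (sb_sq_mem_pure hn hm) hu
  have hkm : k = m + 1 := by
    have h := (mem_pure hn).mp hp k (by omega)
    rw [_root_.map_mul, _root_.map_mul, MulAut.mul_apply, MulAut.mul_apply, map_desc,
      desc_congr (t := sigma n) fun i hi => ev_sb (by omega), desc_sigma_X hk hm,
      braidSub_X (by omega) le_rfl (ev_mem_braidSub (by omega) hb')] at h
    exact isConj_X (by omega) (h.trans ((mem_pure hn).mp hu' _ hm).symm)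
  subst hkm
  rw [desc_of_le _ le_rfl, mul_one] at hp ⊢
  exact ⟨u, hu, b', hb', (Subgroup.mul_mem_cancel_left _ hu').mp hp, rfl⟩

theorem braidSub_one {G : Type*} [Group G] (s : ℕ → G) : braidSub s 1 = ⊥ := by
  rw [braidSub, Subgroup.closure_eq_bot_iff]
  rintro _ ⟨i, hi, rfl⟩
  omega

theorem mem_of_pure_of_mem_braidSub (hn : 2 ≤ n) {N : Subgroup (AbarB n)} [N.Normal]
    (h : ∀ i, i + 1 < n → sb n i ^ 2 ∈ N) : ∀ {m : ℕ}, m < n → ∀ {b : AbarB n},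
    b ∈ braidSub (sb n) (m + 1) → b ∈ pure hn → b ∈ N
  | 0, _, b, hb, _ => by
    rw [zero_add, braidSub_one, Subgroup.mem_bot] at hb
    rw [hb]; exact one_mem _
  | m + 1, hm, b, hb, hp => by
    obtain ⟨u, hu, b', hb', hp', rfl⟩ := exists_combing_pure hn hm hb hp
    exact mul_mem (topSub_le (h m hm) hu)
      (mem_of_pure_of_mem_braidSub hn h (by omega) hb' hp')

theorem exists_inn_mul_pure (hn : 2 ≤ n) {g : AbarB n} (hg : g ∈ pure hn) :
    ∃ y, ∃ b ∈ braidSub (sb n) n, b ∈ pure hn ∧ g = inn n y * b := by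
  obtain ⟨y, b, hb, rfl⟩ := exists_inn_mul hn g
  exact ⟨y, b, hb, (Subgroup.mul_mem_cancel_left _ (inn_mem_pure hn y)).mp hg, rfl⟩

theorem pure_le (hn : 2 ≤ n) {N : Subgroup (AbarB n)} [N.Normal]
    (h : ∀ i, i + 1 < n → sb n i ^ 2 ∈ N) (hU : (inn n).range ≤ N) : pure hn ≤ N := by
  intro g hg
  obtain ⟨y, b, hb, hp, rfl⟩ := exists_inn_mul_pure hn hg
  refine mul_mem (hU ⟨y, rfl⟩) ?_
  obtain ⟨k, rfl⟩ : ∃ k, n = k + 1 := ⟨n - 1, by omega⟩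
  exact mem_of_pure_of_mem_braidSub hn h (by omega) hb hp

theorem sb_induction {p : Subgroup (AbarB n)} (h : ∀ i < n, sb n i ∈ p) : p = ⊤ := by
  rw [eq_top_iff]
  intro a _
  obtain ⟨b, rfl⟩ := πB_surjective a
  have : p.comap (πB n) = ⊤ := artinB_induction h
  exact (this.ge trivial : b ∈ p.comap (πB n))

end Quotient

end ArtinBAut

namespace ArtinBAut

section BraidTuples

variable {G : Type*} [Group G] {N : ℕ} {s : ℕ → G}

theorem IsBraid.exists_shift (h : IsBraid N s) :
    ∃ D : G, ∀ j, j + 1 < N → s j = D * s (j + 1) * D⁻¹ :=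
  ⟨desc s 0 N, fun j hj => by rw [h.desc_mul_of_gt (Nat.zero_le _) hj le_rfl]; group⟩

theorem IsBraid.isConj_zero (h : IsBraid N s) {j : ℕ} (hj : j < N) : IsConj (s j) (s 0) := by
  obtain ⟨D, hD⟩ := h.exists_shift
  induction j with
  | zero => exact IsConj.refl _
  | succ j ih => exact (isConj_iff.mpr ⟨D, (hD j hj).symm⟩).trans (ih (by omega))

theorem IsBraid.const_of_eq_succ (h : IsBraid N s) {i : ℕ} (hi : i + 1 < N)
    (he : s i = s (i + 1)) : ∀ j < N, s j = s 0 := by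
  obtain ⟨D, hD⟩ := h.exists_shift
  have key : ∀ j, j + 2 < N → (s j = s (j + 1) ↔ s (j + 1) = s (j + 2)) := fun j hj => by
    rw [hD j (by omega), hD (j + 1) (by omega)]
    simp only [mul_left_inj, mul_right_inj]
  have h0 : s 0 = s 1 := by
    induction i with
    | zero => exact he
    | succ i ih => exact ih (by omega) ((key i hi).mpr he)
  have hall : ∀ j, j + 1 < N → s j = s (j + 1) := fun j hj => by
    induction j with
    | zero => exact h0
    | succ j ih => exact (key j hj).mp (ih (by omega))
  intro j hj
  induction j with
  | zero => rfl
  | succ j ih => rw [← hall j hj, ih (by omega)]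

theorem eq_of_braid_of_commute {a b : G} (h : a * b * a = b * a * b) (hc : a * b = b * a) :
    a = b := by
  rw [hc] at h
  exact mul_left_cancel h

theorem IsBraid.const_of_commute_succ (h : IsBraid N s) {i : ℕ} (hi : i + 1 < N)
    (hc : s i * s (i + 1) = s (i + 1) * s i) : ∀ j < N, s j = s 0 :=
  h.const_of_eq_succ hi (eq_of_braid_of_commute (h.braid i hi) hc)

theorem IsBraid.const_of_eq_add_two' (h : IsBraid N s) {i : ℕ} (hi : i + 3 < N)
    (he : s (i + 1) = s (i + 3)) : ∀ j < N, s j = s 0 := by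
  have := h.comm i (i + 3) (by omega) hi
  rw [← he] at this
  exact h.const_of_commute_succ (by omega) this

theorem IsBraid.const_of_commute_mul_inv (h : IsBraid N s) {i j : ℕ} (hij : i + 2 ≤ j)
    (hj : j + 1 < N)
    (hc : Commute (s j * (s i)⁻¹) (s (j + 1) * (s i)⁻¹)) : ∀ j < N, s j = s 0 := by
  have h1 : Commute (s i)⁻¹ (s j) := (h.comm i j hij (by omega)).inv_left
  have h2 : Commute (s i)⁻¹ (s (j + 1)) := (h.comm i (j + 1) (by omega) hj).inv_left
  refine h.const_of_commute_succ hj ?_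
  have e : s j * (s i)⁻¹ * (s (j + 1) * (s i)⁻¹) = s (j + 1) * (s i)⁻¹ * (s j * (s i)⁻¹) := hc
  rw [show s j * (s i)⁻¹ * (s (j + 1) * (s i)⁻¹) = s j * ((s i)⁻¹ * s (j + 1)) * (s i)⁻¹ by group,
    show s (j + 1) * (s i)⁻¹ * (s j * (s i)⁻¹) = s (j + 1) * ((s i)⁻¹ * s j) * (s i)⁻¹ by group,
    h2.eq, h1.eq, ← mul_assoc, ← mul_assoc] at e
  exact mul_right_cancel (mul_right_cancel e)

/-- A braid tuple in a subgroup, obtained by dropping the first two entries. -/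
theorem IsBraid.exists_drop_two (h : IsBraid N s) :
    ∃ t : ℕ → Subgroup.centralizer {s 0}, IsBraid (N - 2) t ∧
      ∀ i, i + 2 < N → (t i : G) = s (i + 2) := by
  have hc : ∀ i, i + 2 < N → s (i + 2) ∈ Subgroup.centralizer {s 0} := fun i hi =>
    Subgroup.mem_centralizer_singleton_iff.mpr (h.comm 0 (i + 2) (by omega) hi).eq.symm
  have ht : ∀ i, i + 2 < N →
      ((if hi : i + 2 < N then ⟨s (i + 2), hc i hi⟩ else 1 : Subgroup.centralizer {s 0}) : G) =
        s (i + 2) := fun i hi => by rw [dif_pos hi]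
  refine ⟨fun i => if hi : i + 2 < N then ⟨s (i + 2), hc i hi⟩ else 1, ⟨?_, ?_⟩, ht⟩
  · intro i hi
    apply Subtype.ext
    simp only [Subgroup.coe_mul]
    rw [ht i (by omega), ht (i + 1) (by omega)]
    exact h.braid (i + 2) (by omega)
  · intro i j hij hj
    apply Subtype.ext
    simp only [Subgroup.coe_mul]
    rw [ht i (by omega), ht j (by omega)]
    exact (h.comm (i + 2) (j + 2) (by omega) (by omega)).eq

end BraidTuples

section PermCentralizer

open Equiv.Perm Equiv.Perm.OnCycleFactors Subgroup

variable {X : Type*} [Fintype X] [DecidableEq X]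

/-- The action of the centralizer of a permutation on its fixed points. -/
def fixHom (σ : Equiv.Perm X) :
    centralizer {σ} →* Equiv.Perm (Function.fixedPoints σ) where
  toFun k := (k : Equiv.Perm X).subtypePerm fun x => by
    have h := mem_centralizer_singleton_iff.mp k.2
    have hx := congrArg (fun f => f x) h
    simp only [Equiv.Perm.mul_apply] at hx
    change σ ((k : Equiv.Perm X) x) = (k : Equiv.Perm X) x ↔ σ x = x
    rw [← hx]
    exact (k : Equiv.Perm X).injective.eq_iff
  map_one' := rfl
  map_mul' _ _ := rfl

omit [Fintype X] [DecidableEq X] in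
theorem fixHom_apply {σ : Equiv.Perm X} {k : centralizer {σ}} (h : k ∈ (fixHom σ).ker) {x : X}
    (hx : σ x = x) : (k : Equiv.Perm X) x = x :=
  congrArg Subtype.val (congrArg (fun f => f ⟨x, hx⟩) (MonoidHom.mem_ker.mp h))

theorem exists_zpow_apply {σ : Equiv.Perm X} {k : centralizer {σ}} (h : k ∈ (toPermHom σ).ker)
    {x : X} (hx : σ x ≠ x) : ∃ i : ℤ, (k : Equiv.Perm X) x = (σ ^ i) x := by
  have h1 := (mem_ker_toPermHom_iff σ k).mp h (σ.cycleOf x)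
    (cycleOf_mem_cycleFactorsFinset_iff.mpr (mem_support.mpr hx))
  have h2 : (σ.cycleOf x) ((k : Equiv.Perm X) x) ≠ (k : Equiv.Perm X) x := by
    have := congrArg (fun f => f x) h1.eq
    simp only [Equiv.Perm.mul_apply, cycleOf_apply_self] at this
    rw [← this]
    exact fun h => hx ((k : Equiv.Perm X).injective h)
  have h3 : σ.SameCycle x ((k : Equiv.Perm X) x) := by
    by_contra hn
    exact h2 (cycleOf_apply_of_not_sameCycle hn)
  obtain ⟨i, hi⟩ := h3
  exact ⟨i, hi.symm⟩

omit [Fintype X] [DecidableEq X] in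
theorem zpow_apply_comm' {σ : Equiv.Perm X} (k : centralizer {σ}) (i : ℤ) (x : X) :
    (k : Equiv.Perm X) ((σ ^ i) x) = (σ ^ i) ((k : Equiv.Perm X) x) := by
  have h : Commute (k : Equiv.Perm X) σ := mem_centralizer_singleton_iff.mp k.2
  exact congrArg (fun f => f x) (h.zpow_right i).eq

theorem commute_of_mem_ker {σ : Equiv.Perm X} {k l : centralizer {σ}}
    (hk : k ∈ (toPermHom σ).ker) (hk' : k ∈ (fixHom σ).ker) (hl : l ∈ (toPermHom σ).ker) :
    Commute k l := by
  apply Subtype.ext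
  ext x
  change (k : Equiv.Perm X) ((l : Equiv.Perm X) x) = (l : Equiv.Perm X) ((k : Equiv.Perm X) x)
  by_cases hx : σ x = x
  · have : σ ((l : Equiv.Perm X) x) = (l : Equiv.Perm X) x := by
      have h := zpow_apply_comm' l 1 x
      rw [zpow_one, hx] at h
      exact h.symm
    rw [fixHom_apply hk' hx, fixHom_apply hk' this]
  · obtain ⟨i, hi⟩ := exists_zpow_apply hk hx
    obtain ⟨j, hj⟩ := exists_zpow_apply hl hx
    rw [hi, hj, zpow_apply_comm', zpow_apply_comm', hi, hj, ← Equiv.Perm.mul_apply,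
      ← Equiv.Perm.mul_apply, ← zpow_add, ← zpow_add, add_comm]

theorem pow_eq_one_of_mem_ker {σ : Equiv.Perm X} {k : centralizer {σ}}
    (hk : k ∈ (toPermHom σ).ker) (hk' : k ∈ (fixHom σ).ker) {L : ℕ} (hL : σ ^ L = 1) :
    k ^ L = 1 := by
  apply Subtype.ext
  ext x
  rw [SubgroupClass.coe_pow]
  change ((k : Equiv.Perm X) ^ L) x = x
  by_cases hx : σ x = x
  · exact fixHom_apply (pow_mem hk' L) hx
  · obtain ⟨i, hi⟩ := exists_zpow_apply hk hx
    have h : ∀ M : ℕ, ((k : Equiv.Perm X) ^ M) x = (σ ^ (i * M)) x := fun M => by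
      induction M with
      | zero => simp
      | succ M ih =>
        rw [pow_succ', Equiv.Perm.mul_apply, ih, zpow_apply_comm', hi, ← Equiv.Perm.mul_apply,
          ← zpow_add]
        congr 2; push_cast; ring
    rw [h, mul_comm, zpow_mul, zpow_natCast, hL, one_zpow, Equiv.Perm.one_apply]

theorem pow_eq_one_of_cycleType {σ : Equiv.Perm X} {L : ℕ} (h : ∀ x ∈ σ.cycleType, x ∣ L) :
    σ ^ L = 1 := by
  rw [← orderOf_dvd_iff_pow_eq_one, ← lcm_cycleType]
  exact Multiset.lcm_dvd.mpr h

theorem two_mul_card_cycleFactorsFinset_le (σ : Equiv.Perm X) :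
    2 * σ.cycleFactorsFinset.card ≤ σ.support.card := by
  have h : σ.cycleFactorsFinset.card = σ.cycleType.card := by
    rw [cycleType_def, Multiset.card_map]; rfl
  rw [h, ← sum_cycleType, mul_comm, ← smul_eq_mul]
  exact Multiset.card_nsmul_le_sum fun x hx => two_le_of_mem_cycleType hx

theorem add_two_mul_card_le {σ : Equiv.Perm X} {x : ℕ} (hx : x ∈ σ.cycleType) :
    x + 2 * (σ.cycleFactorsFinset.card - 1) ≤ σ.support.card := by
  have h : σ.cycleFactorsFinset.card = σ.cycleType.card := by
    rw [cycleType_def, Multiset.card_map]; rfl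
  have h2 : ∀ y ∈ σ.cycleType, 2 ≤ y := fun y hy => two_le_of_mem_cycleType hy
  rw [h, ← sum_cycleType]
  obtain ⟨t, ht⟩ := Multiset.exists_cons_of_mem hx
  rw [ht] at h2 ⊢
  rw [Multiset.card_cons, Multiset.sum_cons, Nat.add_sub_cancel, mul_comm, ← smul_eq_mul]
  exact Nat.add_le_add_left (Multiset.card_nsmul_le_sum fun y hy =>
    h2 y (Multiset.mem_cons_of_mem hy)) x

theorem card_fixed_add (σ : Equiv.Perm X) :
    Fintype.card (Function.fixedPoints σ) + σ.support.card = Fintype.card X := by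
  have := Equiv.Perm.card_fixedPoints σ
  have h := sum_cycleType_le σ
  rw [sum_cycleType] at *
  omega

theorem exists_pow_eq_one_of_swap {σ : Equiv.Perm X} {a : centralizer {σ}}
    (ha : a ∉ (toPermHom σ).ker) (hc : σ.cycleFactorsFinset.card ≤ 2) :
    ∃ l, 2 ≤ l ∧ 2 * l ≤ Fintype.card X ∧ σ ^ l = 1 := by
  rw [MonoidHom.mem_ker, Equiv.ext_iff] at ha
  push Not at ha
  obtain ⟨c, hcne⟩ := ha
  set d := toPermHom σ a c with hd
  have hcd : d.1.support.card = c.1.support.card := by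
    rw [hd, coe_toPermHom, Equiv.Perm.support_conj, Finset.card_map]
  have hne : c.1 ≠ d.1 := fun h => hcne (Subtype.ext h.symm)
  have hall : σ.cycleFactorsFinset = {c.1, d.1} := by
    symm
    apply Finset.eq_of_subset_of_card_le
    · intro x hx
      rw [Finset.mem_insert, Finset.mem_singleton] at hx
      rcases hx with rfl | rfl
      · exact c.2
      · exact d.2
    · rw [Finset.card_pair hne]; exact hc
  have hmem : c.1.support.card ∈ σ.cycleType := by
    rw [cycleType_def]
    exact Multiset.mem_map_of_mem _ c.2
  have hsum : σ.cycleType.sum = c.1.support.card + d.1.support.card := by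
    have : σ.cycleType.sum = ∑ x ∈ σ.cycleFactorsFinset, x.support.card := by
      rw [cycleType_def]; rfl
    rw [this, ← Finset.sum_pair hne (f := fun x => x.support.card)]
    exact Finset.sum_congr hall fun _ _ => rfl
  refine ⟨c.1.support.card, two_le_of_mem_cycleType hmem, ?_, pow_eq_one_of_cycleType ?_⟩
  · have := sum_cycleType_le σ
    omega
  · intro x hx
    rw [cycleType_def, Multiset.mem_map] at hx
    obtain ⟨e, he, rfl⟩ := hx
    have : e ∈ σ.cycleFactorsFinset := he
    rw [hall, Finset.mem_insert, Finset.mem_singleton] at this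
    rcases this with rfl | rfl
    · exact dvd_rfl
    · exact hcd.dvd

theorem perm_small {Y : Type*} [Fintype Y] [DecidableEq Y] (hY : Fintype.card Y ≤ 2)
    (a b : Equiv.Perm Y) : Commute a b ∧ a ^ 2 = 1 := by
  have key : ∀ k ≤ 2, ∀ a b : Equiv.Perm (Fin k), a * b = b * a ∧ a ^ 2 = 1 := by
    intro k hk
    interval_cases k <;> decide
  have e := Fintype.equivFin Y
  obtain ⟨h1, h2⟩ := key _ hY (e.permCongrHom a) (e.permCongrHom b)
  constructor
  · apply e.permCongrHom.injective
    rw [_root_.map_mul, _root_.map_mul, h1]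
  · apply e.permCongrHom.injective
    rw [_root_.map_pow, _root_.map_one, h2]

theorem perm_three {Y : Type*} [Fintype Y] [DecidableEq Y] (hY : Fintype.card Y = 3)
    {a b c : Equiv.Perm Y} (h1 : a * b * a = b * a * b) (h2 : b * c * b = c * b * c)
    (h3 : a * c = c * a) (hne : a ≠ b) : a = c ∧ a ^ 2 = 1 ∧ b ^ 2 = 1 := by
  have key : ∀ a b c : Equiv.Perm (Fin 3), a * b * a = b * a * b → b * c * b = c * b * c →
      a * c = c * a → a ≠ b → a = c ∧ a ^ 2 = 1 ∧ b ^ 2 = 1 := by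
    have key' : ∀ a b c : Equiv.Perm (Fin 3), ¬(a * b * a = b * a * b ∧ b * c * b = c * b * c ∧
        a * c = c * a ∧ a ≠ b ∧ ¬(a = c ∧ a ^ 2 = 1 ∧ b ^ 2 = 1)) := by decide
    intro a b c h1 h2 h3 h4
    by_contra h
    exact key' a b c ⟨h1, h2, h3, h4, h⟩
  have e := (Fintype.equivFinOfCardEq hY).permCongrHom
  obtain ⟨k1, k2, k3⟩ := key (e a) (e b) (e c) (by simpa using congrArg e h1)
    (by simpa using congrArg e h2) (by simpa using congrArg e h3) (e.injective.ne hne)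
  exact ⟨e.injective k1, e.injective (by simpa using k2), e.injective (by simpa using k3)⟩

theorem eq_of_braid_of_two_cycles {σ : Equiv.Perm X} (hX : Fintype.card X ≤ 6)
    {a b : centralizer {σ}} (hab : a * b * a = b * a * b) (hconj : IsConj (a : Equiv.Perm X) σ)
    (hc : σ.cycleFactorsFinset.card ≤ 2)
    (hf : fixHom σ a = fixHom σ b) : a = b := by
  have hc' : Fintype.card σ.cycleFactorsFinset ≤ 2 := by rwa [Fintype.card_coe]
  have hA : toPermHom σ a = toPermHom σ b := by
    have := congrArg (toPermHom σ) hab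
    simp only [_root_.map_mul] at this
    exact eq_of_braid_of_commute this (perm_small hc' _ _).1
  have hkA : b * a⁻¹ ∈ (toPermHom σ).ker := by
    rw [MonoidHom.mem_ker, _root_.map_mul, _root_.map_inv, hA, mul_inv_cancel]
  have hkB : b * a⁻¹ ∈ (fixHom σ).ker := by
    rw [MonoidHom.mem_ker, _root_.map_mul, _root_.map_inv, hf, mul_inv_cancel]
  have ha2 : a * a ∈ (toPermHom σ).ker := by
    rw [MonoidHom.mem_ker, _root_.map_mul, ← pow_two, (perm_small hc' _ 1).2]
  obtain ⟨k, rfl⟩ : ∃ k, b = k * a := ⟨b * a⁻¹, by group⟩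
  rw [mul_inv_cancel_right] at hkA hkB
  have hcomm := commute_of_mem_ker hkA hkB ha2
  have h1 : a * k = k * k * a := by
    have e : a * k * a * a = k * (a * a) * k * a := by
      simpa only [mul_assoc] using hab
    rw [hcomm.eq, mul_assoc (a * a) k k, ← (hcomm.mul_left hcomm).eq] at e
    have e' : (a * k) * (a * a) = (k * k * a) * (a * a) := by
      simpa only [mul_assoc] using e
    exact mul_right_cancel e'
  suffices k = 1 by rw [this, one_mul]
  by_cases ha : a ∈ (toPermHom σ).ker
  · have := (commute_of_mem_ker hkA hkB ha).eq
    rw [← this, mul_assoc] at h1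
    have := mul_left_cancel h1
    exact (mul_eq_right.mp this.symm)
  · have h4 : k * (a * a) = k * k * k * k * (a * a) := by
      calc k * (a * a) = a * (a * k) := by rw [hcomm.eq, mul_assoc]
        _ = a * (k * k * a) := by rw [h1]
        _ = (a * k) * k * a := by group
        _ = (k * k * a) * k * a := by rw [h1]
        _ = k * k * (a * k) * a := by group
        _ = k * k * (k * k * a) * a := by rw [h1]
        _ = k * k * k * k * (a * a) := by group
    have h3 : k * k * k = 1 := by
      have := mul_right_cancel h4
      have e : 1 * k = k * k * k * k := by rw [one_mul]; exact this
      exact (mul_right_cancel e).symm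
    obtain ⟨l, hl1, hl2, hl⟩ := exists_pow_eq_one_of_swap ha hc
    have hl' : l = 2 ∨ l = 3 := by omega
    rcases hl' with rfl | rfl
    · have := pow_eq_one_of_mem_ker hkA hkB hl
      rwa [← pow_two, this, one_mul] at h3
    · obtain ⟨g, hg⟩ := isConj_iff.mp hconj
      have ha3 : a ^ 3 = 1 := by
        apply Subtype.ext
        have : (a : Equiv.Perm X) = g⁻¹ * σ * g := by
          refine Eq.trans ?_ (congrArg (fun z => g⁻¹ * z * g) hg)
          group
        rw [SubgroupClass.coe_pow, this]
        have e : (g⁻¹ * σ * g) ^ 3 = g⁻¹ * σ ^ 3 * g := by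
          rw [pow_succ, pow_two, pow_succ, pow_two]; group
        rw [e, hl]; simp
      exfalso
      apply ha
      have : a = a ^ 3 * (a * a)⁻¹ := by rw [pow_succ, pow_two]; group
      rw [this, ha3, one_mul]
      exact inv_mem ha2

end PermCentralizer

end ArtinBAut

namespace ArtinBAut

section BraidPerm

open Equiv.Perm Equiv.Perm.OnCycleFactors Subgroup

theorem const_of_zero_eq_one {G : Type*} [Group G] {N : ℕ} {s : ℕ → G} (h : IsBraid N s)
    (h0 : s 0 = 1) : ∀ i < N, s i = s 0 := fun i hi => by
  have := h.isConj_zero hi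
  rw [h0] at this ⊢
  exact isConj_one_left.mp this

theorem pow_eq_one_of_isConj {G : Type*} [Group G] {a b : G} (h : IsConj a b) {L : ℕ}
    (hb : b ^ L = 1) : a ^ L = 1 := by
  have := h.pow L
  rw [hb] at this
  exact isConj_one_left.mp this

theorem perm_eq_one_of_support_card_le_two {X : Type*} [Fintype X] [DecidableEq X]
    {k : Equiv.Perm X} (h : k.support.card ≤ 2) (hs : sign k = 1) : k = 1 := by
  have h1 := card_support_ne_one k
  by_cases h2 : k.support.card = 2
  · have := (card_support_eq_two.mp h2).sign_eq
    rw [hs] at this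
    exact absurd this (by decide)
  · exact card_support_eq_zero.mp (by omega)

theorem braid_perm_base {X : Type} [Fintype X] [DecidableEq X] {m : ℕ} (h5 : 5 ≤ m) (h6 : m ≤ 6)
    {s : ℕ → Equiv.Perm X} (h : IsBraid (m - 1) s) (hX : Fintype.card X ≤ m) :
    (∀ i < m - 1, s i = s 0) ∨ (Fintype.card X = m ∧ s 0 ^ 2 = 1) := by
  by_cases h0 : s 0 = 1
  · exact Or.inl (const_of_zero_eq_one h h0)
  have hsupp : 2 ≤ (s 0).support.card := two_le_card_support_of_ne_one h0
  have hfix := card_fixed_add (s 0)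
  have htwo : ∀ x ∈ (s 0).cycleType, 2 ≤ x := fun x hx => two_le_of_mem_cycleType hx
  have hcyc := two_mul_card_cycleFactorsFinset_le (s 0)
  have hcyc' : ∀ x ∈ (s 0).cycleType,
    x + 2 * ((s 0).cycleFactorsFinset.card - 1) ≤ (s 0).support.card := fun x hx =>
      add_two_mul_card_le hx
  by_cases hc3 : 3 ≤ (s 0).cycleFactorsFinset.card
  · refine Or.inr ⟨by omega, pow_eq_one_of_cycleType fun x hx => ?_⟩
    have := hcyc' x hx
    have := htwo x hx
    rw [show x = 2 by omega]
  obtain ⟨t, ht, hts⟩ := h.exists_drop_two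
  have hconj : ∀ i, i + 2 < m - 1 → IsConj (t i : Equiv.Perm X) (s 0) := fun i hi => by
    rw [hts i hi]; exact h.isConj_zero hi
  have heq : fixHom (s 0) (t 0) = fixHom (s 0) (t 1) → ∀ i < m - 1, s i = s 0 := fun hf => by
    have := eq_of_braid_of_two_cycles (by omega) (ht.braid 0 (by omega)) (hconj 0 (by omega))
      (by omega) hf
    refine h.const_of_eq_succ (i := 2) (by omega) ?_
    rw [← hts 0 (by omega), ← hts 1 (by omega), this]
  by_cases hf : fixHom (s 0) (t 0) = fixHom (s 0) (t 1)
  · exact Or.inl (heq hf)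
  have hf3 : 3 ≤ Fintype.card (Function.fixedPoints (s 0)) := by
    by_contra hlt
    refine hf (eq_of_braid_of_commute ?_ (perm_small (by omega) _ _).1)
    simpa using congrArg (fixHom (s 0)) (ht.braid 0 (by omega))
  by_cases hs2 : (s 0).support.card = 2 ∧ Fintype.card X = m
  · refine Or.inr ⟨hs2.2, pow_eq_one_of_cycleType fun x hx => ?_⟩
    have := hcyc' x hx
    have := htwo x hx
    rw [show x = 2 by omega]
  have hm : m = 6 := by omega
  subst hm
  obtain ⟨hac, ha2, hb2⟩ := perm_three (by omega)
    (by simpa using congrArg (fixHom (s 0)) (ht.braid 0 (by omega)))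
    (by simpa using congrArg (fixHom (s 0)) (ht.braid 1 (by omega)))
    (by simpa using congrArg (fixHom (s 0)) (ht.comm 0 2 (by omega) (by omega)).eq) hf
  by_cases hs2' : (s 0).support.card = 2
  · left
    have hk : ((t 2 * (t 0)⁻¹ : centralizer {s 0}) : Equiv.Perm X) = 1 := by
      apply perm_eq_one_of_support_card_le_two
      · refine le_trans (Finset.card_le_card (t := (s 0).support) fun x hx => ?_) hs2'.le
        rw [mem_support] at hx ⊢
        refine fun h => hx (fixHom_apply ?_ h)
        rw [MonoidHom.mem_ker, _root_.map_mul, _root_.map_inv, ← hac, mul_inv_cancel]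
      · have e := map_isConj_eq sign ((hconj 2 (by omega)).trans (hconj 0 (by omega)).symm)
        rw [Subgroup.coe_mul, Subgroup.coe_inv, _root_.map_mul, _root_.map_inv, e, mul_inv_cancel]
    refine h.const_of_eq_add_two' (i := 1) (by omega) ?_
    rw [Subgroup.coe_mul, Subgroup.coe_inv, mul_inv_eq_one] at hk
    rw [← hts 0 (by omega), ← hts 2 (by omega), hk]
  · exfalso
    have h3 : s 0 ^ 3 = 1 := pow_eq_one_of_cycleType fun x hx => by
      have h1 := hcyc' x hx
      have h2 := htwo x hx
      obtain ⟨r, hr⟩ := Multiset.exists_cons_of_mem hx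
      have hsum := sum_cycleType (s 0)
      rw [hr, Multiset.sum_cons] at hsum
      have hr2 : x = 2 → False := fun hx2 => by
        by_cases hr0 : r = 0
        · rw [hr0, Multiset.sum_zero] at hsum; omega
        · obtain ⟨y, hy⟩ := Multiset.exists_mem_of_ne_zero hr0
          have := htwo y (hr ▸ Multiset.mem_cons_of_mem hy)
          have := Multiset.single_le_sum (fun _ _ => Nat.zero_le _) y hy
          omega
      have hx2 : x ≠ 2 := hr2
      have hX3 : (s 0).support.card ≤ 3 := by omega
      rw [show x = 3 by omega]
    have hone : ∀ i, i + 2 < 6 - 1 → fixHom (s 0) (t i) ^ 2 = 1 → fixHom (s 0) (t i) = 1 :=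
      fun i hi h2 => by
        have h3' : fixHom (s 0) (t i) ^ 3 = 1 := by
          rw [← _root_.map_pow, show t i ^ 3 = 1 from
            Subtype.ext (pow_eq_one_of_isConj (hconj i hi) h3), _root_.map_one]
        rw [pow_succ, h2, one_mul] at h3'
        exact h3'
    exact hf ((hone 0 (by omega) ha2).trans (hone 1 (by omega) hb2).symm)

theorem braid_perm (m : ℕ) : 5 ≤ m → ∀ {X : Type} [Fintype X] [DecidableEq X]
    {s : ℕ → Equiv.Perm X}, IsBraid (m - 1) s → Fintype.card X ≤ m →
    (∀ i < m - 1, s i = s 0) ∨ (Fintype.card X = m ∧ s 0 ^ 2 = 1) := by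
  induction m using Nat.strong_induction_on with
  | _ m ih =>
  intro h5 X _ _ s h hX
  by_cases h6 : m ≤ 6
  · exact braid_perm_base h5 h6 h hX
  by_cases h0 : s 0 = 1
  · exact Or.inl (const_of_zero_eq_one h h0)
  have hsupp : 2 ≤ (s 0).support.card := two_le_card_support_of_ne_one h0
  have hfix := card_fixed_add (s 0)
  have hcyc := two_mul_card_cycleFactorsFinset_le (s 0)
  by_cases hs2 : (s 0).support.card = 2 ∧ Fintype.card X = m
  · refine Or.inr ⟨hs2.2, pow_eq_one_of_cycleType fun x hx => ?_⟩
    have h1 := add_two_mul_card_le hx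
    have h2 := two_le_of_mem_cycleType hx
    rw [show x = 2 by omega]
  obtain ⟨t, ht, hts⟩ := h.exists_drop_two
  have ht' : IsBraid (m - 2 - 1) t := ht.mono (by omega)
  left
  have hA : ∀ i < m - 2 - 1, toPermHom (s 0) (t i) = toPermHom (s 0) (t 0) := by
    rcases ih (m - 2) (by omega) (by omega) (ht'.map (toPermHom (s 0)))
      (by rw [Fintype.card_coe]; omega) with h1 | ⟨h1, -⟩
    · exact h1
    · rw [Fintype.card_coe] at h1; omega
  have hB : ∀ i < m - 2 - 1, fixHom (s 0) (t i) = fixHom (s 0) (t 0) := by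
    rcases ih (m - 2) (by omega) (by omega) (ht'.map (fixHom (s 0))) (by omega) with h1 | ⟨h1, -⟩
    · exact h1
    · omega
  have hk : ∀ i < m - 2 - 1, t i * (t 0)⁻¹ ∈ (toPermHom (s 0)).ker ∧
      t i * (t 0)⁻¹ ∈ (fixHom (s 0)).ker := fun i hi => by
    simp only [MonoidHom.mem_ker, _root_.map_mul, _root_.map_inv, hA i hi, hB i hi, mul_inv_cancel,
      and_self]
  have hc := commute_of_mem_ker (hk 2 (by omega)).1 (hk 2 (by omega)).2 (hk 3 (by omega)).1
  have hc' := ht'.const_of_commute_mul_inv (i := 0) (j := 2) le_rfl (by omega) hc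
  refine h.const_of_eq_succ (i := 2) (by omega) ?_
  rw [← hts 0 (by omega), ← hts 1 (by omega), hc' 1 (by omega)]

end BraidPerm

end ArtinBAut

namespace ArtinBAut

open FreeGroup (of)

variable {n : ℕ}

theorem ev_tuple_sb {p j : ℕ} (hp : p + 1 < n) :
    ev n (tuple (sb n) (sb n p ^ 2) p j) = tuple (sigma n) (sigma n p ^ 2) p j := by
  have hd : desc (fun i => ev n (sb n i)) j p = desc (sigma n) j p :=
    desc_congr fun i hi => ev_sb (by omega)
  rw [tuple, tuple, _root_.map_mul, _root_.map_mul, _root_.map_inv, map_desc, _root_.map_pow,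
    ev_sb hp, hd]

theorem normal_abelian_eq_bot (h5 : 5 ≤ n) {N : Subgroup (Equiv.Perm (Fin n))} [N.Normal]
    (hN : ∀ x ∈ N, ∀ y ∈ N, x * y = y * x) : N = ⊥ := by
  by_contra hne
  have hle := Equiv.Perm.alternatingGroup_le_of_normal (by simpa using h5)
    (Subgroup.nontrivial_iff_ne_bot N |>.mpr hne)
  have hc := alternatingGroup.center_eq_bot (α := Fin n) (by simp; omega)
  have htop : Subgroup.center (alternatingGroup (Fin n)) = ⊤ := by
    rw [eq_top_iff]
    intro x _
    rw [Subgroup.mem_center_iff]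
    exact fun y => Subtype.ext (hN _ (hle y.2) _ (hle x.2))
  have : Nontrivial (alternatingGroup (Fin n)) :=
    alternatingGroup.nontrivial_of_three_le_card (by simp; omega)
  rw [htop] at hc
  exact top_ne_bot hc

theorem map_inn_eq_one (hn : 2 ≤ n) (h5 : 5 ≤ n) {f : AbarB n →* Equiv.Perm (Fin n)}
    (hf : Function.Surjective f) (hsq : ∀ i, i + 1 < n → f (sb n i) ^ 2 = 1) :
    (inn n).range ≤ f.ker := by
  have ha : ∀ p j, p + 1 < n → f (tuple (sb n) (sb n p ^ 2) p j) = 1 := fun p j hp => by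
    rw [tuple, _root_.map_mul, _root_.map_mul, _root_.map_inv, _root_.map_pow, hsq p hp]
    simp
  have hc : ∀ p j, p + 1 < n → j ≤ p → Commute (f (inn n (X n j))) (f (inn n (X n (p + 1)))) := by
    intro p j hp hj
    have h1 := inn_equivariant hn (tuple (sb n) (sb n p ^ 2) p j) (X n (p + 1))
    rw [ev_tuple_sb hp, (pushesTo_tuple hp hj).1] at h1
    have h2 := congrArg f h1
    simp only [_root_.map_mul, _root_.map_inv, ha p j hp] at h2
    set a := f (inn n (X n j))
    set b := f (inn n (X n (p + 1)))
    have h3 : a * b * b = b * (a * b) := by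
      calc a * b * b = a * b * (1 * b * 1⁻¹) := by group
        _ = _ := by rw [h2]; group
    rw [← mul_assoc b] at h3
    exact mul_right_cancel h3
  have hc' : ∀ i j, i < j → j < n → Commute (f (inn n (X n i))) (f (inn n (X n j))) := by
    intro i j hij hj
    obtain ⟨p, rfl⟩ : ∃ p, j = p + 1 := ⟨j - 1, by omega⟩
    exact hc p i hj (by omega)
  have hcc : ∀ i j : Fin n, Commute (f (inn n (of i))) (f (inn n (of j))) := by
    intro i j
    rw [of_eq_X, of_eq_X]
    rcases lt_trichotomy i.1 j.1 with h | h | h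
    · exact hc' _ _ h j.2
    · rw [h]
    · exact (hc' _ _ h i.2).symm
  have hz : ∀ x y, Commute (f (inn n x)) (f (inn n y)) := by
    have h1 : ∀ (i : Fin n) y, Commute (f (inn n (of i))) (f (inn n y)) := fun i y => by
      induction y using FreeGroup.induction_on with
      | C1 => simp
      | of j => exact hcc i j
      | inv_of j h => rw [_root_.map_inv, _root_.map_inv]; exact h.inv_right
      | mul x y hx hy => rw [_root_.map_mul, _root_.map_mul]; exact hx.mul_right hy
    intro x y
    induction x using FreeGroup.induction_on with
    | C1 => simp
    | of j => exact h1 j y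
    | inv_of j h => rw [_root_.map_inv, _root_.map_inv]; exact h.inv_left
    | mul x y hx hy => rw [_root_.map_mul, _root_.map_mul]; exact hx.mul_left hy
  have hN : ((inn n).range.map f).Normal := by
    refine ⟨?_⟩
    rintro _ ⟨_, ⟨y, rfl⟩, rfl⟩ g
    obtain ⟨g, rfl⟩ := hf g
    exact ⟨inn n (ev n g y), ⟨_, rfl⟩, by
      rw [← inn_equivariant hn, _root_.map_mul, _root_.map_mul, _root_.map_inv]⟩
  have hbot := normal_abelian_eq_bot h5 (N := (inn n).range.map f) (by
    rintro _ ⟨_, ⟨x, rfl⟩, rfl⟩ _ ⟨_, ⟨y, rfl⟩, rfl⟩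
    exact hz x y)
  rwa [Subgroup.map_eq_bot_iff] at hbot

theorem pure_le_ker (hn : 2 ≤ n) (h5 : 5 ≤ n) {f : AbarB n →* Equiv.Perm (Fin n)}
    (hf : Function.Surjective f) : pure hn ≤ f.ker := by
  have hbr := (isBraid_sb hn).map f
  rcases braid_perm n h5 hbr (by simp) with hconst | ⟨-, h0⟩
  · exfalso
    have hcomm : ∀ i < n, ∀ j < n, Commute (f (sb n i)) (f (sb n j)) := by
      have hlast : ∀ i < n - 1, Commute (f (sb n i)) (f (sb n (n - 1))) := fun i hi => by
        rw [hconst i hi]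
        exact ((isBraidB_sb hn).comm 0 (by omega)).map f
      intro i hi j hj
      by_cases h1 : i < n - 1
      · by_cases h2 : j < n - 1
        · rw [hconst i h1, hconst j h2]
        · rw [show j = n - 1 by omega]; exact hlast i h1
      · rw [show i = n - 1 by omega]
        by_cases h2 : j < n - 1
        · exact (hlast j h2).symm
        · rw [show j = n - 1 by omega]
    have hz : ∀ x y, Commute (f x) (f y) := by
      have h1 : ∀ i < n, ∀ y, Commute (f (sb n i)) (f y) := fun i hi y => by
        have := sb_induction (p := (Subgroup.centralizer {f (sb n i)}).comap f) fun j hj => by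
          rw [Subgroup.mem_comap, Subgroup.mem_centralizer_singleton_iff]
          exact (hcomm j hj i hi).eq
        have hy : y ∈ (Subgroup.centralizer {f (sb n i)}).comap f := this ▸ Subgroup.mem_top y
        rw [Subgroup.mem_comap, Subgroup.mem_centralizer_singleton_iff] at hy
        exact hy.symm
      intro x y
      have := sb_induction (p := (Subgroup.centralizer {f y}).comap f) fun j hj => by
        rw [Subgroup.mem_comap, Subgroup.mem_centralizer_singleton_iff]
        exact (h1 j hj y).eq
      have hx : x ∈ (Subgroup.centralizer {f y}).comap f := this ▸ Subgroup.mem_top x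
      rw [Subgroup.mem_comap, Subgroup.mem_centralizer_singleton_iff] at hx
      exact hx
    have htop := normal_abelian_eq_bot h5 (N := ⊤) fun x _ y _ => by
      obtain ⟨x, rfl⟩ := hf x
      obtain ⟨y, rfl⟩ := hf y
      exact hz x y
    have : Nontrivial (Fin n) := Fin.nontrivial_iff_two_le.mpr hn
    exact top_ne_bot htop
  · have hsq : ∀ i, i + 1 < n → f (sb n i) ^ 2 = 1 := fun i hi =>
      pow_eq_one_of_isConj (hbr.isConj_zero (j := i) (by omega)) h0
    exact pure_le hn (fun i hi => by rw [MonoidHom.mem_ker, _root_.map_pow, hsq i hi])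
      (map_inn_eq_one hn h5 hf hsq)

theorem map_mem_pure (hn : 2 ≤ n) (h5 : 5 ≤ n) (φ : MulAut (AbarB n)) {g : AbarB n}
    (hg : g ∈ pure hn) : φ g ∈ pure hn :=
  pure_le_ker hn h5 (f := (perm hn).comp φ.toMonoidHom)
    ((perm_surjective hn).comp φ.surjective) hg

end ArtinBAut

namespace ArtinBAut

open FreeGroup (of)

section BandTwist

variable {G : Type*} [Group G]

/-- The band twist `s p ⋯ s 0 * s 0 ⋯ s p`. -/
def band (s : ℕ → G) : ℕ → G
  | 0 => s 0 ^ 2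
  | p + 1 => s (p + 1) * band s p * s (p + 1)

theorem tuple_succ_conj {N : ℕ} {s : ℕ → G} (h : IsBraid N s) {p j : ℕ} (hp : p + 1 < N)
    (hj : j ≤ p) :
    tuple s (s (p + 1) ^ 2) (p + 1) j = s (p + 1) * tuple s (s p ^ 2) p j * (s (p + 1))⁻¹ := by
  have hc : Commute (s (p + 1)) (desc s j p) :=
    commute_desc fun i _ hi => (h.comm i (p + 1) (by omega) hp).symm
  have hb := h.braid p hp
  have key : (s p)⁻¹ * s (p + 1) ^ 2 * s p = s (p + 1) * s p ^ 2 * (s (p + 1))⁻¹ := by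
    have e1 : s (p + 1) * s p * (s (p + 1))⁻¹ = (s p)⁻¹ * s (p + 1) * s p := by
      rw [mul_inv_eq_iff_eq_mul, mul_assoc, mul_assoc, eq_inv_mul_iff_mul_eq, ← mul_assoc, hb,
        ← mul_assoc]
    calc (s p)⁻¹ * s (p + 1) ^ 2 * s p = ((s p)⁻¹ * s (p + 1) * s p) ^ 2 := by
          rw [pow_two, pow_two]; group
      _ = _ := by rw [← e1, pow_two, pow_two]; group
  rw [tuple, desc_succ s hj, tuple]
  calc (s p * desc s j p)⁻¹ * s (p + 1) ^ 2 * (s p * desc s j p)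
      = (desc s j p)⁻¹ * ((s p)⁻¹ * s (p + 1) ^ 2 * s p) * desc s j p := by group
    _ = (desc s j p)⁻¹ * s (p + 1) * s p ^ 2 * ((s (p + 1))⁻¹ * desc s j p) := by rw [key]; group
    _ = _ := by rw [hc.inv_left.eq, ← hc.inv_right.eq]; group

theorem iota_W {n N : ℕ} {s : ℕ → G} (h : IsBraid N s) {p : ℕ} (hp : p < N) (hn : p < n) :
    iota n s (s p ^ 2) p (W n (p + 1)) = band s p := by
  induction p with
  | zero => simp [W, iota_X _ _ _ hn, tuple_self, band]
  | succ p ih =>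
    have key : ∀ k ≤ p + 1, iota n s (s (p + 1) ^ 2) (p + 1) (W n k) =
        s (p + 1) * iota n s (s p ^ 2) p (W n k) * (s (p + 1))⁻¹ := by
      intro k hk
      induction k with
      | zero => simp [W]
      | succ k ihk =>
        rw [W_succ, _root_.map_mul, _root_.map_mul, ihk (by omega), iota_X _ _ _ hn,
          iota_X _ _ _ (show p < n by omega), if_pos (by omega), if_pos (by omega),
          tuple_succ_conj h hp (by omega)]
        group
    rw [W_succ, _root_.map_mul, key _ le_rfl, ih (by omega) (by omega), iota_X _ _ _ hn,
      if_pos le_rfl, tuple_self, band, pow_two]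
    group

theorem band_mem_braidSub (s : ℕ → G) {p m : ℕ} (h : p + 1 < m) : band s p ∈ braidSub s m := by
  induction p with
  | zero => exact pow_mem (mem_braidSub s h) 2
  | succ p ih =>
    exact mul_mem (mul_mem (mem_braidSub s h) (ih (by omega))) (mem_braidSub s h)

theorem map_band {H : Type*} [Group H] (f : G →* H) (s : ℕ → G) (p : ℕ) :
    f (band s p) = band (fun i => f (s i)) p := by
  induction p with
  | zero => simp [band]
  | succ p ih => simp [band, ih]

theorem band_congr {s t : ℕ → G} {p : ℕ} (h : ∀ i ≤ p, s i = t i) : band s p = band t p := by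
  induction p with
  | zero => rw [band, band, h 0 le_rfl]
  | succ p ih => rw [band, band, h _ le_rfl, ih fun i hi => h i (by omega)]

end BandTwist

variable {n : ℕ}

theorem band_sigma_X {p : ℕ} (hp : p + 1 < n) :
    (∀ i ≤ p, band (sigma n) p (X n i) = (X n (p + 1))⁻¹ * X n i * X n (p + 1)) ∧
      band (sigma n) p (X n (p + 1)) = (W n (p + 2))⁻¹ * X n (p + 1) * W n (p + 2) := by
  induction p with
  | zero =>
    have h0 := sigma_X_self hp
    have h1 := sigma_X_succ hp
    constructor
    · intro i hi
      rw [show i = 0 by omega, band, pow_two, MulAut.mul_apply, h0, h1]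
    · simp only [band, pow_two, MulAut.mul_apply, h1, h0, _root_.map_mul, _root_.map_inv, W]
      group
  | succ p ih =>
    obtain ⟨h1, h2⟩ := ih (by omega)
    have h0 := sigma_X_self hp
    have h0' := sigma_X_succ hp
    constructor
    · intro i hi
      rw [band, MulAut.mul_apply, MulAut.mul_apply]
      by_cases hip : i = p + 1
      · rw [hip, h0, braidSub_X (m := p + 2) (by omega) le_rfl (band_mem_braidSub _ (by omega)),
          h0']
      · rw [sigma_X_ne hp hip (by omega), h1 i (by omega)]
        simp only [_root_.map_mul, _root_.map_inv, h0,
          sigma_X_ne hp hip (show i ≠ p + 1 + 1 by omega)]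
    · have h3 : band (sigma n) p (X n (p + 1 + 1)) = X n (p + 1 + 1) :=
        braidSub_X (m := p + 2) (by omega) le_rfl (band_mem_braidSub _ (by omega))
      have h4 : sigma n (p + 1) (W n (p + 1)) = W n (p + 1) := sigma_W_of_le hp le_rfl
      rw [band, MulAut.mul_apply, MulAut.mul_apply, h0']
      have e2 : W n (p + 2) = W n (p + 1) * X n (p + 1) := rfl
      have e3 : W n (p + 1 + 2) = W n (p + 1) * X n (p + 1) * X n (p + 1 + 1) := rfl
      simp only [_root_.map_mul, _root_.map_inv, h2, h3, e2, e3, h4, h0, h0']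
      generalize X n (p + 1 + 1) = a, X n (p + 1) = b, W n (p + 1) = w
      group

theorem ev_band {p : ℕ} (hp : p + 1 < n) : ev n (band (sb n) p) = band (sigma n) p := by
  rw [map_band]
  exact band_congr fun i hi => ev_sb (by omega)

end ArtinBAut

namespace ArtinBAut

open FreeGroup (of)

variable {n : ℕ}

/-- The homomorphism between free groups sending letters to letters of the same index. -/
def res (n m : ℕ) : FreeGroup (Fin n) →* FreeGroup (Fin m) := liftX n (X m)

theorem res_X {m i : ℕ} (hi : i < n) : res n m (X n i) = X m i := liftX_X _ hi

theorem res_X_of_lt {m i : ℕ} (hi : i < m) (_ : m ≤ n) : res n m (X n i) = X m i :=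
  res_X (by omega)

theorem res_X_of_le {m i : ℕ} (hi : m ≤ i) : res n m (X n i) = 1 := by
  by_cases h : i < n
  · rw [res_X h, X_of_le hi]
  · rw [X_of_le (by omega), _root_.map_one]

theorem res_res {m : ℕ} (_ : m ≤ n) (x : FreeGroup (Fin m)) : res n m (res m n x) = x := by
  have : (res n m).comp (res m n) = MonoidHom.id _ := hom_ext fun i hi => by
    rw [MonoidHom.comp_apply, res_X hi, res_X_of_lt hi ‹_›]; rfl
  exact DFunLike.congr_fun this x

theorem res_res' {m : ℕ} (_ : m ≤ n) (x : FreeGroup (Fin n)) : res m n (res n m x) = q n m x := by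
  have : (res m n).comp (res n m) = q n m := hom_ext fun i hi => by
    rw [MonoidHom.comp_apply, res_X hi, q_X]
    split_ifs with h
    · exact res_X h
    · rw [X_of_le (by omega), _root_.map_one]
  exact DFunLike.congr_fun this x

theorem res_self (x : FreeGroup (Fin n)) : res n n x = x :=
  DFunLike.congr_fun (hom_ext (f := res n n) (g := MonoidHom.id _) fun _ hi => res_X hi) x

theorem res_q {m : ℕ} (hm : m ≤ n) (x : FreeGroup (Fin n)) : res n m (q n m x) = res n m x := by
  rw [← res_res' hm, res_res hm]

theorem expo_res {m i : ℕ} (hi : i < m) (_ : m ≤ n) (x : FreeGroup (Fin n)) :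
    expo m i (res n m x) = expo n i x := by
  have : (expo m i).comp (res n m) = expo n i := hom_ext fun j hj => by
    rw [MonoidHom.comp_apply, res_X hj, expo_X hj]
    by_cases h : j < m
    · rw [expo_X h]
    · rw [X_of_le (by omega), _root_.map_one, if_neg (by omega)]
  exact DFunLike.congr_fun this x

theorem zpow_apply_of_fix {α : Type*} [Group α] {f : MulAut α} {x : α} (h : f x = x) (k : ℤ) :
    (f ^ k) x = x := by
  have h1 : f ∈ MulAction.stabilizer (MulAut α) x := h
  exact zpow_mem h1 k

theorem exists_of_mem_topSub {p : ℕ} (hp : p + 1 < n) {u : AbarB n} (hu : u ∈ topSub (sb n) p) :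
    ∃ v, u = iota n (sb n) (sb n p ^ 2) p v ∧ ev n u = iota n (sigma n) (sigma n p ^ 2) p v := by
  obtain ⟨v, rfl⟩ := topSub_le_range (n := n) (sb n) (p := p) (by omega) hu
  refine ⟨v, rfl, ?_⟩
  rw [map_iota (ev n) (t := sigma n) (fun i hi => ev_sb (by omega)) (by omega), _root_.map_pow,
    ev_sb hp]

theorem exists_mod (hn : 2 ≤ n) {m : ℕ} (h1 : 1 ≤ m) (hm : m ≤ n) {g : AbarB n}
    (hg : g ∈ pure hn) : ∃ y, ∃ b ∈ braidSub (sb n) m, b ∈ pure hn ∧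
      ∀ x, q n m (ev n g x) = q n m (y * ev n b x * y⁻¹) := by
  obtain ⟨d, hd⟩ : ∃ d, n = m + d := ⟨n - m, by omega⟩
  induction d generalizing m with
  | zero =>
    obtain ⟨y, b, hb, hp, rfl⟩ := exists_inn_mul_pure hn hg
    refine ⟨y, b, by rwa [show m = n by omega], hp, fun x => ?_⟩
    rw [_root_.map_mul, ev_inn hn]; rfl
  | succ d ih =>
    obtain ⟨y, b, hb, hp, h⟩ := ih (m := m + 1) (by omega) (by omega) (by omega)
    obtain ⟨p, rfl⟩ : ∃ p, m = p + 1 := ⟨m - 1, by omega⟩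
    obtain ⟨u, hu, b', hb', hp', rfl⟩ := exists_combing_pure hn (by omega) hb hp
    refine ⟨y, b', hb', hp', fun x => ?_⟩
    obtain ⟨v, -, hv⟩ := exists_of_mem_topSub (by omega) hu
    have hP := (pushesTo_iota (n := n) (p := p) (by omega) v).2
    rw [← q_q (show p + 1 ≤ p + 1 + 1 by omega), h, q_q (by omega)]
    simp only [_root_.map_mul, _root_.map_inv, MulAut.mul_apply, hv, hP]

/-- The element `g` acts as conjugation by `c` modulo the letters of index at least `m`. -/
def IsInnerMod (m : ℕ) (g : AbarB n) (c : FreeGroup (Fin m)) : Prop :=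
  ∀ x, res n m (ev n g x) = c * res n m x * c⁻¹

theorem IsInnerMod.succ (hn : 2 ≤ n) {m : ℕ} (hm : 1 ≤ m) (hmn : m < n) {g : AbarB n}
    (hg : g ∈ pure hn) {c : FreeGroup (Fin m)} (hc : IsInnerMod m g c) {u : FreeGroup (Fin n)}
    (hu : ev n g (X n m) = u⁻¹ * X n m * u) (huc : res n m u * c = 1) :
    ∃ c', IsInnerMod (m + 1) g c' := by
  obtain ⟨y, b1, hb1, hp1, h⟩ := exists_mod hn (m := m + 1) (by omega) (by omega) hg
  obtain ⟨p, rfl⟩ : ∃ p, m = p + 1 := ⟨m - 1, by omega⟩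
  obtain ⟨T, hT, b, hb, hp, rfl⟩ := exists_combing_pure hn (by omega) hb1 hp1
  obtain ⟨v, -, hv⟩ := exists_of_mem_topSub (by omega) hT
  obtain ⟨⟨v', hv1, hv2⟩, hP⟩ := pushesTo_iota (n := n) (p := p) (by omega) v
  rw [← hv] at hv1 hP
  have hbs := ev_mem_braidSub (by omega) hb
  have hqc : ∀ x, q n (p + 1) (ev n g x) =
      res (p + 1) n c * q n (p + 1) x * (res (p + 1) n c)⁻¹ := fun x => by
    rw [← res_res' (by omega), hc x, ← res_res' (by omega)]
    simp only [_root_.map_mul, _root_.map_inv]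
  set C := res (p + 1) n c with hC
  set d := q n (p + 1) y⁻¹ * C with hd
  have hbd : ∀ x, ev n b (q n (p + 1) x) = d * q n (p + 1) x * d⁻¹ := fun x => by
    have h1 := hqc x
    rw [← q_q (show p + 1 ≤ p + 1 + 1 by omega), h, q_q (by omega)] at h1
    simp only [_root_.map_mul, _root_.map_inv, MulAut.mul_apply, hP] at h1
    rw [braidSub_q le_rfl (by omega) hbs] at h1
    rw [hd, _root_.map_inv]
    calc ev n b (q n (p + 1) x) = (q n (p + 1) y)⁻¹ * (q n (p + 1) y * ev n b (q n (p + 1) x) *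
          (q n (p + 1) y)⁻¹) * q n (p + 1) y := by group
      _ = _ := by rw [h1]; group
  obtain ⟨j, hj⟩ : d ∈ Subgroup.zpowers (W n (p + 1)) := by
    refine mem_zpowers_W (by omega) (by omega) ?_
    have h1 := hbd (W n (p + 1))
    rw [q_W le_rfl, braidSub_W (by omega) le_rfl hbs] at h1
    exact (mul_inv_eq_iff_eq_mul.mp h1.symm)
  have hqv : q n (p + 1) v = W n (p + 1) ^ (-j) := by
    have h1 := h (X n (p + 1))
    simp only [_root_.map_mul, _root_.map_inv, MulAut.mul_apply, hu,
      braidSub_X (show p + 1 ≤ n by omega) le_rfl hbs, hv1,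
      q_X_of_lt (show p + 1 < p + 1 + 1 by omega)] at h1
    set Q := q n (p + 1 + 1) with hQ
    have h2 : Commute (Q (v' * y⁻¹ * u⁻¹)) (X n (p + 1)) := by
      simp only [_root_.map_mul, _root_.map_inv]
      show _ = _
      calc Q v' * (Q y)⁻¹ * (Q u)⁻¹ * X n (p + 1)
          = Q v' * (Q y)⁻¹ * ((Q u)⁻¹ * X n (p + 1) * Q u) * (Q u)⁻¹ := by group
        _ = _ := by rw [h1]; group
    obtain ⟨k, hk⟩ := mem_zpowers_X (by omega) h2
    have h3 := congrArg (q n (p + 1)) hk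
    simp only [hQ, q_q (show p + 1 ≤ p + 1 + 1 by omega), _root_.map_zpow, q_X_of_le le_rfl,
      one_zpow, _root_.map_mul, _root_.map_inv] at h3
    have h4 : q n (p + 1) u * C = 1 := by
      rw [← res_res' (by omega), hC, ← _root_.map_mul, huc, _root_.map_one]
    rw [← hv2, zpow_neg]
    simp only at hj
    rw [hj, hd, _root_.map_inv, mul_inv_rev, inv_inv, ← eq_inv_of_mul_eq_one_left h4]
    exact mul_inv_eq_iff_eq_mul.mp (mul_inv_eq_one.mp h3.symm)
  have hTE : ev n T = band (sigma n) p ^ (-j) := by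
    rw [hv, ← iota_q (by omega), hqv, _root_.map_zpow, iota_W (isBraid_sigma n) (by omega)
      (by omega)]
  obtain ⟨hE1, hE2⟩ := band_sigma_X (n := n) (p := p) (by omega)
  have hEW : band (sigma n) p (W n (p + 2)) = W n (p + 2) :=
    braidSub_W (by omega) le_rfl (band_mem_braidSub (m := p + 2) _ (by omega))
  have e : W n (p + 2) = W n (p + 1) * X n (p + 1) := rfl
  have hkey : ∀ i < p + 2, ev n T (ev n b (X n i)) = W n (p + 2) ^ j * X n i *
      (W n (p + 2) ^ j)⁻¹ := by
    intro i hi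
    set E := band (sigma n) p with hE
    set c2 := MulAut.conj (W n (p + 2)) with hc2
    have hcE : Commute c2 E := by
      have := mul_conj_eq E (W n (p + 2))
      rw [hEW, mul_inv_eq_iff_eq_mul] at this
      exact this.symm
    set β := c2 * E with hβ
    have hcβ : Commute c2 β := (Commute.refl c2).mul_right hcE
    have hEβ : E ^ (-j) = c2 ^ j * β ^ (-j) := by
      rw [hβ, hcE.mul_zpow, ← mul_assoc, ← zpow_add, add_neg_cancel, zpow_zero, one_mul]
    have hc2j : ∀ z, (c2 ^ j) z = W n (p + 2) ^ j * z * (W n (p + 2) ^ j)⁻¹ := fun z => by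
      rw [hc2, ← _root_.map_zpow]; rfl
    rw [hTE, hEβ, MulAut.mul_apply, hc2j]
    congr 2
    rcases Nat.lt_or_ge i (p + 1) with hi' | hi'
    · have hbi : ev n b (X n i) = (MulAut.conj (W n (p + 1)) ^ j) (X n i) := by
        have := hbd (X n i)
        rw [q_X_of_lt hi', ← hj] at this
        rw [this, ← _root_.map_zpow]; rfl
      have hβW : β (W n (p + 1)) = W n (p + 1) := by
        have : W n (p + 1) = W n (p + 2) * (X n (p + 1))⁻¹ := by rw [e, mul_inv_cancel_right]
        rw [hβ, MulAut.mul_apply, this, _root_.map_mul, _root_.map_inv, hEW, hE2, hc2,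
          MulAut.conj_apply]
        group
      have hcc : Commute (MulAut.conj (W n (p + 1))) β := by
        have := mul_conj_eq β (W n (p + 1))
        rw [hβW, mul_inv_eq_iff_eq_mul] at this
        exact this.symm
      have hγ : ((MulAut.conj (W n (p + 1)))⁻¹ * β) (X n i) = X n i := by
        rw [MulAut.mul_apply, hβ, MulAut.mul_apply, hE1 i (by omega), hc2, MulAut.conj_apply,
          ← _root_.map_inv, MulAut.conj_apply, e]
        group
      have := zpow_apply_of_fix hγ (-j)
      rw [hcc.inv_left.mul_zpow, inv_zpow, zpow_neg, inv_inv] at this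
      rw [hbi, ← MulAut.mul_apply, ← (hcc.zpow_zpow j (-j)).eq]
      exact this
    · obtain rfl : i = p + 1 := by omega
      rw [braidSub_X (show p + 1 ≤ n by omega) le_rfl hbs]
      refine zpow_apply_of_fix ?_ _
      rw [hβ, MulAut.mul_apply, hE2, hc2, MulAut.conj_apply]
      group
  refine ⟨res n (p + 2) (y * W n (p + 2) ^ j), fun x => ?_⟩
  have := hom_ext (f := (res n (p + 2)).comp (ev n g).toMonoidHom)
    (g := (MulAut.conj (res n (p + 2) (y * W n (p + 2) ^ j))).toMonoidHom.comp (res n (p + 2)))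
    fun i hi => by
      show res n (p + 2) (ev n g (X n i)) = res n (p + 2) (y * W n (p + 2) ^ j) *
        res n (p + 2) (X n i) * (res n (p + 2) (y * W n (p + 2) ^ j))⁻¹
      rcases Nat.lt_or_ge i (p + 2) with hi' | hi'
      · rw [← res_q (by omega), h, res_q (by omega), _root_.map_mul (ev n), MulAut.mul_apply,
          hkey i hi']
        simp only [_root_.map_mul, _root_.map_inv, mul_inv_rev, mul_assoc]
      · have := (res n (p + 2)).map_isConj ((mem_pure hn).mp hg i hi)
        rw [res_X_of_le hi', isConj_one_right] at this
        rw [this, res_X_of_le hi']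
        group
  exact DFunLike.congr_fun this x

end ArtinBAut

namespace ArtinBAut

variable {n : ℕ}

theorem exists_hom_of_rel {G H : Type*} [Group G] [Group H] (R : G → H → Prop)
    (hex : ∀ g, ∃ y, R g y) (huniq : ∀ g y y', R g y → R g y' → y = y')
    (hmul : ∀ g h y y', R g y → R h y' → R (g * h) (y * y')) :
    ∃ f : G →* H, ∀ g, R g (f g) := by
  choose f hf using hex
  exact ⟨MonoidHom.mk' f fun g h => huniq _ _ _ (hf _) (hmul _ _ _ _ (hf g) (hf h)), hf⟩

theorem exists_of_isConj {G : Type*} [Group G] {x y : G} (h : IsConj x y) :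
    ∃ u, y = u⁻¹ * x * u := by
  obtain ⟨c, rfl⟩ := isConj_iff.mp h
  exact ⟨c⁻¹, by rw [inv_inv]⟩

theorem exists_conj_of_mem_pure (hn : 2 ≤ n) {g : AbarB n} (hg : g ∈ pure hn) {i : ℕ}
    (hi : i < n) : ∃ u, ev n g (X n i) = u⁻¹ * X n i * u :=
  exists_of_isConj ((mem_pure hn).mp hg i hi)

theorem eq_zpow_mul_of_conj_eq {i : ℕ} (hi : i < n) {u u' : FreeGroup (Fin n)}
    (h : u⁻¹ * X n i * u = u'⁻¹ * X n i * u') : ∃ k : ℤ, u' = X n i ^ k * u := by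
  obtain ⟨k, hk⟩ := mem_zpowers_X (g := u' * u⁻¹) hi (by
    show _ = _
    calc u' * u⁻¹ * X n i = u' * (u⁻¹ * X n i * u) * u⁻¹ := by group
      _ = _ := by rw [h]; group)
  simp only at hk
  exact ⟨k, by rw [hk]; group⟩

theorem isInnerMod_inn (hn : 2 ≤ n) (m : ℕ) (y : FreeGroup (Fin n)) :
    IsInnerMod m (inn n y) (res n m y) := fun x => by
  rw [ev_inn hn, MulAut.conj_apply]
  simp only [_root_.map_mul, _root_.map_inv]

theorem IsInnerMod.mul {m : ℕ} {g h : AbarB n} {c d : FreeGroup (Fin m)} (hg : IsInnerMod m g c)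
    (hh : IsInnerMod m h d) : IsInnerMod m (g * h) (c * d) := fun x => by
  rw [_root_.map_mul, MulAut.mul_apply, hg, hh]
  group

theorem IsInnerMod.inv {m : ℕ} {g : AbarB n} {c : FreeGroup (Fin m)} (hg : IsInnerMod m g c) :
    IsInnerMod m g⁻¹ c⁻¹ := fun x => by
  have h1 := hg (ev n g⁻¹ x)
  rw [← MulAut.mul_apply, ← _root_.map_mul, mul_inv_cancel, _root_.map_one] at h1
  rw [show res n m x = c * res n m (ev n g⁻¹ x) * c⁻¹ from h1]
  group

theorem IsInnerMod.unique {m : ℕ} (hm : 2 ≤ m) (hmn : m ≤ n) {g : AbarB n}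
    {c d : FreeGroup (Fin m)} (hc : IsInnerMod m g c) (hd : IsInnerMod m g d) : c = d := by
  have key : ∀ i < m, Commute (d⁻¹ * c) (X m i) := fun i hi => by
    have h1 := (hc (X n i)).symm.trans (hd (X n i))
    rw [res_X_of_lt hi hmn] at h1
    show _ = _
    calc d⁻¹ * c * X m i = d⁻¹ * (c * X m i * c⁻¹) * c := by group
      _ = _ := by rw [h1]; group
  have := eq_one_of_commute_X (by omega) (by omega) (show 0 ≠ 1 by omega) (key 0 (by omega))
    (key 1 (by omega))
  exact (inv_mul_eq_one.mp this).symm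

/-- The relation stating that, modulo the letters above `m`, the element `g` acts on the first
`m` letters as conjugation by some `c` and pushes the letter `X m` along `y * c⁻¹`. -/
def UBar (m : ℕ) (g : AbarB n) (y : FreeGroup (Fin m)) : Prop :=
  ∃ c u, IsInnerMod m g c ∧ ev n g (X n m) = u⁻¹ * X n m * u ∧ y = res n m u * c

theorem UBar.unique {m : ℕ} (hm : 2 ≤ m) (hmn : m < n) {g : AbarB n}
    {y y' : FreeGroup (Fin m)} (h : UBar m g y) (h' : UBar m g y') : y = y' := by
  obtain ⟨c, u, hc, hu, rfl⟩ := h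
  obtain ⟨c', u', hc', hu', rfl⟩ := h'
  obtain ⟨k, rfl⟩ := eq_zpow_mul_of_conj_eq hmn (hu.symm.trans hu')
  rw [hc.unique hm hmn.le hc', _root_.map_mul, _root_.map_zpow, res_X_of_le le_rfl, one_zpow,
    one_mul]

theorem UBar.mul {m : ℕ} {g h : AbarB n}
    {y y' : FreeGroup (Fin m)} (hg : UBar m g y) (hh : UBar m h y') : UBar m (g * h) (y * y') := by
  obtain ⟨c, u, hc, hu, rfl⟩ := hg
  obtain ⟨c', u', hc', hu', rfl⟩ := hh
  refine ⟨c * c', u * ev n g u', hc.mul hc', ?_, ?_⟩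
  · rw [_root_.map_mul, MulAut.mul_apply, hu', _root_.map_mul, _root_.map_mul, hu, _root_.map_inv]
    group
  · rw [_root_.map_mul, hc]
    group

theorem UBar.inv {m : ℕ} {g : AbarB n} {y : FreeGroup (Fin m)} (hg : UBar m g y) :
    UBar m g⁻¹ y⁻¹ := by
  obtain ⟨c, u, hc, hu, rfl⟩ := hg
  refine ⟨c⁻¹, (ev n g⁻¹ u)⁻¹, hc.inv, ?_, ?_⟩
  · have h1 : X n m = ev n g⁻¹ (ev n g (X n m)) := by
      rw [← MulAut.mul_apply, ← _root_.map_mul, inv_mul_cancel, _root_.map_one]; rfl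
    rw [hu, _root_.map_mul, _root_.map_mul, _root_.map_inv] at h1
    calc ev n g⁻¹ (X n m) = ev n g⁻¹ u * ((ev n g⁻¹ u)⁻¹ * ev n g⁻¹ (X n m) * ev n g⁻¹ u) *
          (ev n g⁻¹ u)⁻¹ := by group
      _ = _ := by rw [← h1, inv_inv]
  · rw [_root_.map_inv, hc.inv]
    group

theorem exists_uBar (hn : 2 ≤ n) {m : ℕ} (hmn : m < n) {g : AbarB n} (hg : g ∈ pure hn)
    (hc : ∃ c, IsInnerMod m g c) : ∃ y, UBar m g y := by
  obtain ⟨c, hc⟩ := hc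
  obtain ⟨u, hu⟩ := exists_conj_of_mem_pure hn hg hmn
  exact ⟨_, c, u, hc, hu, rfl⟩

theorem uBar_inn (hn : 2 ≤ n) (m : ℕ) (y : FreeGroup (Fin n)) :
    UBar m (inn n y) (1 : FreeGroup (Fin m)) := by
  refine ⟨res n m y, y⁻¹, isInnerMod_inn hn m y, ?_, ?_⟩
  · rw [ev_inn hn, MulAut.conj_apply, inv_inv]
  · rw [_root_.map_inv, inv_mul_cancel]

theorem uBar_tuple {p j : ℕ} (hp : p + 1 < n) (hj : j ≤ p) :
    UBar (p + 1) (tuple (sb n) (sb n p ^ 2) p j) (X (p + 1) j) := by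
  obtain ⟨h1, h2⟩ := pushesTo_tuple hp hj
  refine ⟨1, X n j * X n (p + 1), fun x => ?_, ?_, ?_⟩
  · rw [ev_tuple_sb hp, ← res_q (by omega), h2, res_q (by omega)]
    group
  · rw [ev_tuple_sb hp, h1]
  · rw [_root_.map_mul, res_X_of_le le_rfl, res_X (by omega)]
    group

theorem tuple_mem_pure (hn : 2 ≤ n) {p : ℕ} (hp : p + 1 < n) (j : ℕ) :
    tuple (sb n) (sb n p ^ 2) p j ∈ pure hn := by
  have := (inferInstance : (pure hn).Normal).conj_mem _ (sb_sq_mem_pure hn hp)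
    (desc (sb n) j p)⁻¹
  rwa [inv_inv] at this

theorem uBar_surjective (hn : 2 ≤ n) {m : ℕ} (hm : 1 ≤ m) (hmn : m < n)
    (y : FreeGroup (Fin m)) : ∃ t ∈ pure hn, UBar m t y := by
  obtain ⟨p, rfl⟩ : ∃ p, m = p + 1 := ⟨m - 1, by omega⟩
  induction y using FreeGroup.induction_on with
  | C1 => exact ⟨1, one_mem _, by simpa using uBar_inn hn (p + 1) 1⟩
  | of i =>
    refine ⟨_, tuple_mem_pure hn (by omega) i, ?_⟩
    rw [of_eq_X]
    exact uBar_tuple hmn (by omega)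
  | inv_of i h =>
    obtain ⟨t, ht, hu⟩ := h
    exact ⟨t⁻¹, inv_mem ht, hu.inv⟩
  | mul x y hx hy =>
    obtain ⟨t, ht, hu⟩ := hx
    obtain ⟨t', ht', hu'⟩ := hy
    exact ⟨t * t', mul_mem ht ht', hu.mul hu'⟩

theorem exists_isInnerMod_two (hn : 2 < n) {g : AbarB n} (hg : g ∈ pure hn.le) :
    ∃ c, IsInnerMod 2 g c := by
  obtain ⟨u, hu⟩ := exists_conj_of_mem_pure hn.le hg (show 1 < n by omega)
  refine IsInnerMod.succ hn.le le_rfl (by omega) hg (c := (res n 1 u)⁻¹) (fun x => ?_) hu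
    (mul_inv_cancel _)
  have hcomm : ∀ a b : FreeGroup (Fin 1), a * b = b * a := by
    have : ∀ a : FreeGroup (Fin 1), a ∈ Subgroup.zpowers (X 1 0) := fun a => by
      induction a using FreeGroup.induction_on with
      | C1 => exact one_mem _
      | of i => rw [of_eq_X, Subsingleton.elim i 0]
                exact Subgroup.mem_zpowers _
      | inv_of i h => exact inv_mem h
      | mul x y hx hy => exact mul_mem hx hy
    intro a b
    obtain ⟨k, rfl⟩ := this a
    obtain ⟨l, rfl⟩ := this b
    exact (Commute.refl _).zpow_zpow k l
  rw [hcomm (res n 1 u)⁻¹, mul_inv_cancel_right]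
  have := hom_ext (f := (res n 1).comp (ev n g).toMonoidHom) (g := res n 1) fun i hi => by
    obtain ⟨v, hv⟩ := exists_conj_of_mem_pure hn.le hg hi
    show res n 1 (ev n g (X n i)) = _
    rw [hv, _root_.map_mul, _root_.map_mul, hcomm (res n 1 v⁻¹), mul_assoc, ← _root_.map_mul,
      inv_mul_cancel, _root_.map_one, mul_one]
  exact DFunLike.congr_fun this x

open Classical in
/-- The exponent of the letter `j` in the word along which `g` pushes the letter `i`. -/
noncomputable def ell (n i j : ℕ) (g : AbarB n) : Multiplicative ℤ :=
  if h : ∃ u, ev n g (X n i) = u⁻¹ * X n i * u then expo n j h.choose else 1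

theorem ell_eq {i j : ℕ} (hi : i < n) (hij : i ≠ j) {g : AbarB n} {u : FreeGroup (Fin n)}
    (hu : ev n g (X n i) = u⁻¹ * X n i * u) : ell n i j g = expo n j u := by
  have h : ∃ u, ev n g (X n i) = u⁻¹ * X n i * u := ⟨u, hu⟩
  rw [ell, dif_pos h]
  obtain ⟨k, hk⟩ := eq_zpow_mul_of_conj_eq hi (hu.symm.trans h.choose_spec)
  rw [hk, _root_.map_mul, _root_.map_zpow, expo_X_ne hij, one_zpow, one_mul]

theorem expo_isInnerMod (hn : 2 ≤ n) {m i j : ℕ} (hm : m ≤ n) (hi : i < m) (hj : j < m)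
    (hij : j ≠ i) {g : AbarB n} (hg : g ∈ pure hn) {c : FreeGroup (Fin m)}
    (hc : IsInnerMod m g c) : expo m i c = (ell n j i g)⁻¹ := by
  obtain ⟨u, hu⟩ := exists_conj_of_mem_pure hn hg (show j < n by omega)
  rw [ell_eq (by omega) hij hu, ← expo_res hi hm]
  have h1 := hc (X n j)
  rw [hu, _root_.map_mul, _root_.map_mul, _root_.map_inv, res_X_of_lt hj hm] at h1
  have h2 : (c⁻¹)⁻¹ * X m j * c⁻¹ = (res n m u)⁻¹ * X m j * res n m u := by rw [h1, inv_inv]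
  obtain ⟨k, hk⟩ := eq_zpow_mul_of_conj_eq hj h2
  rw [hk, _root_.map_mul, _root_.map_zpow, expo_X_ne hij, one_zpow, one_mul, _root_.map_inv,
    inv_inv]

theorem UBar.expo_eq (hn : 2 ≤ n) {m i j : ℕ} (hm : m < n) (hi : i < m) (hj : j < m)
    (hij : j ≠ i) {g : AbarB n} (hg : g ∈ pure hn) {y : FreeGroup (Fin m)} (hy : UBar m g y) :
    expo m i y = ell n m i g * (ell n j i g)⁻¹ := by
  obtain ⟨c, u, hc, hu, rfl⟩ := hy
  rw [_root_.map_mul, expo_isInnerMod hn hm.le hi hj hij hg hc, expo_res hi hm.le,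
    ell_eq hm (by omega) hu]

theorem expo_ev_perm (hn : 2 ≤ n) (γ : AbarB n) (j : Fin n) (x : FreeGroup (Fin n)) :
    expo n (perm hn γ j) (ev n γ x) = expo n j x := by
  have := hom_ext (f := (expo n (perm hn γ j)).comp (ev n γ).toMonoidHom) (g := expo n j)
    fun i hi => by
      show expo n (perm hn γ j) (ev n γ (X n i)) = _
      rw [← map_isConj_eq _ (perm_spec hn γ ⟨i, hi⟩), expo_X (perm hn γ ⟨i, hi⟩).2, expo_X hi]
      have : ((perm hn γ ⟨i, hi⟩ : ℕ) = perm hn γ j) ↔ i = j := by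
        rw [← Fin.ext_iff, (perm hn γ).injective.eq_iff, Fin.ext_iff]
      simp only [this]
  exact DFunLike.congr_fun this x

theorem expo_ev (hn : 2 ≤ n) {g : AbarB n} (hg : g ∈ pure hn) {j : ℕ} (hj : j < n)
    (x : FreeGroup (Fin n)) : expo n j (ev n g x) = expo n j x := by
  have := expo_ev_perm hn g ⟨j, hj⟩ x
  rwa [show perm hn g = 1 from hg] at this

theorem ell_conj (hn : 2 ≤ n) (γ : AbarB n) {g : AbarB n} (hg : g ∈ pure hn) {i j : Fin n}
    (hij : i ≠ j) : ell n (perm hn γ i) (perm hn γ j) (γ * g * γ⁻¹) = ell n i j g := by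
  have hg' := (inferInstance : (pure hn).Normal).conj_mem _ hg γ
  obtain ⟨u, hu⟩ := exists_conj_of_mem_pure hn hg i.2
  obtain ⟨v, hv⟩ := exists_of_isConj (perm_spec hn γ i)
  have h1 : X n (perm hn γ i) = v * ev n γ (X n i) * v⁻¹ := by rw [hv]; group
  have h2 : ev n (γ * g * γ⁻¹) (X n (perm hn γ i)) =
      (v * ev n γ u * (ev n (γ * g * γ⁻¹) v)⁻¹)⁻¹ * X n (perm hn γ i) *
        (v * ev n γ u * (ev n (γ * g * γ⁻¹) v)⁻¹) := by
    have hc : ev n (γ * g * γ⁻¹) (ev n γ (X n i)) = ev n γ (ev n g (X n i)) := by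
      rw [← MulAut.mul_apply, ← _root_.map_mul, inv_mul_cancel_right, _root_.map_mul,
        MulAut.mul_apply]
    conv_lhs => rw [h1]
    rw [_root_.map_mul (ev n (γ * g * γ⁻¹)), _root_.map_mul (ev n (γ * g * γ⁻¹)),
      _root_.map_inv (ev n (γ * g * γ⁻¹)), hc, hu, _root_.map_mul (ev n γ), _root_.map_mul (ev n γ),
      _root_.map_inv (ev n γ), hv]
    group
  rw [ell_eq (perm hn γ i).2 (fun h => hij ((perm hn γ).injective (Fin.ext h))) h2,
    ell_eq i.2 (fun h => hij (Fin.ext h)) hu, _root_.map_mul, _root_.map_mul, _root_.map_inv,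
    expo_ev hn hg' (perm hn γ j).2, expo_ev_perm, mul_comm (expo n _ v), mul_inv_cancel_right]

theorem exists_perm_three {α : Type*} [Finite α] {a b c a' b' c' : α} (h1 : a ≠ b)
    (h2 : a ≠ c) (h3 : b ≠ c) (h1' : a' ≠ b') (h2' : a' ≠ c') (h3' : b' ≠ c') :
    ∃ f : Equiv.Perm α, f a = a' ∧ f b = b' ∧ f c = c' := by
  have inj : ∀ {a b c : α}, a ≠ b → a ≠ c → b ≠ c → Function.Injective ![a, b, c] := by
    intro a b c h1 h2 h3 i j h
    fin_cases i <;> fin_cases j <;> simp_all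
  obtain ⟨f, hf⟩ := Equiv.Perm.exists_extending_pair _ _ (inj h1 h2 h3) (inj h1' h2' h3')
  exact ⟨f, hf 0, hf 1, hf 2⟩

theorem ell_eq_of_normal (hn : 2 < n) {N : Subgroup (AbarB n)} [hN : N.Normal]
    (hNp : N ≤ pure hn.le)
    (hell : ∀ g ∈ N, ell n 2 0 g = ell n 1 0 g) {g : AbarB n} (hg : g ∈ N) {i j k : ℕ}
    (hi : i < n) (hj : j < n) (hk : k < n) (hij : j ≠ i) (hik : k ≠ i) (hjk : j ≠ k) :
    ell n k i g = ell n j i g := by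
  obtain ⟨f, h0, h1, h2⟩ := exists_perm_three (α := Fin n) (a := ⟨0, by omega⟩)
    (b := ⟨1, by omega⟩) (c := ⟨2, by omega⟩) (a' := ⟨i, hi⟩) (b' := ⟨j, hj⟩) (c' := ⟨k, hk⟩)
    (by simp) (by simp) (by simp) (by simpa using hij.symm) (by simpa using hik.symm)
    (by simpa using hjk)
  obtain ⟨γ, rfl⟩ := perm_surjective hn.le f
  have hg' : γ⁻¹ * g * γ ∈ N := by simpa using hN.conj_mem g hg γ⁻¹
  have e1 := ell_conj hn.le γ (hNp hg') (i := ⟨2, by omega⟩) (j := ⟨0, by omega⟩) (by simp)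
  have e2 := ell_conj hn.le γ (hNp hg') (i := ⟨1, by omega⟩) (j := ⟨0, by omega⟩) (by simp)
  have e3 : γ * (γ⁻¹ * g * γ) * γ⁻¹ = g := by group
  rw [h0, h1, e3] at e2
  rw [h0, h2, e3] at e1
  rw [← show ell n k i g = _ from e1.trans (hell _ hg')] at e2
  exact e2.symm

theorem expo_ne_one {i : ℕ} (hi : i < n) : expo n i ≠ 1 := fun h => by
  have := DFunLike.congr_fun h (X n i)
  rw [expo_X_self hi] at this
  exact one_ne_zero (Multiplicative.ofAdd.injective this)

theorem le_range_inn (hn : 2 < n) {N : Subgroup (AbarB n)} [hN : N.Normal]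
    (hNp : N ≤ pure hn.le) (hfg : N.FG) (hell : ∀ g ∈ N, ell n 2 0 g = ell n 1 0 g) :
    N ≤ (inn n).range := by
  have main : ∀ m, 2 ≤ m → m ≤ n → ∀ g ∈ N, ∃ c, IsInnerMod m g c := by
    intro m hm
    induction m, hm using Nat.le_induction with
    | base => exact fun _ g hg => exists_isInnerMod_two hn (hNp hg)
    | succ m hm ih =>
      intro hmn
      have ih := ih (by omega)
      obtain ⟨f, hf⟩ := exists_hom_of_rel (G := N) (fun g y => UBar m g.1 y)
        (fun g => exists_uBar hn.le (by omega) (hNp g.2) (ih g.1 g.2))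
        (fun g y y' h h' => h.unique (by omega) (by omega) h')
        (fun g h y y' hg hh => hg.mul hh)
      have : Group.FG N := (Group.fg_iff_subgroup_fg N).mpr hfg
      have hr : f.range = ⊥ := by
        refine FreeGroup.eq_bot_of_fg_le_ker ⟨?_⟩ ((Group.fg_iff_subgroup_fg _).mp
          (Group.fg_range f)) (expo m 0) (expo_ne_one (by omega)) ?_
        · rintro _ ⟨g, rfl⟩ y
          obtain ⟨t, -, ht⟩ := uBar_surjective hn.le (m := m) (by omega) (by omega) y
          exact ⟨⟨t * g.1 * t⁻¹, hN.conj_mem _ g.2 t⟩, (hf _).unique (by omega) (by omega)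
            ((ht.mul (hf g)).mul ht.inv)⟩
        · rintro _ ⟨g, rfl⟩
          rw [MonoidHom.mem_ker, (hf g).expo_eq hn.le (j := 1) (by omega) (by omega) (by omega)
            (by omega) (hNp g.2), ell_eq_of_normal hn hNp hell g.2 (j := 1) (by omega) (by omega)
            (by omega) (by omega) (by omega) (by omega), mul_inv_cancel]
      intro g hg
      obtain ⟨c, u, hc, hu, h⟩ := hf ⟨g, hg⟩
      refine hc.succ hn.le (by omega) (by omega) (hNp hg) hu ?_
      rw [← h, ← Subgroup.mem_bot, ← hr]
      exact ⟨_, rfl⟩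
  intro g hg
  obtain ⟨c, hc⟩ := main n hn.le le_rfl g hg
  refine ⟨c, ev_injective hn.le (MulEquiv.ext fun x => ?_)⟩
  have := hc x
  rw [res_self, res_self] at this
  rw [this, ev_inn hn.le]; rfl

end ArtinBAut

namespace ArtinBAut

variable {n : ℕ}

theorem desc_mem {G : Type*} [Group G] {s : ℕ → G} {K : Subgroup G} {j k : ℕ}
    (h : ∀ i, j ≤ i → i < k → s i ∈ K) : desc s j k ∈ K := by
  rcases Nat.lt_or_ge k j with hk | hk
  · rw [desc_of_le s hk.le]; exact one_mem _
  · induction k, hk using Nat.le_induction with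
    | base => rw [desc_of_le s le_rfl]; exact one_mem _
    | succ k hk ih =>
      rw [desc_succ s hk]
      exact mul_mem (h k hk (by omega)) (ih fun i h1 h2 => h i h1 (by omega))

/-- The element acting trivially on all the letters but the last one, which it pushes around all
the other ones. -/
noncomputable def xi (n : ℕ) : AbarB n := inn n (X n (n - 1)) * band (sb n) (n - 2)

theorem ev_xi (hn : 2 ≤ n) : (∀ i < n - 1, ev n (xi n) (X n i) = X n i) ∧
    ev n (xi n) (X n (n - 1)) = X n (n - 1) * ((W n n)⁻¹ * X n (n - 1) * W n n) *
      (X n (n - 1))⁻¹ := by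
  obtain ⟨p, rfl⟩ : ∃ p, n = p + 2 := ⟨n - 2, by omega⟩
  obtain ⟨h1, h2⟩ := band_sigma_X (n := p + 2) (p := p) (by omega)
  have hE := ev_band (n := p + 2) (p := p) (by omega)
  rw [xi, _root_.map_mul, ev_inn hn]
  simp only [Nat.add_sub_cancel, show p + 2 - 1 = p + 1 by omega, MulAut.mul_apply, hE]
  refine ⟨fun i hi => ?_, ?_⟩
  · rw [h1 i (by omega), MulAut.conj_apply]
    group
  · rw [h2, MulAut.conj_apply]

theorem band_mem_pure (hn : 2 ≤ n) {p : ℕ} (hp : p + 1 < n) : band (sb n) p ∈ pure hn := by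
  rw [← iota_W (n := n) (isBraid_sb hn) (by omega) (by omega)]
  induction W n (p + 1) using FreeGroup.induction_on with
  | C1 => rw [_root_.map_one]; exact one_mem _
  | of i =>
    rw [of_eq_X, iota_X _ _ _ (by omega)]
    split_ifs
    · exact tuple_mem_pure hn hp i
    · exact one_mem _
  | inv_of i h => rw [_root_.map_inv]; exact inv_mem h
  | mul x y hx hy => rw [_root_.map_mul]; exact mul_mem hx hy

theorem xi_mem_pure (hn : 2 ≤ n) : xi n ∈ pure hn :=
  mul_mem (inn_mem_pure hn _) (band_mem_pure hn (by omega))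

theorem ev_xi_q (hn : 2 ≤ n) (x : FreeGroup (Fin n)) :
    ev n (xi n) (q n (n - 1) x) = q n (n - 1) x := by
  have := hom_ext (f := (ev n (xi n)).toMonoidHom.comp (q n (n - 1))) (g := q n (n - 1))
    fun i hi => by
      show ev n (xi n) (q n (n - 1) (X n i)) = _
      rw [q_X]
      split_ifs with h
      · exact (ev_xi hn).1 i h
      · exact _root_.map_one _
  exact DFunLike.congr_fun this x

theorem commute_xi_inn (hn : 2 ≤ n) {i : ℕ} (hi : i < n - 1) : Commute (xi n) (inn n (X n i)) := by
  have := inn_equivariant hn (xi n) (X n i)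
  rw [(ev_xi hn).1 i hi] at this
  exact mul_inv_eq_iff_eq_mul.mp this

theorem commute_xi_braidSub (hn : 2 ≤ n) {b : AbarB n} (hb : b ∈ braidSub (sb n) (n - 1)) :
    Commute (xi n) b := by
  have hb' := ev_mem_braidSub (by omega) hb
  apply ev_injective hn
  rw [_root_.map_mul, _root_.map_mul]
  apply aut_ext
  intro i hi
  rw [MulAut.mul_apply, MulAut.mul_apply]
  rcases Nat.lt_or_ge i (n - 1) with h | h
  · rw [(ev_xi hn).1 i h]
    have : X n i = q n (n - 1) (X n i) := (q_X_of_lt h).symm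
    rw [this, ← braidSub_q le_rfl (by omega) hb', ev_xi_q hn]
  · obtain rfl : i = n - 1 := by omega
    have h1 := braidSub_X (by omega) le_rfl hb'
    rw [h1, (ev_xi hn).2]
    simp only [_root_.map_mul, _root_.map_inv, h1, braidSub_W (k := n) (by omega) (by omega) hb']

/-- The embedding of the free group of inner automorphisms into the pure group. -/
noncomputable def innP (hn : 2 ≤ n) : FreeGroup (Fin n) →* pure hn :=
  (inn n).codRestrict _ (inn_mem_pure hn)

/-- The restriction of conjugation to the pure group. -/
noncomputable def cn (hn : 2 ≤ n) (γ : AbarB n) : MulAut (pure hn) := MulAut.conjNormal γ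

theorem coe_cn (hn : 2 ≤ n) (γ : AbarB n) (g : pure hn) : (cn hn γ g : AbarB n) = γ * g * γ⁻¹ :=
  MulAut.conjNormal_apply _ _

theorem coe_innP (hn : 2 ≤ n) (y : FreeGroup (Fin n)) : (innP hn y : AbarB n) = inn n y := rfl

theorem cn_mul (hn : 2 ≤ n) (γ δ : AbarB n) (g : pure hn) :
    cn hn (γ * δ) g = cn hn γ (cn hn δ g) := by
  rw [cn, _root_.map_mul]; rfl

theorem cn_innP (hn : 2 ≤ n) (γ : AbarB n) (y : FreeGroup (Fin n)) :
    cn hn γ (innP hn y) = innP hn (ev n γ y) := by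
  apply Subtype.ext
  rw [coe_cn, coe_innP, coe_innP, inn_equivariant hn]

/-- The elements of the pure group whose image commutes with `z`. -/
noncomputable def cent {hn : 2 ≤ n} {F : Type*} [Group F] (h : pure hn →* F) (z : F) :
    Subgroup (AbarB n) :=
  ((Subgroup.centralizer {z}).comap h).map (pure hn).subtype

theorem mem_cent {hn : 2 ≤ n} {F : Type*} [Group F] {h : pure hn →* F} {z : F} {g : AbarB n}
    (hg : g ∈ pure hn) : g ∈ cent h z ↔ Commute (h ⟨g, hg⟩) z := by
  rw [cent, Subgroup.mem_map]
  constructor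
  · rintro ⟨g', hg', rfl⟩
    exact (Subgroup.mem_centralizer_singleton_iff.mp hg')
  · intro hc
    exact ⟨⟨g, hg⟩, Subgroup.mem_centralizer_singleton_iff.mpr hc, rfl⟩

section Trichotomy

variable {α : Type*} {hn : 2 ≤ n} {h : pure hn →* FreeGroup α}

theorem commute_of_pure_le_cent {z : FreeGroup α} (hz : z ≠ 1) (hle : pure hn ≤ cent h z)
    (x y : pure hn) : Commute (h x) (h y) :=
  FreeGroup.commute_trans hz ((mem_cent x.2).mp (hle x.2)).symm ((mem_cent y.2).mp (hle y.2)).symm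

theorem pure_le_cent {z : FreeGroup α}
    (hU : ∀ i < n, inn n (X n i) ∈ cent h z)
    (hb : ∀ b ∈ braidSub (sb n) n, b ∈ pure hn → b ∈ cent h z) : pure hn ≤ cent h z := by
  have hU' : ∀ y, inn n y ∈ cent h z := fun y => by
    induction y using FreeGroup.induction_on with
    | C1 => rw [_root_.map_one]; exact one_mem _
    | of i => rw [of_eq_X]; exact hU i i.2
    | inv_of i h => rw [_root_.map_inv]; exact inv_mem h
    | mul x y hx hy => rw [_root_.map_mul]; exact mul_mem hx hy
  intro g hg
  obtain ⟨y, b, hb1, hb2, rfl⟩ := exists_inn_mul_pure hn hg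
  exact mul_mem (hU' y) (hb b hb1 hb2)

theorem mem_cent_of_commute {g k : AbarB n} (hg : g ∈ pure hn) (hk : k ∈ pure hn)
    (hc : Commute g k) {z : FreeGroup α} (hz : h ⟨k, hk⟩ = z) : g ∈ cent h z := by
  rw [mem_cent hg, ← hz]
  show _ = _
  rw [← _root_.map_mul, ← _root_.map_mul]
  congr 1
  exact Subtype.ext hc

theorem tuple_last_mem_cent (hx0 : h (innP hn (X n 0)) ≠ 1) (h3 : 3 ≤ n) {j : ℕ} (hj : 1 ≤ j) :
    tuple (sb n) (sb n (n - 2) ^ 2) (n - 2) j ∈ cent h (h ⟨xi n, xi_mem_pure hn⟩) := by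
  have hp := tuple_mem_pure hn (p := n - 2) (by omega) j
  have hfix : ev n (tuple (sb n) (sb n (n - 2) ^ 2) (n - 2) j) (X n 0) = X n 0 := by
    obtain ⟨p, rfl⟩ : ∃ p, n = p + 2 := ⟨n - 2, by omega⟩
    have hs : ∀ i, 1 ≤ i → i + 1 < p + 2 →
        sigma (p + 2) i ∈ MulAction.stabilizer (MulAut _) (X (p + 2) 0) :=
      fun i h1 h2 => sigma_X_ne (by omega) (by omega) (by omega)
    have hd : desc (sigma (p + 2)) j p ∈ MulAction.stabilizer (MulAut _) (X (p + 2) 0) :=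
      desc_mem fun i h1 h2 => hs i (by omega) (by omega)
    rw [ev_tuple_sb (by omega)]
    exact mul_mem (mul_mem (inv_mem hd) (pow_mem (hs p (by omega) (by omega)) 2)) hd
  have h1 := inn_equivariant hn (tuple (sb n) (sb n (n - 2) ^ 2) (n - 2) j) (X n 0)
  rw [hfix, mul_inv_eq_iff_eq_mul] at h1
  have h2 := (mem_cent hp).mp (mem_cent_of_commute (h := h) hp (inn_mem_pure hn (X n 0)) h1 rfl)
  have h3 := (mem_cent (xi_mem_pure hn)).mp (mem_cent_of_commute (h := h) (xi_mem_pure hn)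
    (inn_mem_pure hn (X n 0)) (commute_xi_inn hn (by omega)) rfl)
  rw [mem_cent hp]
  exact FreeGroup.commute_trans hx0 h2.symm h3.symm

theorem not_mem_cent (hna : ¬ ∀ x y, Commute (h x) (h y)) (hxi : h ⟨xi n, xi_mem_pure hn⟩ ≠ 1)
    (hx0 : h (innP hn (X n 0)) ≠ 1) (h3 : 3 ≤ n) :
    tuple (sb n) (sb n (n - 2) ^ 2) (n - 2) 0 ∉ cent h (h ⟨xi n, xi_mem_pure hn⟩) ∧
      inn n (X n (n - 1)) ∉ cent h (h ⟨xi n, xi_mem_pure hn⟩) := by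
  have hj := fun j => tuple_last_mem_cent (h := h) hx0 h3 (j := j)
  have hcent := fun {g} (hg : g ∈ pure hn) (hc : Commute g (xi n)) =>
    mem_cent_of_commute (h := h) hg (xi_mem_pure hn) hc rfl
  set Z := cent h (h ⟨xi n, xi_mem_pure hn⟩) with hZ
  have hband : ∃ r ∈ Z, band (sb n) (n - 2) =
      tuple (sb n) (sb n (n - 2) ^ 2) (n - 2) 0 * r := by
    rw [← iota_W (n := n) (isBraid_sb hn) (by omega) (by omega)]
    have : ∀ k, k ≤ n - 2 → ∃ r ∈ Z, iota n (sb n) (sb n (n - 2) ^ 2) (n - 2) (W n (k + 1)) =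
        tuple (sb n) (sb n (n - 2) ^ 2) (n - 2) 0 * r := by
      intro k
      induction k with
      | zero =>
        refine fun _ => ⟨1, one_mem _, ?_⟩
        rw [show W n (0 + 1) = W n 0 * X n 0 from rfl, show W n 0 = 1 from rfl, one_mul,
          iota_X _ _ _ (by omega), if_pos (by omega), mul_one]
      | succ k ih =>
        intro hk
        obtain ⟨r, hr, e⟩ := ih (by omega)
        refine ⟨_, mul_mem hr (hj (k + 1) (by omega)), ?_⟩
        rw [show W n (k + 1 + 1) = W n (k + 1) * X n (k + 1) from rfl, _root_.map_mul, e,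
          iota_X _ _ _ (by omega), if_pos hk, mul_assoc]
    exact this (n - 2) le_rfl
  obtain ⟨r, hr, hband⟩ := hband
  have hxiZ : inn n (X n (n - 1)) * (tuple (sb n) (sb n (n - 2) ^ 2) (n - 2) 0 * r) ∈ Z := by
    rw [← hband]
    exact hcent (xi_mem_pure hn) (Commute.refl _)
  have h0 : tuple (sb n) (sb n (n - 2) ^ 2) (n - 2) 0 ∉ Z := by
    intro h0
    have hl : inn n (X n (n - 1)) ∈ Z :=
      (Subgroup.mul_mem_cancel_right _ (mul_mem h0 hr)).mp hxiZ
    refine hna (commute_of_pure_le_cent hxi (pure_le_cent (fun i hi => ?_) fun b hb hp => ?_))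
    · rcases Nat.lt_or_ge i (n - 1) with hi' | hi'
      · exact hcent (inn_mem_pure hn _) (commute_xi_inn hn hi').symm
      · rwa [show i = n - 1 by omega]
    · obtain ⟨u, hu, b', hb', hp', rfl⟩ := exists_combing_pure hn (m := n - 2) (by omega)
        (by rwa [show n - 2 + 2 = n by omega]) hp
      refine mul_mem ?_ (hcent hp' (commute_xi_braidSub hn ?_).symm)
      · have : topSub (sb n) (n - 2) ≤ Z := by
          rw [topSub, Subgroup.closure_le]
          rintro _ ⟨j, hj', rfl⟩
          rcases Nat.eq_zero_or_pos j with rfl | hj1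
          · exact h0
          · exact hj j hj1
        exact this hu
      · rwa [show n - 1 = n - 2 + 1 by omega]
  refine ⟨h0, fun hl => h0 ?_⟩
  exact (Subgroup.mul_mem_cancel_right _ hr).mp ((Subgroup.mul_mem_cancel_left _ hl).mp hxiZ)

theorem not_commute_comp_cn (hna : ¬ ∀ x y, Commute (h x) (h y)) (γ : AbarB n) :
    ¬ ∀ x y, Commute (h.comp (cn hn γ).toMonoidHom x) (h.comp (cn hn γ).toMonoidHom y) := by
  intro hc
  refine hna fun x y => ?_
  have := hc ((cn hn γ).symm x) ((cn hn γ).symm y)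
  simpa using this

/-- The homomorphism `h` factors, up to conjugation, through the first two letters on the inner
automorphisms, with a non-abelian image. -/
def IsTwoStrand (h : pure hn →* FreeGroup α) : Prop :=
  ∃ γ, (∀ k, 2 ≤ k → k < n → h (cn hn γ (innP hn (X n k))) = 1) ∧
    ∃ x y, ¬ Commute (h (cn hn γ (innP hn x))) (h (cn hn γ (innP hn y)))

theorem IsTwoStrand.of_comp_cn {γ : AbarB n}
    (hh : IsTwoStrand (h.comp (cn hn γ).toMonoidHom)) : IsTwoStrand h := by
  obtain ⟨δ, h1, x, y, h2⟩ := hh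
  refine ⟨γ * δ, fun k hk hk' => ?_, x, y, ?_⟩
  · rw [cn_mul]; exact h1 k hk hk'
  · rw [cn_mul, cn_mul]; exact h2

theorem isTwoStrand_of_first (hna : ¬ ∀ x y, Commute (h x) (h y))
    (hxi : h ⟨xi n, xi_mem_pure hn⟩ ≠ 1) (hx0 : h (innP hn (X n 0)) ≠ 1) (h3 : 3 ≤ n) :
    IsTwoStrand h := by
  have hdead : ∀ k, 1 ≤ k → k < n - 1 → h (innP hn (X n k)) = 1 := by
    intro k hk hk'
    by_contra hal
    have hγ : desc (sb n) 0 k ∈ braidSub (sb n) (n - 1) := desc_mem_braidSub _ hk'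
    have hev : ev n (desc (sb n) 0 k) (X n 0) = X n k := by
      rw [map_desc, desc_congr fun i hi => ev_sb (by omega), desc_sigma_X (by omega) (by omega)]
    have hcx : cn hn (desc (sb n) 0 k) ⟨xi n, xi_mem_pure hn⟩ = ⟨xi n, xi_mem_pure hn⟩ := by
      apply Subtype.ext
      rw [coe_cn, mul_inv_eq_iff_eq_mul]
      exact (commute_xi_braidSub hn hγ).symm
    have hct : cn hn (desc (sb n) 0 k) ⟨_, tuple_mem_pure hn (p := n - 2) (by omega) 0⟩ =
        ⟨_, tuple_mem_pure hn (p := n - 2) (by omega) k⟩ := by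
      apply Subtype.ext
      rw [coe_cn]
      simp only [tuple]
      rw [← desc_mul (sb n) (show 0 ≤ k by omega) (show k ≤ n - 2 by omega)]
      group
    have h1 := (not_mem_cent (not_commute_comp_cn hna (desc (sb n) 0 k)) ?_ ?_ h3).1
    · apply h1
      have h2 := tuple_last_mem_cent hx0 h3 hk
      rw [mem_cent (tuple_mem_pure hn (by omega) k)] at h2
      rw [mem_cent (tuple_mem_pure hn (by omega) 0)]
      simpa [hcx, hct] using h2
    · simpa [hcx] using hxi
    · simpa [cn_innP, hev] using hal
  have hl := (not_mem_cent hna hxi hx0 h3).2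
  rw [mem_cent (inn_mem_pure hn _)] at hl
  have hnc : ¬ Commute (h (innP hn (X n 0))) (h (innP hn (X n (n - 1)))) := fun hc => hl <| by
    have := (mem_cent (xi_mem_pure hn)).mp (mem_cent_of_commute (h := h) (xi_mem_pure hn)
      (inn_mem_pure hn (X n 0)) (commute_xi_inn hn (by omega)) rfl)
    exact FreeGroup.commute_trans hx0 hc this.symm
  obtain ⟨f, f0, f1, -⟩ := exists_perm_three (α := Fin n) (a := ⟨0, by omega⟩)
    (b := ⟨n - 1, by omega⟩) (c := ⟨1, by omega⟩) (a' := ⟨0, by omega⟩) (b' := ⟨1, by omega⟩)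
    (c' := ⟨2, by omega⟩) (by simp; omega) (by simp) (by simp; omega) (by simp) (by simp) (by simp)
  obtain ⟨γ, hγ⟩ := perm_surjective hn f⁻¹
  refine ⟨γ, fun k hk hk' => ?_, ev n γ⁻¹ (X n 0), ev n γ⁻¹ (X n (n - 1)), ?_⟩
  · obtain ⟨v, hv⟩ := exists_of_isConj (perm_spec hn γ ⟨k, hk'⟩)
    have e : ∀ i, f (perm hn γ i) = i := fun i => by rw [hγ]; exact f.apply_symm_apply i
    have n0 : (perm hn γ ⟨k, hk'⟩ : ℕ) ≠ 0 := fun h0 => by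
      have := e ⟨k, hk'⟩
      rw [show perm hn γ ⟨k, hk'⟩ = ⟨0, by omega⟩ from Fin.ext h0, f0] at this
      simp at this; omega
    have n1 : (perm hn γ ⟨k, hk'⟩ : ℕ) ≠ n - 1 := fun h0 => by
      have := e ⟨k, hk'⟩
      rw [show perm hn γ ⟨k, hk'⟩ = ⟨n - 1, by omega⟩ from Fin.ext h0, f1] at this
      simp at this; omega
    rw [cn_innP, hv]
    simp only [_root_.map_mul, _root_.map_inv]
    rw [hdead _ (by omega) (by have := (perm hn γ ⟨k, hk'⟩).2; omega)]
    group
  · rw [cn_innP, cn_innP, ← MulAut.mul_apply, ← MulAut.mul_apply, ← _root_.map_mul,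
      mul_inv_cancel, _root_.map_one]
    exact hnc

theorem isTwoStrand (hna : ¬ ∀ x y, Commute (h x) (h y))
    (hxi : ∃ γ, h (cn hn γ ⟨xi n, xi_mem_pure hn⟩) ≠ 1) (hx : ∃ y, h (innP hn y) ≠ 1)
    (h3 : 3 ≤ n) : IsTwoStrand h := by
  obtain ⟨γ, hγ⟩ := hxi
  apply IsTwoStrand.of_comp_cn (γ := γ)
  have hna' := not_commute_comp_cn hna γ
  have hx' : ∃ y, h.comp (cn hn γ).toMonoidHom (innP hn y) ≠ 1 := by
    obtain ⟨y, hy⟩ := hx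
    refine ⟨ev n γ⁻¹ y, ?_⟩
    show h (cn hn γ _) ≠ 1
    rwa [cn_innP, ← MulAut.mul_apply, ← _root_.map_mul, mul_inv_cancel, _root_.map_one]
  have hγ' : h.comp (cn hn γ).toMonoidHom ⟨xi n, xi_mem_pure hn⟩ ≠ 1 := hγ
  generalize h.comp (cn hn γ).toMonoidHom = k at *
  by_cases hal : ∃ i < n - 1, k (innP hn (X n i)) ≠ 1
  · obtain ⟨i, hi, hal⟩ := hal
    have hev : ev n (desc (sb n) 0 i) (X n 0) = X n i := by
      rw [map_desc, desc_congr fun i hi => ev_sb (by omega), desc_sigma_X (by omega) (by omega)]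
    apply IsTwoStrand.of_comp_cn (γ := desc (sb n) 0 i)
    refine isTwoStrand_of_first (not_commute_comp_cn hna' _) ?_ ?_ h3
    · have hcx : cn hn (desc (sb n) 0 i) ⟨xi n, xi_mem_pure hn⟩ = ⟨xi n, xi_mem_pure hn⟩ := by
        apply Subtype.ext
        rw [coe_cn, mul_inv_eq_iff_eq_mul]
        exact (commute_xi_braidSub hn (desc_mem_braidSub _ hi)).symm
      simpa [hcx] using hγ'
    · simpa [cn_innP, hev] using hal
  · exfalso
    have hdead : ∀ i < n - 1, k (innP hn (X n i)) = 1 := fun i hi => by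
      by_contra hne
      exact hal ⟨i, hi, hne⟩
    have hW : ∀ m ≤ n - 1, k (innP hn (W n m)) = 1 := by
      intro m
      induction m with
      | zero => intro _; rw [show W n 0 = 1 from rfl, _root_.map_one, _root_.map_one]
      | succ m ih =>
        intro hm
        rw [show W n (m + 1) = W n m * X n m from rfl, _root_.map_mul, _root_.map_mul,
          ih (by omega), hdead m (by omega), one_mul]
    have hWn : k (innP hn (W n n)) = k (innP hn (X n (n - 1))) := by
      obtain ⟨p, rfl⟩ : ∃ p, n = p + 1 := ⟨n - 1, by omega⟩
      rw [show W (p + 1) (p + 1) = W (p + 1) p * X (p + 1) p from rfl, _root_.map_mul,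
        _root_.map_mul, hW p (by omega), one_mul]
      rfl
    have hz : k (innP hn (X n (n - 1))) ≠ 1 := by
      intro h1
      obtain ⟨y, hy⟩ := hx'
      have := hom_ext (f := k.comp (innP hn)) (g := 1) fun i hi => by
        show k (innP hn (X n i)) = 1
        rcases Nat.lt_or_ge i (n - 1) with hi' | hi'
        · exact hdead i hi'
        · rwa [show i = n - 1 by omega]
      exact hy (DFunLike.congr_fun this y)
    refine hna' (commute_of_pure_le_cent hz (pure_le_cent (fun i hi => ?_) fun b hb hp => ?_))
    · rw [mem_cent (inn_mem_pure hn _)]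
      rcases Nat.lt_or_ge i (n - 1) with hi' | hi'
      · rw [show k ⟨_, inn_mem_pure hn (X n i)⟩ = 1 from hdead i hi']
        exact Commute.one_left _
      · rw [show i = n - 1 by omega]
        exact Commute.refl _
    · refine mem_cent_of_commute hp (inn_mem_pure hn (W n n)) ?_ hWn
      have h1 := inn_equivariant hn b (W n n)
      rw [braidSub_W le_rfl le_rfl (ev_mem_braidSub le_rfl hb), mul_inv_eq_iff_eq_mul] at h1
      exact h1

end Trichotomy

end ArtinBAut

namespace ArtinBAut

variable {n : ℕ}

theorem range_inn_normal (hn : 2 ≤ n) : (inn n).range.Normal := ⟨by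
  rintro _ ⟨y, rfl⟩ g
  exact ⟨ev n g y, (inn_equivariant hn g y).symm⟩⟩

theorem map_range_inn_fg (φ : MulAut (AbarB n)) : ((inn n).range.map φ.toMonoidHom).FG := by
  rw [← MonoidHom.range_comp]
  exact (Group.fg_iff_subgroup_fg _).mp (Group.fg_range _)

theorem map_range_inn_normal (hn : 2 ≤ n) (φ : MulAut (AbarB n)) :
    ((inn n).range.map φ.toMonoidHom).Normal :=
  (range_inn_normal hn).map _ φ.surjective

theorem map_range_inn_le_pure (hn : 5 ≤ n) (φ : MulAut (AbarB n)) :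
    (inn n).range.map φ.toMonoidHom ≤ pure (show 2 ≤ n by omega) := by
  rintro _ ⟨_, ⟨y, rfl⟩, rfl⟩
  exact map_mem_pure _ hn φ (inn_mem_pure _ y)

theorem map_range_inn_le (hn : 5 ≤ n) (φ : MulAut (AbarB n))
    (h : ∀ y, UBar 2 (φ (inn n y)) (1 : FreeGroup (Fin 2))) :
    (inn n).range.map φ.toMonoidHom ≤ (inn n).range := by
  have := map_range_inn_normal (show 2 ≤ n by omega) φ
  refine le_range_inn (by omega) (map_range_inn_le_pure hn φ) (map_range_inn_fg _) ?_
  rintro _ ⟨_, ⟨y, rfl⟩, rfl⟩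
  have h1 := (h y).expo_eq (show 2 ≤ n by omega) (i := 0) (j := 1) (by omega) (by omega) (by omega)
    (by omega) (map_mem_pure _ hn φ (inn_mem_pure _ y))
  rw [_root_.map_one, eq_comm, mul_inv_eq_one] at h1
  exact h1

theorem eq_bot_of_isTwoStrand {α : Type*} (hn : 2 < n) {h : pure hn.le →* FreeGroup α}
    (hh : IsTwoStrand h) {N : Subgroup (AbarB n)} [hN : N.Normal] (hNp : N ≤ pure hn.le)
    (hfg : N.FG) (hker : ∀ g (hg : g ∈ N), h ⟨g, hNp hg⟩ = 1) : N = ⊥ := by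
  obtain ⟨γ, hk, x₀, y₀, hxy⟩ := hh
  obtain ⟨H, hH⟩ : ∃ H : FreeGroup (Fin n) →* FreeGroup α,
      ∀ y, H y = h (cn hn.le γ (innP hn.le y)) :=
    ⟨h.comp ((cn hn.le γ).toMonoidHom.comp (innP hn.le)), fun _ => rfl⟩
  have hHq : ∀ x, H (q n 2 x) = H x := fun x => by
    refine DFunLike.congr_fun (hom_ext (f := H.comp (q n 2)) (g := H) fun i hi => ?_) x
    rw [MonoidHom.comp_apply, q_X]
    split_ifs with h2
    · rfl
    · rw [_root_.map_one, hH, hk i (by omega) hi]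
  obtain ⟨χ, hχ⟩ : ∃ χ : FreeGroup (Fin 2) →* FreeGroup α, ∀ x, χ (res n 2 x) = H x :=
    ⟨H.comp (res 2 n), fun x => by rw [MonoidHom.comp_apply, res_res' hn.le, hHq]⟩
  have hHN : ∀ g ∈ N, ∀ x, H (ev n g x) = H x := fun g hg x => by
    have e : cn hn.le γ (innP hn.le (ev n g x)) = cn hn.le γ ⟨g, hNp hg⟩ *
        cn hn.le γ (innP hn.le x) * (cn hn.le γ ⟨g, hNp hg⟩)⁻¹ := by
      rw [← cn_innP, ← _root_.map_mul, ← _root_.map_inv, ← _root_.map_mul]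
      congr 1
    have e' : h (cn hn.le γ ⟨g, hNp hg⟩) = 1 := hker _ (hN.conj_mem g hg γ)
    rw [hH, hH, e, _root_.map_mul, _root_.map_mul, _root_.map_inv, e', one_mul, inv_one, mul_one]
  obtain ⟨f, hf⟩ := exists_hom_of_rel (G := N) (fun g c => IsInnerMod 2 g.1 c)
    (fun g => exists_isInnerMod_two hn (hNp g.2))
    (fun g y y' h h' => h.unique le_rfl hn.le h') (fun g h y y' hg hh => hg.mul hh)
  have hr : f.range = ⊥ := by
    have : Group.FG N := (Group.fg_iff_subgroup_fg N).mpr hfg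
    refine FreeGroup.eq_bot_of_fg_le_ker ⟨?_⟩ ((Group.fg_iff_subgroup_fg _).mp
      (Group.fg_range f)) χ ?_ ?_
    · rintro _ ⟨g, rfl⟩ d
      refine ⟨⟨inn n (res 2 n d) * g * (inn n (res 2 n d))⁻¹, hN.conj_mem _ g.2 _⟩, ?_⟩
      have hd := isInnerMod_inn hn.le 2 (res 2 n d)
      rw [res_res hn.le] at hd
      exact (hf _).unique le_rfl hn.le ((hd.mul (hf g)).mul hd.inv)
    · rintro rfl
      apply hxy
      rw [← hH, ← hH, ← hχ, MonoidHom.one_apply]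
      exact Commute.one_left _
    · rintro _ ⟨g, rfl⟩
      rw [MonoidHom.mem_ker]
      by_contra hne
      have key : ∀ x, Commute (χ (f g)) (H x) := fun x => by
        have := congrArg χ (hf g x)
        simp only [_root_.map_mul, _root_.map_inv, hχ, hHN _ g.2] at this
        exact (mul_inv_eq_iff_eq_mul.mp this.symm)
      apply hxy
      rw [← hH, ← hH]
      exact FreeGroup.commute_trans hne (key _) (key _)
  have hmod : ∀ g ∈ N, IsInnerMod 2 g 1 := fun g hg => by
    have h1 := hf ⟨g, hg⟩
    rwa [show f ⟨g, hg⟩ = 1 from Subgroup.mem_bot.mp (hr ▸ ⟨_, rfl⟩)] at h1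
  have hell : ∀ g ∈ N, ell n 1 0 g = 1 := fun g hg => by
    have h1 := expo_isInnerMod hn.le (i := 0) (j := 1) hn.le (by omega) (by omega) (by omega)
      (hNp hg) (hmod g hg)
    rw [_root_.map_one, eq_comm, inv_eq_one] at h1
    exact h1
  have hle : N ≤ (inn n).range := by
    refine le_range_inn hn hNp hfg fun g hg => ?_
    obtain ⟨σ, h0, h1, -⟩ := exists_perm_three (α := Fin n) (a := ⟨0, by omega⟩)
      (b := ⟨1, by omega⟩) (c := ⟨2, by omega⟩) (a' := ⟨0, by omega⟩) (b' := ⟨2, by omega⟩)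
      (c' := ⟨1, by omega⟩) (by simp) (by simp) (by simp) (by simp) (by simp) (by simp)
    obtain ⟨δ, rfl⟩ := perm_surjective hn.le σ
    have hg' : δ⁻¹ * g * δ ∈ N := by simpa using hN.conj_mem g hg δ⁻¹
    have e1 := ell_conj hn.le δ (hNp hg') (i := ⟨1, by omega⟩) (j := ⟨0, by omega⟩) (by simp)
    rw [h0, h1, show δ * (δ⁻¹ * g * δ) * δ⁻¹ = g by group] at e1
    rw [hell g hg]
    exact e1.trans (hell _ hg')
  have hN0 : N.comap (inn n) = ⊥ := by
    refine FreeGroup.eq_bot_of_fg_le_ker inferInstance ?_ (res n 2) ?_ ?_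
    · have hm : (N.comap (inn n)).map (inn n) = N := by
        rw [Subgroup.map_comap_eq, inf_eq_right.mpr hle]
      have := (Group.fg_iff_subgroup_fg _).mpr (hm ▸ hfg)
      exact (Group.fg_iff_subgroup_fg _).mp
        (Group.fg_of_surjective (f := ((N.comap (inn n)).equivMapOfInjective _
          (inn_injective hn.le)).symm.toMonoidHom) (MulEquiv.surjective _))
    · intro h1
      have := res_X_of_lt (n := n) (m := 2) (i := 0) (by omega) hn.le
      rw [h1, MonoidHom.one_apply] at this
      exact X_ne_one (by omega) this.symm
    · intro y hy
      have h1 := (isInnerMod_inn hn.le 2 y).unique le_rfl hn.le (hmod _ hy)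
      exact h1
  rw [eq_bot_iff]
  intro g hg
  obtain ⟨y, rfl⟩ := hle hg
  have : y ∈ N.comap (inn n) := hg
  rw [hN0, Subgroup.mem_bot] at this
  rw [this, _root_.map_one]
  exact one_mem _

theorem inn_X_eq_conj (hn : 2 ≤ n) {k : ℕ} (hk : k < n) :
    ∃ g, inn n (X n k) = g * inn n (X n (n - 1)) * g⁻¹ := by
  refine ⟨(desc (sb n) k (n - 1))⁻¹, ?_⟩
  have h := inn_equivariant hn (desc (sb n) k (n - 1)) (X n k)
  rw [map_desc, desc_congr fun i hi => ev_sb (by omega), desc_sigma_X (by omega) (by omega)] at h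
  rw [← h]
  group

theorem map_range_inn_le_or (hn : 5 ≤ n) (φ μ : MulAut (AbarB n))
    (hμ : ∃ γ, μ (inn n (X n (n - 1))) = γ * xi n * γ⁻¹) :
    (inn n).range.map φ.toMonoidHom ≤ (inn n).range ∨
      (inn n).range.map (φ * μ).toMonoidHom ≤ (inn n).range := by
  have h2 : 2 ≤ n := by omega
  have h3 : 2 < n := by omega
  obtain ⟨f, hf⟩ := exists_hom_of_rel (G := pure h2) (fun g y => UBar 2 g.1 y)
    (fun g => exists_uBar h2 h3 g.2 (exists_isInnerMod_two h3 g.2))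
    (fun g y y' h h' => h.unique le_rfl h3 h') (fun g h y y' hg hh => hg.mul hh)
  have f_inn : ∀ y hy, f ⟨inn n y, hy⟩ = 1 := fun y hy =>
    (hf _).unique le_rfl h3 (uBar_inn h2 2 y)
  obtain ⟨h, hh⟩ : ∃ h : pure h2 →* FreeGroup (Fin 2),
      ∀ g, h g = f ⟨φ g, map_mem_pure h2 hn φ g.2⟩ :=
    ⟨f.comp ((φ.toMonoidHom.comp (pure h2).subtype).codRestrict _ _), fun _ => rfl⟩
  have hU : ∀ g, UBar 2 (φ g.1) (h g) := fun g => by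
    rw [hh]; exact hf ⟨φ g, map_mem_pure h2 hn φ g.2⟩
  have hna : ¬ ∀ x y, Commute (h x) (h y) := fun hc => by
    obtain ⟨a, ha, ha'⟩ := uBar_surjective h2 (m := 2) (by omega) h3 (X 2 0)
    obtain ⟨b, hb, hb'⟩ := uBar_surjective h2 (m := 2) (by omega) h3 (X 2 1)
    have := hc ⟨φ⁻¹ a, map_mem_pure h2 hn _ ha⟩ ⟨φ⁻¹ b, map_mem_pure h2 hn _ hb⟩
    have e1 := hU ⟨φ⁻¹ a, map_mem_pure h2 hn _ ha⟩
    have e2 := hU ⟨φ⁻¹ b, map_mem_pure h2 hn _ hb⟩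
    rw [show φ (φ⁻¹ a) = a from φ.apply_symm_apply a] at e1
    rw [show φ (φ⁻¹ b) = b from φ.apply_symm_apply b] at e2
    rw [e1.unique le_rfl h3 ha', e2.unique le_rfl h3 hb'] at this
    exact not_commute_X (by omega) (by omega) (by omega) this
  by_cases hx : ∃ y, h (innP h2 y) ≠ 1
  swap
  · push Not at hx
    exact .inl (map_range_inn_le hn φ fun y => by
      rw [← hx y]; exact hU (innP h2 y))
  by_cases hxi : ∃ γ, h (cn h2 γ ⟨xi n, xi_mem_pure h2⟩) ≠ 1
  swap
  · push Not at hxi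
    refine .inr (map_range_inn_le hn (φ * μ) fun y => ?_)
    induction y using FreeGroup.induction_on with
    | C1 => simpa using uBar_inn h2 2 1
    | of i =>
      rw [of_eq_X]
      obtain ⟨g, hg⟩ := inn_X_eq_conj h2 i.2
      obtain ⟨γ, hγ⟩ := hμ
      have h1 := hU (cn h2 (μ g * γ) ⟨xi n, xi_mem_pure h2⟩)
      rw [hxi, coe_cn] at h1
      rw [hg, MulAut.mul_apply, _root_.map_mul, _root_.map_mul μ, hγ, _root_.map_inv]
      convert h1 using 2
      group
    | inv_of i h => simpa using h.inv
    | mul x y hx hy => simpa using hx.mul hy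
  · exfalso
    have h4 := isTwoStrand hna hxi hx (by omega)
    have := map_range_inn_normal h2 φ⁻¹
    have h5 := eq_bot_of_isTwoStrand h3 h4 (map_range_inn_le_pure hn φ⁻¹) (map_range_inn_fg _) (by
      rintro _ ⟨_, ⟨y, rfl⟩, rfl⟩
      rw [hh]
      have : ∀ g, φ ((φ⁻¹).toMonoidHom g) = g := φ.apply_symm_apply
      simp only [this]
      exact f_inn y _)
    have h6 : (φ⁻¹).toMonoidHom (inn n (X n 0)) ∈ (⊥ : Subgroup (AbarB n)) :=
      h5 ▸ ⟨_, ⟨_, rfl⟩, rfl⟩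
    rw [Subgroup.mem_bot] at h6
    have h7 : inn n (X n 0) = 1 := (φ⁻¹).injective (h6.trans (_root_.map_one φ⁻¹).symm)
    exact X_ne_one (by omega) (inn_injective h2 (h7.trans (_root_.map_one _).symm))

end ArtinBAut

namespace FreeGroup

variable {α : Type*}

/-- The product of all the entries of a list of pairs. -/
def pairProd (l : List (FreeGroup α × FreeGroup α)) : FreeGroup α :=
  (l.map fun p => p.1 * p.2).prod

theorem pairProd_append (l l' : List (FreeGroup α × FreeGroup α)) :
    pairProd (l ++ l') = pairProd l * pairProd l' := by
  rw [pairProd, List.map_append, List.prod_append]; rfl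

theorem pairProd_cons (p : FreeGroup α × FreeGroup α) (l : List (FreeGroup α × FreeGroup α)) :
    pairProd (p :: l) = p.1 * p.2 * pairProd l := by
  rw [pairProd, List.map_cons, List.prod_cons]; rfl

variable [DecidableEq α]

theorem NoCancel.mul_right {a b c : FreeGroup α} (h1 : NoCancel a b) (h2 : NoCancel b c)
    (hb : b ≠ 1) : NoCancel a (b * c) := by
  have h := h1.mul_left h2 hb
  rw [NoCancel] at *
  rw [← mul_assoc]
  omega

theorem norm_pow_le (x : FreeGroup α) (k : ℕ) : norm (x ^ k) ≤ k * norm x := by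
  induction k with
  | zero => simp
  | succ k ih =>
    have := norm_mul_le (x ^ k) x
    rw [pow_succ, Nat.succ_mul]
    omega

/-- The elements of the free group which only involve the letters in `S`. -/
def letters (S : Set α) : Subgroup (FreeGroup α) where
  carrier := {x | ∀ p ∈ x.toWord, p.1 ∈ S}
  one_mem' := by simp
  mul_mem' {x y} hx hy p hp := by
    rcases List.mem_append.mp ((toWord_mul_sublist x y).subset hp) with h | h
    · exact hx p h
    · exact hy p h
  inv_mem' {x} hx p hp := by
    rw [toWord_inv, invRev, List.mem_reverse, List.mem_map] at hp
    obtain ⟨p', h, rfl⟩ := hp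
    exact hx p' h

theorem of_mem_letters {S : Set α} {i : α} (hi : i ∈ S) : of i ∈ letters S := fun p hp => by
  rw [toWord_of, List.mem_singleton] at hp
  rwa [hp]

theorem letters_le {S : Set α} {K : Subgroup (FreeGroup α)} (h : ∀ i ∈ S, of i ∈ K) :
    letters S ≤ K := by
  have key : ∀ L : List (α × Bool), (∀ p ∈ L, p.1 ∈ S) → mk L ∈ K := by
    intro L
    induction L with
    | nil => exact fun _ => one_mem _
    | cons p L ih =>
      intro hL
      rw [← List.singleton_append, ← mul_mk]
      refine mul_mem ?_ (ih fun p' hp' => hL p' (by simp [hp']))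
      have := h p.1 (hL p (by simp))
      rcases p with ⟨i, _ | _⟩
      · exact inv_mem this
      · exact this
  intro x hx
  rw [← mk_toWord (x := x)]
  exact key _ hx

theorem noCancel_of_mem_letters {S T : Set α} (hST : Disjoint S T) {x y : FreeGroup α}
    (hx : x ∈ letters S) (hy : y ∈ letters T) : NoCancel x y := by
  rw [noCancel_iff_isReduced, IsReduced, List.isChain_append]
  refine ⟨isReduced_toWord, isReduced_toWord, fun p hp p' hp' h => ?_⟩
  have h1 := hx p (List.mem_of_mem_getLast? hp)
  have h2 := hy p' (List.mem_of_mem_head? hp')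
  exact (Set.disjoint_left.mp hST h1 (h ▸ h2)).elim

/-- The sum of the lengths of all the entries of a list of pairs. -/
def pairNorm (l : List (FreeGroup α × FreeGroup α)) : ℕ :=
  (l.map fun p => norm p.1 + norm p.2).sum

/-- The entries of the pairs are nontrivial and involve alternately letters inside and
outside of `S`. -/
def Alternates (S : Set α) (l : List (FreeGroup α × FreeGroup α)) : Prop :=
  ∀ p ∈ l, (p.1 ∈ letters S ∧ p.1 ≠ 1) ∧ p.2 ∈ letters Sᶜ ∧ p.2 ≠ 1

theorem Alternates.norm_pairProd {S : Set α} {l : List (FreeGroup α × FreeGroup α)}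
    (h : Alternates S l) : norm (pairProd l) = pairNorm l := by
  suffices (∀ c ∈ letters Sᶜ, NoCancel c (pairProd l)) ∧ norm (pairProd l) = pairNorm l from this.2
  induction l with
  | nil => exact ⟨fun c _ => by simp [NoCancel, pairProd], by simp [pairProd, pairNorm]⟩
  | cons p l ih =>
    obtain ⟨ih1, ih2⟩ := ih fun p hp => h p (by simp [hp])
    obtain ⟨⟨ha, ha'⟩, hc, hc'⟩ := h p (by simp)
    have h1 : NoCancel p.1 (p.2 * pairProd l) :=
      (noCancel_of_mem_letters disjoint_compl_right ha hc).mul_right (ih1 _ hc) hc'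
    rw [pairProd_cons, mul_assoc]
    refine ⟨fun c hc0 => (noCancel_of_mem_letters disjoint_compl_left hc0 ha).mul_right h1 ha', ?_⟩
    rw [h1, ih1 _ hc, ih2, pairNorm, pairNorm, List.map_cons, List.sum_cons]
    omega

theorem Alternates.norm_pow {S : Set α} {l : List (FreeGroup α × FreeGroup α)}
    (h : Alternates S l) (k : ℕ) : norm (pairProd l ^ k) = k * norm (pairProd l) := by
  obtain ⟨l', h1, h2, h3⟩ : ∃ l', Alternates S l' ∧ pairProd l' = pairProd l ^ k ∧
      pairNorm l' = k * pairNorm l := by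
    induction k with
    | zero => exact ⟨[], by simp [Alternates], by simp [pairProd], by simp [pairNorm]⟩
    | succ k ih =>
      obtain ⟨l', h1, h2, h3⟩ := ih
      refine ⟨l' ++ l, fun p hp => (List.mem_append.mp hp).elim (h1 p) (h p), ?_, ?_⟩
      · rw [pairProd_append, h2, pow_succ]
      · rw [Nat.succ_mul, ← h3, pairNorm, List.map_append, List.sum_append]; rfl
  rw [← h2, h1.norm_pairProd, h3, h.norm_pairProd]

theorem Alternates.norm_le_of_isConj {S : Set α} {l : List (FreeGroup α × FreeGroup α)}
    (h : Alternates S l) {y : FreeGroup α} (hy : IsConj (pairProd l) y) :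
    norm (pairProd l) ≤ norm y := by
  obtain ⟨u, rfl⟩ := isConj_iff.mp hy
  by_contra! hlt
  have key : ∀ k, k * norm (pairProd l) ≤ 2 * norm u + k * norm (u * pairProd l * u⁻¹) := by
    intro k
    have h1 : pairProd l ^ k = u⁻¹ * (u * pairProd l * u⁻¹) ^ k * u := by rw [conj_pow]; group
    rw [← h.norm_pow, h1]
    have h2 := norm_mul_le (u⁻¹ * (u * pairProd l * u⁻¹) ^ k) u
    have h3 := norm_mul_le u⁻¹ ((u * pairProd l * u⁻¹) ^ k)
    have h4 := norm_pow_le (u * pairProd l * u⁻¹) k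
    rw [norm_inv_eq] at h3
    omega
  have := key (2 * norm u + 1)
  nlinarith

theorem exists_pairProd_eq (S : Set α) (y : FreeGroup α) :
    ∃ l : List (FreeGroup α × FreeGroup α),
      (∀ p ∈ l, p.1 ∈ letters S ∧ p.2 ∈ letters Sᶜ) ∧ pairProd l = y := by
  have single : ∀ x : FreeGroup α, x ∈ letters S ∨ x ∈ letters Sᶜ →
      ∃ l : List (FreeGroup α × FreeGroup α),
        (∀ p ∈ l, p.1 ∈ letters S ∧ p.2 ∈ letters Sᶜ) ∧ pairProd l = x := by
    rintro x (hx | hx)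
    · exact ⟨[(x, 1)], by
        simp only [List.mem_singleton, forall_eq]; exact ⟨hx, one_mem _⟩, by simp [pairProd]⟩
    · exact ⟨[(1, x)], by
        simp only [List.mem_singleton, forall_eq]; exact ⟨one_mem _, hx⟩, by simp [pairProd]⟩
  have hof : ∀ i, of i ∈ letters S ∨ of i ∈ letters Sᶜ := fun i =>
    (em (i ∈ S)).imp of_mem_letters fun h => of_mem_letters h
  induction y using FreeGroup.induction_on with
  | C1 => exact single 1 (.inl (one_mem _))
  | of i => exact single _ (hof i)
  | inv_of i _ => exact single _ ((hof i).imp (fun h => inv_mem h) fun h => inv_mem h)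
  | mul x y hx hy =>
    obtain ⟨l, h1, rfl⟩ := hx
    obtain ⟨l', h2, rfl⟩ := hy
    exact ⟨l ++ l', fun p hp => (List.mem_append.mp hp).elim (h1 p) (h2 p), pairProd_append _ _⟩

/-- Every conjugacy class of a free product decomposition of the free group meets one of the
factors or has an alternating representative. -/
theorem exists_alternates (S : Set α) (y : FreeGroup α) :
    (∃ x ∈ letters S, IsConj x y) ∨ (∃ x ∈ letters Sᶜ, IsConj x y) ∨
      ∃ l, Alternates S l ∧ IsConj (pairProd l) y := by
  classical
  have hex : ∃ k, ∃ l : List (FreeGroup α × FreeGroup α), l.length = k ∧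
      (∀ p ∈ l, p.1 ∈ letters S ∧ p.2 ∈ letters Sᶜ) ∧ IsConj (pairProd l) y := by
    obtain ⟨l, h1, h2⟩ := exists_pairProd_eq S y
    exact ⟨_, l, rfl, h1, h2 ▸ IsConj.refl _⟩
  obtain ⟨l, hk, hl, hconj⟩ := Nat.find_spec hex
  have hmin : ∀ l' : List (FreeGroup α × FreeGroup α),
      (∀ p ∈ l', p.1 ∈ letters S ∧ p.2 ∈ letters Sᶜ) → IsConj (pairProd l') y →
        l.length ≤ l'.length := fun l' h1 h2 => by
    rw [hk]; exact Nat.find_min' hex ⟨l', rfl, h1, h2⟩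
  by_cases halt : Alternates S l
  · exact .inr (.inr ⟨l, halt, hconj⟩)
  obtain ⟨p, hp, hp1⟩ : ∃ p ∈ l, p.1 = 1 ∨ p.2 = 1 := by
    by_contra! hc
    exact halt fun p hp => ⟨⟨(hl p hp).1, (hc p hp).1⟩, (hl p hp).2, (hc p hp).2⟩
  obtain ⟨l₁, l₂, rfl⟩ := List.append_of_mem hp
  have hl' : ∀ p ∈ l₂ ++ l₁, p.1 ∈ letters S ∧ p.2 ∈ letters Sᶜ := fun p hp => hl p (by
    simp only [List.mem_append, List.mem_cons] at hp ⊢; tauto)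
  have hlen : (l₁ ++ p :: l₂).length = (l₂ ++ l₁).length + 1 := by simp; omega
  have hc1 : IsConj (p.1 * p.2 * pairProd (l₂ ++ l₁)) y := by
    refine IsConj.trans (isConj_iff.mpr ⟨pairProd l₁, ?_⟩) hconj
    rw [pairProd_append, pairProd_append, pairProd_cons]
    group
  obtain ⟨ha, hc⟩ := hl p hp
  rcases hp1 with h1 | h1 <;> rw [h1] at hc1
  · rcases List.eq_nil_or_concat (l₂ ++ l₁) with h0 | ⟨l', p', h0⟩
    · exact .inr (.inl ⟨_, hc, by simpa [h0, pairProd] using hc1⟩)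
    · rw [h0] at hc1 hl' hlen
      have := hmin (l' ++ [(p'.1, p'.2 * p.2)]) (fun r hr => ?_)
        (IsConj.trans (isConj_iff.mpr ⟨p.2, ?_⟩) hc1)
      · simp at this hlen; omega
      · rcases List.mem_append.mp hr with hr | hr
        · exact hl' r (by simp [hr])
        · rw [List.mem_singleton] at hr
          obtain ⟨h2, h3⟩ := hl' p' (by simp)
          exact hr ▸ ⟨h2, mul_mem h3 hc⟩
      · rw [pairProd_append, List.concat_eq_append, pairProd_append, pairProd_cons, pairProd_cons]
        simp only [pairProd, List.map_nil, List.prod_nil]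
        group
  · rcases h0 : l₂ ++ l₁ with _ | ⟨p', l'⟩
    · exact .inl ⟨_, ha, by simpa [h0, pairProd] using hc1⟩
    · rw [h0] at hc1 hl' hlen
      have := hmin ((p.1 * p'.1, p'.2) :: l') (fun r hr => ?_) ?_
      · simp at this hlen; omega
      · rcases List.mem_cons.mp hr with hr | hr
        · obtain ⟨h2, h3⟩ := hl' p' (by simp)
          exact hr ▸ ⟨mul_mem ha h2, h3⟩
        · exact hl' r (by simp [hr])
      · rw [pairProd_cons] at hc1 ⊢
        simpa [mul_assoc] using hc1

theorem finite_norm_le [Finite α] (k : ℕ) : {x : FreeGroup α | norm x ≤ k}.Finite :=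
  Set.Finite.preimage toWord_injective.injOn (List.finite_length_le (α × Bool) k)

theorem mem_zpowers_of_norm_conj_le [Finite α] {b : α} {a : FreeGroup α} {k : ℕ}
    (h : ∀ N : ℕ, norm ((of b ^ N)⁻¹ * a * of b ^ N) ≤ k) : a ∈ Subgroup.zpowers (of b) := by
  obtain ⟨N, -, M, -, hne, heq⟩ := Set.infinite_univ.exists_ne_map_eq_of_mapsTo
    (f := fun N : ℕ => (of b ^ N)⁻¹ * a * of b ^ N) (fun N _ => h N) (finite_norm_le k)
  apply mem_zpowers_of_commute
  apply commute_of_commute_zpow (k := (N : ℤ) - M) (by omega)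
  simp only [← zpow_natCast] at heq
  show _ = _
  rw [zpow_sub]
  generalize of b ^ (N : ℤ) = x at *
  generalize hz : of b ^ (M : ℤ) = z at *
  have hxz : a * x = x * (z⁻¹ * a * z) := by rw [← heq]; group
  calc a * (x * z⁻¹) = a * x * z⁻¹ := by group
    _ = _ := by rw [hxz]; group

/-- A conjugacy class invariant under a partial conjugation by a letter `b ∈ S` of the letters
in `S` meets one of the two pieces exchanged by the twist. -/
theorem exists_isConj_of_twist [Finite α] {S : Set α} {b : α} (hb : b ∈ S)
    {ζ : ℕ → FreeGroup α →* FreeGroup α}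
    (hS : ∀ N, ∀ i ∈ S, ζ N (of i) = (of b ^ N)⁻¹ * of i * of b ^ N)
    (hS' : ∀ N, ∀ i ∉ S, ζ N (of i) = of i) {y : FreeGroup α} (hy : ∀ N, IsConj (ζ N y) y) :
    ∃ x, IsConj x y ∧ (x ∈ letters S ∨ x ∈ letters (insert b Sᶜ)) := by
  have hmono : letters Sᶜ ≤ letters (insert b Sᶜ) :=
    letters_le fun i hi => of_mem_letters (.inr hi)
  rcases exists_alternates S y with ⟨x, hx, h⟩ | ⟨x, hx, h⟩ | ⟨l, hl, h⟩
  · exact ⟨x, h, .inl hx⟩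
  · exact ⟨x, h, .inr (hmono hx)⟩
  refine ⟨_, h, .inr ?_⟩
  have hA : ∀ N, ∀ x ∈ letters S, ζ N x = (of b ^ N)⁻¹ * x * of b ^ N := fun N => by
    have : letters S ≤ (ζ N).eqLocus (MulAut.conj (of b ^ N)⁻¹).toMonoidHom :=
      letters_le fun i hi => by
        show ζ N (of i) = (of b ^ N)⁻¹ * of i * ((of b ^ N)⁻¹)⁻¹
        rw [hS N i hi, inv_inv]
    intro x hx
    have e : ζ N x = (of b ^ N)⁻¹ * x * ((of b ^ N)⁻¹)⁻¹ := this hx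
    rw [e, inv_inv]
  have hC : ∀ N, ∀ x ∈ letters Sᶜ, ζ N x = x := fun N => by
    have : letters Sᶜ ≤ (ζ N).eqLocus (MonoidHom.id _) := letters_le fun i hi => hS' N i hi
    exact fun x hx => this hx
  have hpow : ∀ N, of b ^ N ∈ letters S := fun N => pow_mem (of_mem_letters hb) N
  have key : ∀ N : ℕ, ∀ p ∈ l, norm ((of b ^ N)⁻¹ * p.1 * of b ^ N) ≤ norm (pairProd l) := by
    intro N p hp
    let l' := l.map fun p => ((of b ^ N)⁻¹ * p.1 * of b ^ N, p.2)
    have hl' : Alternates S l' := by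
      intro r hr
      obtain ⟨p, hp, rfl⟩ := List.mem_map.mp hr
      obtain ⟨⟨h1, h2⟩, h3⟩ := hl p hp
      refine ⟨⟨mul_mem (mul_mem (inv_mem (hpow N)) h1) (hpow N), fun h0 => h2 ?_⟩, h3⟩
      rw [mul_eq_one_iff_eq_inv, inv_mul_eq_iff_eq_mul] at h0
      simpa using h0
    have e : ζ N (pairProd l) = pairProd l' := by
      rw [pairProd, pairProd, _root_.map_list_prod, List.map_map, List.map_map]
      congr 1
      refine List.map_congr_left fun p hp => ?_
      obtain ⟨⟨h1, -⟩, h3, -⟩ := hl p hp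
      simp only [Function.comp_apply, _root_.map_mul]
      rw [hA N _ h1, hC N _ h3]
    have h1 := hl'.norm_le_of_isConj (y := pairProd l)
      (e ▸ (((ζ N).map_isConj h).trans (hy N)).trans h.symm)
    refine le_trans ?_ h1
    rw [hl'.norm_pairProd]
    refine le_trans (Nat.le_add_right _ (norm p.2))
      (List.single_le_sum (fun _ _ => Nat.zero_le _) _ ?_)
    exact List.mem_map.mpr ⟨_, List.mem_map.mpr ⟨p, hp, rfl⟩, rfl⟩
  apply Subgroup.list_prod_mem
  intro x hx
  obtain ⟨p, hp, rfl⟩ := List.mem_map.mp hx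
  refine mul_mem ?_ (hmono (hl p hp).2.1)
  exact (Subgroup.zpowers_le.mpr (of_mem_letters (Set.mem_insert b _)))
    (mem_zpowers_of_norm_conj_le fun N => key N p hp)

end FreeGroup

namespace ArtinBAut

open FreeGroup (of letters)

variable {n : ℕ}

/-- A word whose conjugacy class is invariant under the pure subgroup. -/
def PureInv (hn : 2 ≤ n) (y : FreeGroup (Fin n)) : Prop :=
  ∀ g ∈ pure hn, IsConj (ev n g y) y

theorem PureInv.map_ev {hn : 2 ≤ n} {y : FreeGroup (Fin n)} (hy : PureInv hn y) (γ : AbarB n) :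
    PureInv hn (ev n γ y) := fun g hg => by
  have h := (ev n γ).toMonoidHom.map_isConj (hy (γ⁻¹ * g * γ) (by
    have := (inferInstance : (pure hn).Normal).conj_mem g hg γ⁻¹
    rwa [inv_inv] at this))
  have e : ev n γ (ev n (γ⁻¹ * g * γ) y) =
      ev n g (ev n γ y) := by
    rw [← MulAut.mul_apply, ← MulAut.mul_apply, ← _root_.map_mul, ← _root_.map_mul]
    congr 2
    group
  rw [← e]
  exact h

theorem pureInv_X {hn : 2 ≤ n} {i : ℕ} (hi : i < n) : PureInv hn (X n i) :=
  fun _ hg => ((mem_pure hn).mp hg i hi).symm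

theorem pureInv_W {hn : 2 ≤ n} : PureInv hn (W n n) := fun g _ => (ev_W hn g).symm

theorem expo_W {i m : ℕ} (h : m ≤ i) : expo n i (W n m) = 1 := by
  induction m with
  | zero => exact _root_.map_one _
  | succ m ih =>
    rw [show W n (m + 1) = W n m * X n m from rfl, _root_.map_mul, ih (by omega),
      expo_X_ne (by omega), one_mul]

/-- The class of a word invariant under a pure element acting as a partial conjugation in a
suitable basis meets one of two special subgroups. -/
theorem PureInv.exists_isConj {hn : 2 ≤ n} {g : AbarB n} (hg : g ∈ pure hn)
    {α : MulAut (FreeGroup (Fin n))} {k : ℕ} (hk0 : k ≠ 0)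
    (h0 : ev n g (α (X n 0)) = α (X n 0))
    (h1 : ev n g (α (X n k)) = (α (X n 0))⁻¹ * α (X n k) * α (X n 0))
    (h2 : ∀ i < n, i ≠ 0 → i ≠ k → ev n g (α (X n i)) = α (X n i))
    {y : FreeGroup (Fin n)} (hy : PureInv hn y) :
    ∃ v, IsConj v y ∧
      ((∀ K : Subgroup (FreeGroup (Fin n)), α (X n 0) ∈ K → α (X n k) ∈ K → v ∈ K) ∨
        ∀ K : Subgroup (FreeGroup (Fin n)), (∀ i < n, i ≠ k → α (X n i) ∈ K) → v ∈ K) := by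
  have hX : ∀ i : Fin n, of i = X n i := fun i => by rw [X_of_lt i.2]
  have hpow : ∀ N : ℕ, ∀ x, ev n (g ^ (N + 1)) x =
      ev n g (ev n (g ^ N) x) := fun N x => by
    rw [pow_succ', _root_.map_mul, MulAut.mul_apply]
  have e0 : ∀ N : ℕ, ev n (g ^ N) (α (X n 0)) = α (X n 0) := fun N => by
    induction N with
    | zero => simp
    | succ N ih => rw [hpow, ih, h0]
  have e1 : ∀ N : ℕ, ev n (g ^ N) (α (X n k)) =
      (α (X n 0) ^ N)⁻¹ * α (X n k) * α (X n 0) ^ N := fun N => by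
    induction N with
    | zero => simp
    | succ N ih =>
      rw [hpow, ih]
      simp only [_root_.map_mul, _root_.map_inv, _root_.map_pow, h0, h1, pow_succ']
      group
  have e2 : ∀ N : ℕ, ∀ i < n, i ≠ 0 → i ≠ k → ev n (g ^ N) (α (X n i)) = α (X n i) :=
    fun N i hi h h' => by
      induction N with
      | zero => simp
      | succ N ih => rw [hpow, ih, h2 i hi h h']
  obtain ⟨x, hx, hx'⟩ := FreeGroup.exists_isConj_of_twist
    (S := {i : Fin n | i.1 = 0 ∨ i.1 = k}) (b := ⟨0, by omega⟩) (.inl rfl)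
    (ζ := fun N => (α⁻¹ * ev n (g ^ N) * α : MulAut _).toMonoidHom) (y := α⁻¹ y)
    (fun N i hi => by
      show α⁻¹ (ev n (g ^ N) (α (of i))) = _
      rw [hX, hX]
      rcases hi with hi | hi <;> rw [hi]
      · rw [e0, MulAut.inv_apply_self, mul_assoc, ← pow_succ', pow_succ, inv_mul_cancel_left]
      · rw [e1]
        simp only [_root_.map_mul, _root_.map_inv, _root_.map_pow, MulAut.inv_apply_self])
    (fun N i hi => by
      show α⁻¹ (ev n (g ^ N) (α (of i))) = _
      rw [hX, e2 N i i.2 (fun h => hi (.inl h)) fun h => hi (.inr h), MulAut.inv_apply_self])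
    (fun N => by
      show IsConj (α⁻¹ (ev n (g ^ N) (α (α⁻¹ y)))) _
      rw [MulAut.apply_inv_self]
      exact (α⁻¹).toMonoidHom.map_isConj (hy _ (pow_mem hg N)))
  refine ⟨α x, ?_, hx'.imp (fun h K k0 kk => ?_) fun h K hK => ?_⟩
  · have := α.toMonoidHom.map_isConj hx
    simpa using this
  · refine FreeGroup.letters_le (K := K.comap α.toMonoidHom) (fun i hi => ?_) h
    rw [hX]
    rcases hi with hi | hi <;> rw [hi]
    exacts [k0, kk]
  · refine FreeGroup.letters_le (K := K.comap α.toMonoidHom) (fun i hi => ?_) h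
    rw [hX]
    refine hK i i.2 fun hik => ?_
    rcases hi with rfl | hi
    · exact hk0 hik.symm
    · exact hi (.inr hik)

theorem PureInv.q_two {hn : 2 ≤ n} {y : FreeGroup (Fin n)} (hy : PureInv hn y) :
    (∃ v, IsConj v y ∧ q n 2 v = v) ∨ expo n 0 y = expo n 1 y := by
  obtain ⟨α, h0, h1⟩ := exists_basisW (n := n) (m := 2) (by omega) hn
  have hs : ev n (sb n 0 ^ 2) = sigma n 0 * sigma n 0 := by
    rw [_root_.map_pow, ev_sb (by omega), sq]
  have hW : W n 2 = X n 0 * X n 1 := by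
    rw [show W n 2 = 1 * X n 0 * X n 1 from rfl, one_mul]
  obtain ⟨v, hv, h | h⟩ := PureInv.exists_isConj (sb_sq_mem_pure hn (i := 0) (by omega)) (α := α)
    (k := 1) (by omega)
    (by rw [h0, hs, MulAut.mul_apply, sigma_W_of_gt (by omega) (by omega),
      sigma_W_of_gt (by omega) (by omega)])
    (by
      rw [h0, h1 1 (by omega), hs, MulAut.mul_apply, hW]
      simp only [_root_.map_mul, _root_.map_inv, sigma_X_succ (n := n) (i := 0) (by omega),
        sigma_X_self (n := n) (i := 0) (by omega), zero_add]
      group)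
    (fun i hi hi0 hi1 => by
      rw [h1 i hi0, hs, MulAut.mul_apply, sigma_X_ne (by omega) hi0 hi1,
        sigma_X_ne (by omega) hi0 hi1]) hy
  · exact .inl ⟨v, hv, h ((q n 2).eqLocus (MonoidHom.id _))
      (by rw [h0]; exact q_W le_rfl) (by rw [h1 1 (by omega)]; exact q_X_of_lt (by omega))⟩
  · refine .inr ?_
    rw [← map_isConj_eq _ hv, ← map_isConj_eq _ hv]
    refine h ((expo n 0).eqLocus (expo n 1)) fun i hi hi1 => ?_
    show expo n 0 (α (X n i)) = expo n 1 (α (X n i))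
    rcases Nat.eq_zero_or_pos i with rfl | hi0
    · rw [h0, hW, _root_.map_mul, _root_.map_mul, expo_X_self (by omega), expo_X_self (by omega),
        expo_X_ne (by omega), expo_X_ne (by omega), one_mul, mul_one]
    · rw [h1 i (by omega), expo_X_ne (by omega), expo_X_ne (by omega)]

theorem PureInv.mem_closure {hn : 2 ≤ n} {y : FreeGroup (Fin n)} (hy : PureInv hn y) :
    (∃ v, IsConj v y ∧ v ∈ Subgroup.closure {W n n, X n (n - 1)}) ∨ expo n (n - 1) y = 1 := by
  obtain ⟨α, h0, h1⟩ := exists_basisW (n := n) (m := n - 1) (by omega) (by omega)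
  obtain ⟨hx, hx'⟩ := ev_xi hn
  have hW : W n n = W n (n - 1) * X n (n - 1) := by
    obtain ⟨m, rfl⟩ : ∃ m, n = m + 1 := ⟨n - 1, by omega⟩
    rfl
  have hWfix : ∀ m ≤ n - 1, ev n (xi n) (W n m) = W n m := fun m hm => by
    induction m with
    | zero => exact _root_.map_one _
    | succ m ih =>
      rw [show W n (m + 1) = W n m * X n m from rfl, _root_.map_mul (ev n (xi n)),
        ih (by omega), hx m (by omega)]
  obtain ⟨v, hv, h | h⟩ := PureInv.exists_isConj (xi_mem_pure hn) (α := α)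
    (k := n - 1) (by omega) (by rw [h0, hWfix _ le_rfl])
    (by rw [h0, h1 _ (by omega), hx', hW]; group)
    (fun i hi hi0 hi1 => by rw [h1 i hi0, hx i (by omega)]) hy
  · have hX := Subgroup.subset_closure (k := {W n n, X n (n - 1)})
      (show X n (n - 1) ∈ _ from .inr rfl)
    refine .inl ⟨v, hv, h _ ?_ ?_⟩
    · have := mul_mem (Subgroup.subset_closure (k := {W n n, X n (n - 1)})
        (show W n n ∈ _ from .inl rfl)) (inv_mem hX)
      rwa [hW, mul_inv_cancel_right, ← hW, ← h0] at this
    · rwa [h1 _ (by omega)]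
  · refine .inr ?_
    rw [← map_isConj_eq _ hv]
    refine h (expo n (n - 1)).ker fun i hi hi1 => ?_
    show expo n (n - 1) (α (X n i)) = 1
    rcases Nat.eq_zero_or_pos i with rfl | hi0
    · rw [h0, expo_W le_rfl]
    · rw [h1 i (by omega), expo_X_ne hi1]

end ArtinBAut

namespace ArtinBAut

variable {n : ℕ}

theorem PureInv.expo_eq_one {hn : 2 ≤ n} {y : FreeGroup (Fin n)} (hy : PureInv hn y)
    {i j k : Fin n} (hij : i ≠ j) (hik : i ≠ k) (hjk : j ≠ k) (h : expo n i y ≠ expo n j y) :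
    expo n k y = 1 := by
  have hn3 : 2 < n := by
    have := i.2; have := j.2; have := k.2
    have : i.1 ≠ j := fun h => hij (Fin.ext h)
    have : i.1 ≠ k := fun h => hik (Fin.ext h)
    have : j.1 ≠ k := fun h => hjk (Fin.ext h)
    omega
  obtain ⟨f, hi, hj, hk⟩ := exists_perm_three hij hik hjk
    (a' := (⟨0, by omega⟩ : Fin n)) (b' := ⟨1, by omega⟩) (c' := ⟨2, hn3⟩)
    (by simp) (by simp) (by simp)
  obtain ⟨γ, rfl⟩ := perm_surjective hn f
  have ei := expo_ev_perm hn γ i y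
  have ej := expo_ev_perm hn γ j y
  have ek := expo_ev_perm hn γ k y
  rw [hi] at ei
  rw [hj] at ej
  rw [hk] at ek
  rcases (hy.map_ev γ).q_two with ⟨v, hv, hq⟩ | h'
  · have h2 : (expo n 2).comp (q n 2) = 1 := hom_ext fun i _ => by
      rw [MonoidHom.comp_apply, q_X]
      split_ifs with hi2
      · exact expo_X_ne (by omega)
      · exact _root_.map_one _
    rw [← ek, ← map_isConj_eq _ hv, ← hq]
    exact DFunLike.congr_fun h2 v
  · exact absurd (ei.symm.trans (h'.trans ej)) h

theorem PureInv.expo_cases (hn : 3 ≤ n) {y : FreeGroup (Fin n)}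
    (hy : PureInv (show 2 ≤ n by omega) y) :
    (∀ i j : Fin n, expo n i y = expo n j y) ∨
      ∃ k : Fin n, expo n k y ≠ 1 ∧ ∀ i, i ≠ k → expo n i y = 1 := by
  by_cases hall : ∀ i j : Fin n, expo n i y = expo n j y
  · exact .inl hall
  push Not at hall
  obtain ⟨i, j, hne⟩ := hall
  have hij : i ≠ j := fun h => hne (by rw [h])
  refine .inr ?_
  by_cases hi : expo n i y = 1
  · refine ⟨j, fun h => hne (hi.trans h.symm), fun k hk => ?_⟩
    by_cases hki : k = i
    · rw [hki, hi]
    · exact hy.expo_eq_one hij (Ne.symm hki) (Ne.symm hk) hne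
  · refine ⟨i, hi, fun k hk => ?_⟩
    by_cases hkj : k = j
    · subst hkj
      obtain ⟨l, hl⟩ : ∃ l : Fin n, l ∉ ({i, k} : Finset (Fin n)) := by
        by_contra! hc
        have := Finset.card_le_card (fun x _ => hc x : Finset.univ ⊆ ({i, k} : Finset (Fin n)))
        have := Finset.card_le_two (a := i) (b := k)
        rw [Finset.card_univ, Fintype.card_fin] at *
        omega
      simp only [Finset.mem_insert, Finset.mem_singleton, not_or] at hl
      have hl1 := hy.expo_eq_one hij (Ne.symm hl.1) (Ne.symm hl.2) hne
      exact hy.expo_eq_one (Ne.symm hl.1) hij hl.2 fun h => hi (h.trans hl1)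
    · exact hy.expo_eq_one hij (Ne.symm hk) (Ne.symm hkj) hne

theorem isConj_zpow {G : Type*} [Group G] {x y : G} (h : IsConj x y) (c : ℤ) :
    IsConj (x ^ c) (y ^ c) := by
  obtain ⟨u, rfl⟩ := isConj_iff.mp h
  exact isConj_iff.mpr ⟨u, conj_zpow.symm⟩

theorem q_one_mem_zpowers (x : FreeGroup (Fin n)) :
    q n 1 x ∈ Subgroup.zpowers (X n 0) := by
  have h := hom_ext (f := q n 1) (g := (zpowersHom _ (X n 0)).comp (expo n 0)) fun i hi => by
    rw [MonoidHom.comp_apply, q_X]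
    split_ifs with h1
    · obtain rfl : i = 0 := by omega
      rw [expo_X_self (by omega)]
      simp [zpowersHom_apply]
    · rw [expo_X_ne (by omega), _root_.map_one]
  rw [h]
  exact ⟨Multiplicative.toAdd (expo n 0 x), rfl⟩

theorem exists_zpow_zero (hn : 3 ≤ n) {y : FreeGroup (Fin n)}
    (hy : PureInv (show 2 ≤ n by omega) y) (h0 : expo n 0 y ≠ 1)
    (h : ∀ i < n, i ≠ 0 → expo n i y = 1) : ∃ c : ℤ, IsConj (X n 0 ^ c) y := by
  have hn2 : 2 ≤ n := by omega
  have key : ∀ y, PureInv hn2 y → expo n 0 y ≠ 1 → expo n 1 y = 1 →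
      ∃ v, IsConj v y ∧ q n 2 v = v := fun y hy h0 h1 =>
    hy.q_two.resolve_right fun h => h0 (h.trans h1)
  obtain ⟨v₁, hv₁, hq₁⟩ := key y hy h0 (h 1 (by omega) (by omega))
  have hp : perm hn2 (sb n 1) = Equiv.swap ⟨1, by omega⟩ ⟨2, by omega⟩ := perm_sb hn2 (by omega)
  have e0 := expo_ev_perm hn2 (sb n 1) ⟨0, by omega⟩ y
  have e1 := expo_ev_perm hn2 (sb n 1) ⟨2, by omega⟩ y
  rw [hp, Equiv.swap_apply_right] at e1
  rw [hp, Equiv.swap_apply_of_ne_of_ne (by simp) (by simp)] at e0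
  simp only at e0 e1
  obtain ⟨v₂, hv₂, hq₂⟩ := key _ (hy.map_ev (sb n 1)) (by rwa [e0])
    (e1.trans (h 2 (by omega) (by omega)))
  have e : (q n 2).comp ((sigma n 1)⁻¹.toMonoidHom.comp (q n 2)) = q n 1 := hom_ext fun i _ => by
    show q n 2 ((sigma n 1)⁻¹ (q n 2 (X n i))) = _
    rw [q_X, q_X]
    rcases Nat.lt_or_ge i 2 with h2 | h2
    · rw [if_pos h2, sigma_inv_X (by omega)]
      obtain rfl | rfl : i = 0 ∨ i = 1 := by omega
      · simp [q_X]
      · simp [q_X]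
    · rw [if_neg (by omega), if_neg (by omega), _root_.map_one, _root_.map_one]
  obtain ⟨c, hc⟩ := q_one_mem_zpowers v₂
  refine ⟨c, ?_⟩
  have h1 : IsConj ((sigma n 1)⁻¹ v₂) v₁ := by
    have := ((sigma n 1)⁻¹).toMonoidHom.map_isConj hv₂
    simp only [MulEquiv.toMonoidHom_eq_coe, MonoidHom.coe_coe, ev_sb (n := n) (i := 1) (by omega),
      MulAut.inv_apply_self] at this
    exact this.trans hv₁.symm
  have h2 := (q n 2).map_isConj h1
  rw [hq₁, ← hq₂] at h2
  have h3 : q n 2 ((sigma n 1)⁻¹ (q n 2 v₂)) = q n 1 v₂ := DFunLike.congr_fun e v₂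
  rw [h3, ← show X n 0 ^ c = _ from hc] at h2
  exact h2.trans hv₁

theorem exists_zpow_X (hn : 3 ≤ n) {y : FreeGroup (Fin n)}
    (hy : PureInv (show 2 ≤ n by omega) y) {k : Fin n} (h0 : expo n k y ≠ 1)
    (h : ∀ i, i ≠ k → expo n i y = 1) : ∃ c : ℤ, IsConj (X n k ^ c) y := by
  have hn2 : 2 ≤ n := by omega
  obtain ⟨γ, hγ⟩ := perm_surjective hn2 (Equiv.swap k ⟨0, by omega⟩)
  have hk : perm hn2 γ k = ⟨0, by omega⟩ := by rw [hγ, Equiv.swap_apply_left]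
  obtain ⟨c, hc⟩ := exists_zpow_zero hn (hy.map_ev γ)
    (by have := expo_ev_perm hn2 γ k y; rw [hk] at this; rwa [this])
    (fun i hi hi0 => by
      have := expo_ev_perm hn2 γ ((perm hn2 γ).symm ⟨i, hi⟩) y
      rw [Equiv.apply_symm_apply] at this
      rw [this]
      refine h _ fun hc => hi0 ?_
      rw [Equiv.symm_apply_eq, hk] at hc
      exact congrArg Fin.val hc)
  refine ⟨c, ?_⟩
  have h1 := perm_spec hn2 γ k
  rw [hk] at h1
  have h2 : IsConj (ev n γ (X n k ^ c)) (ev n γ y) := by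
    rw [_root_.map_zpow]
    exact (isConj_zpow h1 c).symm.trans hc
  have := ((ev n γ)⁻¹).toMonoidHom.map_isConj h2
  simpa using this

theorem exists_zpow_W (hn : 3 ≤ n) {y : FreeGroup (Fin n)}
    (hy : PureInv (show 2 ≤ n by omega) y) (h0 : ∀ i : Fin n, expo n i y ≠ 1) :
    ∃ c : ℤ, IsConj (W n n ^ c) y := by
  have hn2 : 2 ≤ n := by omega
  obtain ⟨r, hr⟩ : ∃ r : FreeGroup (Fin n) →* FreeGroup (Fin n), ∀ i < n,
      r (X n i) = if i = 0 then X n 0 else if i = 1 then (X n 0)⁻¹ * W n n else 1 :=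
    ⟨liftX n _, fun i hi => liftX_X _ hi⟩
  have hrW : ∀ m, 2 ≤ m → m ≤ n → r (W n m) = W n n := fun m hm hmn => by
    induction m, hm using Nat.le_induction with
    | base =>
      rw [show W n 2 = 1 * X n 0 * X n 1 from rfl, one_mul, _root_.map_mul, hr 0 (by omega),
        hr 1 (by omega), if_pos rfl, if_neg (by omega), if_pos rfl, mul_inv_cancel_left]
    | succ m hm ih =>
      rw [show W n (m + 1) = W n m * X n m from rfl, _root_.map_mul, ih (by omega),
        hr m (by omega), if_neg (by omega), if_neg (by omega), mul_one]
  set R := desc (sb n) 0 (n - 1) with hR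
  have hRW : ev n R (W n n) = W n n :=
    braidSub_W le_rfl le_rfl (ev_mem_braidSub le_rfl (desc_mem_braidSub _ (by omega)))
  have hRX : ev n R (X n 0) = X n (n - 1) := by
    rw [map_desc, desc_congr fun i hi => ev_sb (by omega), desc_sigma_X (by omega) (by omega)]
  obtain ⟨v₁, hv₁, hm₁⟩ := hy.mem_closure.resolve_right (h0 ⟨n - 1, by omega⟩)
  obtain ⟨v₂, hv₂, hm₂⟩ := (hy.map_ev R).mem_closure.resolve_right (by
    have := expo_ev_perm hn2 R ((perm hn2 R).symm ⟨n - 1, by omega⟩) y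
    rw [Equiv.apply_symm_apply] at this
    exact this ▸ h0 _)
  have hv₂' : IsConj ((ev n R)⁻¹ v₂) y := by
    have := ((ev n R)⁻¹).toMonoidHom.map_isConj hv₂
    simpa using this
  have hfix : r ((ev n R)⁻¹ v₂) = (ev n R)⁻¹ v₂ := by
    have : Subgroup.closure {W n n, X n (n - 1)} ≤ (r.comp (ev n R)⁻¹.toMonoidHom).eqLocus
        (ev n R)⁻¹.toMonoidHom := by
      rw [Subgroup.closure_le]
      rintro x (rfl | rfl)
      · show r ((ev n R)⁻¹ (W n n)) = (ev n R)⁻¹ (W n n)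
        have : (ev n R)⁻¹ (W n n) = W n n := by
          nth_rw 1 [← hRW]
          exact MulAut.inv_apply_self _ _ _
        rw [this, hrW n hn2 le_rfl]
      · show r ((ev n R)⁻¹ (X n (n - 1))) = (ev n R)⁻¹ (X n (n - 1))
        rw [← hRX, MulAut.inv_apply_self, hr 0 (by omega), if_pos rfl]
    exact this hm₂
  have hmem : r v₁ ∈ Subgroup.zpowers (W n n) := by
    have : Subgroup.closure {W n n, X n (n - 1)} ≤ (Subgroup.zpowers (W n n)).comap r := by
      rw [Subgroup.closure_le]
      rintro x (rfl | rfl)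
      · show r _ ∈ Subgroup.zpowers (W n n)
        rw [hrW n hn2 le_rfl]
        exact Subgroup.mem_zpowers _
      · show r _ ∈ Subgroup.zpowers (W n n)
        rw [hr _ (by omega), if_neg (by omega), if_neg (by omega)]
        exact one_mem _
    exact this hm₁
  obtain ⟨c, hc⟩ := hmem
  refine ⟨c, ?_⟩
  rw [show W n n ^ c = r v₁ from hc]
  have := r.map_isConj (hv₁.trans hv₂'.symm)
  rw [hfix] at this
  exact this.trans hv₂'

end ArtinBAut

namespace ArtinBAut

variable {n : ℕ}

/-- The total exponent of a word. -/
def total (n : ℕ) : FreeGroup (Fin n) →* Multiplicative ℤ :=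
  liftX n fun _ => Multiplicative.ofAdd 1

theorem total_X {i : ℕ} (hi : i < n) : total n (X n i) = Multiplicative.ofAdd 1 := liftX_X _ hi

theorem total_W {m : ℕ} (hm : m ≤ n) : total n (W n m) = Multiplicative.ofAdd (m : ℤ) := by
  induction m with
  | zero => exact _root_.map_one _
  | succ m ih =>
    rw [show W n (m + 1) = W n m * X n m from rfl, _root_.map_mul, ih (by omega),
      total_X (by omega), ← ofAdd_add]
    push_cast
    rfl

theorem total_ev (hn : 2 ≤ n) (γ : AbarB n) (x : FreeGroup (Fin n)) :
    total n (ev n γ x) = total n x := by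
  refine DFunLike.congr_fun (hom_ext (f := (total n).comp (ev n γ).toMonoidHom) (g := total n)
    fun i hi => ?_) x
  obtain ⟨j, hj, h⟩ := ev_permutes hn γ i hi
  show total n (ev n γ (X n i)) = _
  rw [← map_isConj_eq _ h, total_X hi, total_X hj]

theorem total_eq_one {x : FreeGroup (Fin n)} (h : ∀ i < n, expo n i x = 1) : total n x = 1 := by
  have := hom_ext (f := total n) (g := ∏ i ∈ Finset.range n, expo n i) fun i hi => by
    rw [MonoidHom.finsetProd_apply, Finset.prod_eq_single_of_mem i (Finset.mem_range.mpr hi)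
      fun j _ hj => expo_X_ne (Ne.symm hj), total_X hi, expo_X_self hi]
  rw [this, MonoidHom.finsetProd_apply]
  exact Finset.prod_eq_one fun i hi => h i (Finset.mem_range.mp hi)

theorem inn_X_conj_ne_inv (hn : 2 ≤ n) (γ : AbarB n) :
    γ * inn n (X n (n - 1)) * γ⁻¹ ≠ (inn n (X n (n - 1)))⁻¹ := fun h => by
  rw [inn_equivariant hn, ← _root_.map_inv] at h
  have := congrArg (total n) (inn_injective hn h)
  rw [total_ev hn, _root_.map_inv, total_X (by omega), ← ofAdd_neg] at this
  exact absurd (Multiplicative.ofAdd.injective this) (by decide)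

theorem exists_induced (hn : 2 ≤ n) {φ : MulAut (AbarB n)}
    (hφ : (inn n).range.map φ.toMonoidHom = (inn n).range) :
    ∃ θ : MulAut (FreeGroup (Fin n)), ∀ y, φ (inn n y) = inn n (θ y) := by
  let e := MonoidHom.ofInjective (inn_injective hn)
  let r : (inn n).range ≃* (inn n).range :=
    (φ.subgroupMap (inn n).range).trans (MulEquiv.subgroupCongr hφ)
  refine ⟨(e.trans r).trans e.symm, fun y => ?_⟩
  exact (congrArg Subtype.val (e.apply_symm_apply (r (e y)))).symm

theorem ev_induced (hn : 2 ≤ n) {φ : MulAut (AbarB n)} {θ : MulAut (FreeGroup (Fin n))}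
    (hθ : ∀ y, φ (inn n y) = inn n (θ y)) (g : AbarB n) (y : FreeGroup (Fin n)) :
    ev n (φ g) (θ y) = θ (ev n g y) := by
  apply inn_injective hn
  rw [← inn_equivariant hn, ← hθ, ← hθ, ← inn_equivariant hn]
  simp only [_root_.map_mul, _root_.map_inv]

section Induced

variable {φ : MulAut (AbarB n)} {θ : MulAut (FreeGroup (Fin n))}

theorem PureInv.induced (hn : 5 ≤ n) (hθ : ∀ y, φ (inn n y) = inn n (θ y))
    {y : FreeGroup (Fin n)} (hy : PureInv (show 2 ≤ n by omega) y) :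
    PureInv (show 2 ≤ n by omega) (θ y) := fun g hg => by
  have h := θ.toMonoidHom.map_isConj (hy (φ⁻¹ g) (map_mem_pure _ hn φ⁻¹ hg))
  have e := ev_induced (show 2 ≤ n by omega) hθ (φ⁻¹ g) y
  rw [MulAut.apply_inv_self] at e
  rw [e]
  exact h

theorem isConj_ev_induced (hn : 2 ≤ n) (hθ : ∀ y, φ (inn n y) = inn n (θ y)) {γ : AbarB n}
    {x y : FreeGroup (Fin n)} (h : IsConj (ev n γ x) y) : IsConj (ev n (φ γ) (θ x)) (θ y) := by
  rw [ev_induced hn hθ]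
  exact θ.toMonoidHom.map_isConj h

theorem exists_ev_X (hn : 2 ≤ n) (i j : Fin n) : ∃ γ, IsConj (ev n γ (X n i)) (X n j) := by
  obtain ⟨γ, hγ⟩ := perm_surjective hn (Equiv.swap i j)
  have := perm_spec hn γ i
  rw [hγ, Equiv.swap_apply_left] at this
  exact ⟨γ, this.symm⟩

theorem exists_expo_ne (hn : 2 ≤ n) (i : Fin n) (hθ : ∀ y, φ (inn n y) = inn n (θ y)) :
    ¬ ∀ a b : Fin n, expo n a (θ (X n i)) = expo n b (θ (X n i)) := fun h => by
  have key : (expo n 0).comp θ.toMonoidHom = (expo n 1).comp θ.toMonoidHom :=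
    hom_ext fun j hj => by
      show expo n 0 (θ (X n j)) = expo n 1 (θ (X n j))
      obtain ⟨γ, hγ⟩ := exists_ev_X hn i ⟨j, hj⟩
      have hc := isConj_ev_induced hn hθ hγ
      have e : ∀ a : Fin n, expo n a (θ (X n j)) =
          expo n ((perm hn (φ γ)).symm a : Fin n) (θ (X n i)) := fun a => by
        have := expo_ev_perm hn (φ γ) ((perm hn (φ γ)).symm a) (θ (X n i))
        rw [Equiv.apply_symm_apply, map_isConj_eq _ hc] at this
        exact this
      exact (e ⟨0, by omega⟩).trans ((h _ _).trans (e ⟨1, by omega⟩).symm)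
  have := DFunLike.congr_fun key (θ⁻¹ (X n 0))
  simp only [MonoidHom.comp_apply, MulEquiv.toMonoidHom_eq_coe, MonoidHom.coe_coe,
    MulAut.apply_inv_self] at this
  rw [expo_X_self (by omega), expo_X_ne (by omega)] at this
  exact absurd (Multiplicative.ofAdd.injective this) (by decide)

theorem toAdd_eq_of_isConj_zpow {G : Type*} [Group G] (f : G →* Multiplicative ℤ) {x y : G} {c : ℤ}
    (h : IsConj (x ^ c) y) : (f y).toAdd = c * (f x).toAdd := by
  rw [← map_isConj_eq f h, _root_.map_zpow, toAdd_zpow, smul_eq_mul]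

theorem exists_induced_X (hn : 5 ≤ n) (hθ : ∀ y, φ (inn n y) = inn n (θ y)) :
    ∃ ε : ℤ, (ε = 1 ∨ ε = -1) ∧ ∀ i < n, ∃ k < n, IsConj (X n k ^ ε) (θ (X n i)) := by
  have hn2 : 2 ≤ n := by omega
  have h0 : (0 : ℕ) < n := by omega
  obtain ⟨k, hk1, hk2⟩ := (PureInv.expo_cases (by omega)
    (PureInv.induced hn hθ (pureInv_X h0))).resolve_left (exists_expo_ne hn2 ⟨0, h0⟩ hθ)
  obtain ⟨c, hc⟩ := exists_zpow_X (by omega) (PureInv.induced hn hθ (pureInv_X h0)) hk1 hk2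
  refine ⟨c, ?_, fun j hj => ?_⟩
  · have h1 : IsConj ((θ⁻¹ (X n k)) ^ c) (X n 0) := by
      have := (θ⁻¹).toMonoidHom.map_isConj hc
      simpa using this
    have h2 := toAdd_eq_of_isConj_zpow (expo n 0) h1
    rw [expo_X_self h0, toAdd_ofAdd] at h2
    exact Int.isUnit_iff.mp (IsUnit.of_mul_eq_one _ h2.symm)
  · obtain ⟨γ, hγ⟩ := exists_ev_X hn2 ⟨0, h0⟩ ⟨j, hj⟩
    have h1 := isConj_ev_induced hn2 hθ hγ
    have h2 := (ev n (φ γ)).toMonoidHom.map_isConj hc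
    have h3 := isConj_zpow (perm_spec hn2 (φ γ) k) c
    rw [← _root_.map_zpow] at h3
    exact ⟨_, Fin.is_lt _, h3.trans (h2.trans h1)⟩

theorem induced_W (hn : 5 ≤ n) (hθ : ∀ y, φ (inn n y) = inn n (θ y)) {ε : ℤ}
    (hε : ε = 1 ∨ ε = -1) (hX : ∀ i < n, ∃ k < n, IsConj (X n k ^ ε) (θ (X n i))) :
    IsConj (W n n ^ ε) (θ (W n n)) := by
  have hn2 : 2 ≤ n := by omega
  have hinv := PureInv.induced hn hθ (pureInv_W (hn := hn2))
  have ht : total n (θ (W n n)) = total n (W n n) ^ ε := by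
    refine DFunLike.congr_fun (hom_ext (f := (total n).comp θ.toMonoidHom)
      (g := (zpowGroupHom ε).comp (total n)) fun i hi => ?_) (W n n)
    obtain ⟨k, hk, h⟩ := hX i hi
    show total n (θ (X n i)) = total n (X n i) ^ ε
    rw [← map_isConj_eq _ h, _root_.map_zpow, total_X hi, total_X hk]
  have hall : ∀ a b : Fin n, expo n a (θ (W n n)) = expo n b (θ (W n n)) := fun a b => by
    obtain ⟨δ, hδ⟩ := perm_surjective hn2 (Equiv.swap a b)
    obtain ⟨γ, rfl⟩ := φ.surjective δ
    have := expo_ev_perm hn2 (φ γ) a (θ (W n n))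
    rw [hδ, Equiv.swap_apply_left,
      map_isConj_eq _ (isConj_ev_induced hn2 hθ (ev_W hn2 γ).symm)] at this
    exact this.symm
  have hne : total n (θ (W n n)) ≠ 1 := fun h => by
    rw [ht, total_W le_rfl, ← ofAdd_zsmul, ofAdd_eq_one, smul_eq_mul] at h
    rcases hε with rfl | rfl <;> omega
  obtain ⟨c, hc⟩ := exists_zpow_W (by omega) hinv fun i hi => hne
    (total_eq_one fun j hj => (hall ⟨j, hj⟩ i).trans hi)
  have h := toAdd_eq_of_isConj_zpow (total n) hc
  rw [ht, total_W le_rfl, toAdd_zpow, toAdd_ofAdd, smul_eq_mul] at h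
  rwa [mul_right_cancel₀ (by omega) h]

end Induced

/-- An automorphism preserving the free normal subgroup is inner or inverts the class of its
standard generator. -/
theorem mem_range_conj_or (hn : 5 ≤ n) {φ : MulAut (AbarB n)}
    (hφ : (inn n).range.map φ.toMonoidHom = (inn n).range) :
    φ ∈ (MulAut.conj : AbarB n →* MulAut (AbarB n)).range ∨
      ∃ γ, φ (inn n (X n (n - 1))) = γ * (inn n (X n (n - 1)))⁻¹ * γ⁻¹ := by
  have hn2 : 2 ≤ n := by omega
  obtain ⟨θ, hθ⟩ := exists_induced hn2 hφ
  obtain ⟨ε, hε, hX⟩ := exists_induced_X hn hθ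
  have hW := induced_W hn hθ hε hX
  rcases hε with rfl | rfl
  · left
    simp only [zpow_one] at hX hW
    obtain ⟨γ, rfl⟩ := mem_range_ev hn2 hX hW
    refine ⟨γ, MulEquiv.ext fun g => ev_injective hn2 (MulEquiv.ext fun y => ?_)⟩
    obtain ⟨x, rfl⟩ := (ev n γ).surjective y
    rw [ev_induced hn2 hθ, MulAut.conj_apply, _root_.map_mul, _root_.map_mul, _root_.map_inv,
      MulAut.mul_apply, MulAut.mul_apply, MulAut.inv_apply_self]
  · right
    obtain ⟨k, hk, h⟩ := hX (n - 1) (by omega)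
    obtain ⟨u, hu⟩ := isConj_iff.mp h
    obtain ⟨g, hg⟩ := inn_X_eq_conj hn2 hk
    refine ⟨inn n u * g, ?_⟩
    rw [hθ, ← hu, _root_.map_mul, _root_.map_mul, _root_.map_zpow, _root_.map_inv, hg]
    group

theorem expo_W_of_lt {i m : ℕ} (hi : i < m) (hm : m ≤ n) :
    expo n i (W n m) = Multiplicative.ofAdd 1 := by
  induction m with
  | zero => omega
  | succ m ih =>
    rw [show W n (m + 1) = W n m * X n m from rfl, _root_.map_mul, expo_X (by omega)]
    split_ifs with h
    · rw [expo_W h.le, one_mul]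
    · rw [ih (by omega) (by omega), mul_one]

theorem xi_not_mem (hn : 3 ≤ n) : xi n ∉ (inn n).range := by
  have hn2 : 2 ≤ n := by omega
  rintro ⟨y, hy⟩
  obtain ⟨h1, h2⟩ := ev_xi hn2
  rw [← hy, ev_inn hn2] at h1 h2
  have hy1 : y = 1 := by
    refine eq_one_of_commute_X (n := n) (i := 0) (j := 1) (by omega) (by omega) (by omega) ?_ ?_
    · exact mul_inv_eq_iff_eq_mul.mp (h1 0 (by omega))
    · exact mul_inv_eq_iff_eq_mul.mp (h1 1 (by omega))
  rw [hy1, _root_.map_one, MulAut.one_apply] at h2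
  have hc : Commute (W n n) (X n (n - 1)) := by
    generalize X n (n - 1) = x at *
    generalize W n n = w at *
    have h3 : x = w⁻¹ * x * w := by
      rw [eq_mul_inv_iff_mul_eq] at h2
      exact mul_left_cancel h2
    show w * x = x * w
    nth_rw 1 [h3]
    group
  obtain ⟨c, hc⟩ := mem_zpowers_X (by omega) hc
  have h0 : expo n 0 (X n (n - 1) ^ c) = expo n 0 (W n n) := congrArg (expo n 0) hc
  rw [_root_.map_zpow, expo_X_ne (by omega), one_zpow, expo_W_of_lt (by omega) le_rfl] at h0
  exact absurd (Multiplicative.ofAdd.injective h0) (by decide)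

theorem map_range_inn_eq (hn : 5 ≤ n) {φ μ : MulAut (AbarB n)}
    (hμ : ∃ γ, μ (inn n (X n (n - 1))) = γ * xi n * γ⁻¹)
    (h : (inn n).range.map φ.toMonoidHom ≤ (inn n).range) :
    (inn n).range.map φ.toMonoidHom = (inn n).range := by
  have hn2 : 2 ≤ n := by omega
  refine le_antisymm h ?_
  rcases map_range_inn_le_or hn φ⁻¹ μ hμ with h' | h'
  · intro x hx
    exact ⟨φ⁻¹ x, h' ⟨x, hx, rfl⟩, MulAut.apply_inv_self _ _ _⟩
  · obtain ⟨γ, hγ⟩ := hμ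
    have h1 : φ⁻¹ (μ (inn n (X n (n - 1)))) ∈ (inn n).range := h' ⟨_, ⟨_, rfl⟩, rfl⟩
    have h2 := h ⟨_, h1, rfl⟩
    have h3 : γ * xi n * γ⁻¹ ∈ (inn n).range := by
      rw [← hγ]
      simpa using h2
    have := (range_inn_normal hn2).conj_mem _ h3 γ⁻¹
    refine absurd ?_ (xi_not_mem (n := n) (by omega))
    convert this using 1
    group

end ArtinBAut

namespace ArtinBAut

variable {n : ℕ}

/-- The homomorphism from the Klein four-group given by two commuting involutions. -/
def kleinHom {G : Type*} [Group G] {a b : G} (ha : a ^ 2 = 1) (hb : b ^ 2 = 1) (hab : Commute a b) :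
    Multiplicative (ZMod 2 × ZMod 2) →* G where
  toFun v := a ^ v.toAdd.1.val * b ^ v.toAdd.2.val
  map_one' := by simp
  map_mul' v w := by
    have h : ∀ {c : G}, c ^ 2 = 1 → ∀ x y : ZMod 2, c ^ (x + y).val = c ^ x.val * c ^ y.val :=
      fun hc x y => by rw [ZMod.val_add, ← pow_eq_pow_mod _ hc, pow_add]
    rw [toAdd_mul, Prod.fst_add, Prod.snd_add, h ha, h hb]
    exact (hab.pow_pow _ _).mul_mul_mul_comm _ _

section KleinHom

variable {G : Type*} [Group G] {a b : G} (ha : a ^ 2 = 1) (hb : b ^ 2 = 1) (hab : Commute a b)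

theorem kleinHom_ofAdd (x y : ZMod 2) :
    kleinHom ha hb hab (Multiplicative.ofAdd (x, y)) = a ^ x.val * b ^ y.val := rfl

theorem eq_one_of_kleinHom_mem {N : Subgroup G} (h1 : a ∉ N) (h2 : b ∉ N) (h3 : a * b ∉ N)
    {v : Multiplicative (ZMod 2 × ZMod 2)} (hv : kleinHom ha hb hab v ∈ N) : v = 1 := by
  obtain ⟨⟨x, y⟩, rfl⟩ := Multiplicative.ofAdd.surjective v
  rw [kleinHom_ofAdd] at hv
  have h2cases : ∀ x : ZMod 2, x = 0 ∨ x = 1 := by decide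
  rcases h2cases x with rfl | rfl <;> rcases h2cases y with rfl | rfl
  · rfl
  · exact absurd (by simpa [ZMod.val_one] using hv) h2
  · exact absurd (by simpa [ZMod.val_one] using hv) h1
  · exact absurd (by simpa [ZMod.val_one] using hv) h3

theorem kleinHom_mem_closure (v : Multiplicative (ZMod 2 × ZMod 2)) :
    kleinHom ha hb hab v ∈ Subgroup.closure {a, b} :=
  mul_mem (pow_mem (Subgroup.subset_closure (.inl rfl)) _)
    (pow_mem (Subgroup.subset_closure (.inr rfl)) _)

theorem closure_le_range_kleinHom : Subgroup.closure {a, b} ≤ (kleinHom ha hb hab).range := by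
  rw [Subgroup.closure_le]
  rintro x (rfl | rfl)
  · exact ⟨Multiplicative.ofAdd (1, 0), by rw [kleinHom_ofAdd]; simp [ZMod.val_one]⟩
  · exact ⟨Multiplicative.ofAdd (0, 1), by rw [kleinHom_ofAdd]; simp [ZMod.val_one]⟩

end KleinHom

/-- The automorphism group of a centreless group whose outer automorphism group is represented by
two commuting involutions. -/
theorem mulAut_structure {G : Type*} [Group G] {a b : MulAut G} (ha : a ^ 2 = 1) (hb : b ^ 2 = 1)
    (hab : Commute a b) (hinj : Function.Injective (MulAut.conj : G →* MulAut G))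
    (h1 : a ∉ (MulAut.conj : G →* MulAut G).range) (h2 : b ∉ (MulAut.conj : G →* MulAut G).range)
    (h3 : a * b ∉ (MulAut.conj : G →* MulAut G).range)
    (hcov : ∀ φ : MulAut G, ∃ x v, φ = MulAut.conj x * kleinHom ha hb hab v) :
    Subgroup.closure (↑(MulAut.conj : G →* MulAut G).range ∪ {a, b}) = ⊤ ∧
    Subgroup.closure {a, b} ⊓ (MulAut.conj : G →* MulAut G).range = ⊥ ∧
    (∃ act : Multiplicative (ZMod 2 × ZMod 2) →* MulAut G,
      Nonempty (MulAut G ≃* SemidirectProduct G (Multiplicative (ZMod 2 × ZMod 2)) act)) ∧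
    ∃ f : MulAut G →* Multiplicative (ZMod 2 × ZMod 2),
      Function.Surjective f ∧ f.ker = (MulAut.conj : G →* MulAut G).range := by
  have hker : ∀ v, kleinHom ha hb hab v ∈ (MulAut.conj : G →* MulAut G).range → v = 1 :=
    fun v => eq_one_of_kleinHom_mem ha hb hab h1 h2 h3
  let Ψ : SemidirectProduct G (Multiplicative (ZMod 2 × ZMod 2)) (kleinHom ha hb hab) →* MulAut G :=
    SemidirectProduct.lift MulAut.conj (kleinHom ha hb hab) fun v => by
      ext1 x
      exact (mul_conj_eq _ _).symm
  have hΨ : ∀ p, Ψ p = MulAut.conj p.left * kleinHom ha hb hab p.right := fun p => rfl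
  have hbij : Function.Bijective Ψ := by
    refine ⟨(injective_iff_map_eq_one Ψ).mpr fun p hp => ?_, fun φ => ?_⟩
    · rw [hΨ] at hp
      have hr := hker p.right ⟨p.left⁻¹, by
        rw [_root_.map_inv]; exact inv_eq_of_mul_eq_one_right hp⟩
      rw [hr, _root_.map_one, mul_one] at hp
      exact SemidirectProduct.ext (hinj (hp.trans (_root_.map_one _).symm)) hr
    · obtain ⟨x, v, rfl⟩ := hcov φ
      exact ⟨⟨x, v⟩, rfl⟩
  let e := MulEquiv.ofBijective Ψ hbij
  refine ⟨?_, ?_, ⟨kleinHom ha hb hab, ⟨e.symm⟩⟩,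
    SemidirectProduct.rightHom.comp e.symm.toMonoidHom,
    SemidirectProduct.rightHom_surjective.comp e.symm.surjective, ?_⟩
  · refine eq_top_iff.mpr fun φ _ => ?_
    obtain ⟨x, v, rfl⟩ := hcov φ
    exact mul_mem (Subgroup.subset_closure (.inl ⟨x, rfl⟩))
      (Subgroup.closure_mono Set.subset_union_right (kleinHom_mem_closure ha hb hab v))
  · refine eq_bot_iff.mpr fun φ hφ => ?_
    obtain ⟨v, rfl⟩ := closure_le_range_kleinHom ha hb hab hφ.1
    rw [hker v hφ.2, _root_.map_one]
    exact one_mem _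
  · ext φ
    obtain ⟨p, rfl⟩ := e.surjective φ
    show (e.symm (e p)).right = 1 ↔ _
    rw [e.symm_apply_apply]
    constructor
    · intro h
      refine ⟨p.left, ?_⟩
      show _ = MulAut.conj p.left * kleinHom ha hb hab p.right
      rw [h, _root_.map_one, mul_one]
    · rintro ⟨x, hx⟩
      have hx : MulAut.conj x = MulAut.conj p.left * kleinHom ha hb hab p.right := hx
      exact hker _ ⟨p.left⁻¹ * x, by rw [_root_.map_mul, hx, _root_.map_inv, inv_mul_cancel_left]⟩

theorem conj_AbarB_injective (hn : 2 ≤ n) :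
    Function.Injective (MulAut.conj : AbarB n →* MulAut (AbarB n)) := by
  rw [injective_iff_map_eq_one]
  intro g hg
  refine ev_injective hn (MulEquiv.ext fun y => inn_injective hn ?_)
  rw [← inn_equivariant hn, _root_.map_one, MulAut.one_apply]
  exact DFunLike.congr_fun hg (inn n y)

theorem tbar_eq_sb {i : ℕ} (hi : i + 1 < n) : tbar n (i + 1) = sb n i := by
  rw [tbar, tB, Nat.mod_eq_of_lt hi, if_neg (by omega)]
  rfl

theorem list_prod_range_succ {G : Type*} [Group G] (s : ℕ → G) (m : ℕ) :
    ((List.range (m + 1)).map s).prod = ((List.range m).map s).prod * s m := by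
  rw [List.range_succ, List.map_append, List.prod_append, List.map_singleton, List.prod_singleton]

theorem ρbar_eq (hn : 2 ≤ n) :
    ρbar n = ((List.range (n - 1)).map (sb n)).prod * inn n (X n (n - 1)) := by
  rw [← sb_last hn, ← list_prod_range_succ, show n - 1 + 1 = n by omega, ρbar, ρB,
    map_list_prod, List.map_map]
  rfl

theorem inn_X_last (hn : 2 ≤ n) :
    inn n (X n (n - 1)) = (((List.range (n - 1)).map (sb n)).prod)⁻¹ * ρbar n := by
  rw [ρbar_eq hn, inv_mul_cancel_left]

theorem mulAut_ext (hn : 2 ≤ n) {φ ψ : MulAut (AbarB n)}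
    (h : ∀ i, i + 1 < n → φ (tbar n (i + 1)) = ψ (tbar n (i + 1))) (hρ : φ (ρbar n) = ψ (ρbar n)) :
    φ = ψ := by
  have hs : ∀ i ∈ List.range (n - 1), φ (sb n i) = ψ (sb n i) := fun i hi => by
    rw [List.mem_range] at hi
    rw [← tbar_eq_sb (by omega)]
    exact h i (by omega)
  have hp : φ ((List.range (n - 1)).map (sb n)).prod =
      ψ ((List.range (n - 1)).map (sb n)).prod := by
    rw [map_list_prod, map_list_prod, List.map_map, List.map_map]
    exact congrArg _ (List.map_congr_left hs)
  have htop : φ.toMonoidHom.eqLocus ψ.toMonoidHom = ⊤ := sb_induction fun i hi => by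
    show φ _ = ψ _
    rcases Nat.lt_or_ge (i + 1) n with h' | h'
    · exact hs i (List.mem_range.mpr (by omega))
    · rw [show i = n - 1 by omega, sb_last hn, inn_X_last hn, _root_.map_mul, _root_.map_mul,
        _root_.map_inv, _root_.map_inv, hp, hρ]
  exact MulEquiv.ext fun g => (htop ▸ Subgroup.mem_top g : g ∈ φ.toMonoidHom.eqLocus ψ.toMonoidHom)

theorem tau_inn_X (hn : 2 ≤ n) {τ : MulAut (AbarB n)}
    (hτ : ∀ i < n, τ (tbar n i) = (tbar n (n - i))⁻¹) (hρ : τ (ρbar n) = (ρbar n)⁻¹) :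
    τ (inn n (X n (n - 1))) = ρbar n * (inn n (X n (n - 1)))⁻¹ * (ρbar n)⁻¹ := by
  have key : τ ((List.range (n - 1)).map (sb n)).prod =
      (((List.range (n - 1)).map (sb n)).prod)⁻¹ := by
    rw [map_list_prod, List.prod_inv_reverse, List.map_map, List.map_map, ← List.map_reverse]
    congr 1
    apply List.ext_getElem (by simp)
    intro i h1 h2
    simp only [List.length_map, List.length_range] at h1
    simp only [List.getElem_map, List.getElem_range, List.getElem_reverse, List.length_range,
      Function.comp_apply]
    rw [← tbar_eq_sb (by omega), hτ _ (by omega), ← tbar_eq_sb (by omega)]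
    congr 2
    omega
  rw [inn_X_last hn, _root_.map_mul, _root_.map_inv, key, hρ]
  group

theorem mu_inn_X (hn : 2 ≤ n) {μ : MulAut (AbarB n)}
    (hμ : ∀ i < n, μ (tbar n i) = (tbar n i)⁻¹) (hρ : μ (ρbar n) = ρbar n) :
    ∃ γ, μ (inn n (X n (n - 1))) = γ * xi n * γ⁻¹ := by
  have hs : ∀ i, i + 1 < n → μ (sb n i) = (sb n i)⁻¹ := fun i hi => by
    rw [← tbar_eq_sb hi, hμ _ hi]
  have key : ∀ m, m + 1 < n → (μ ((List.range (m + 1)).map (sb n)).prod)⁻¹ *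
      ((List.range (m + 1)).map (sb n)).prod = band (sb n) m := fun m hm => by
    induction m with
    | zero => simp [hs 0 hm, band, sq]
    | succ m ih =>
      rw [list_prod_range_succ, _root_.map_mul, hs _ hm, band, ← ih (by omega)]
      group
  refine ⟨band (sb n) (n - 2), ?_⟩
  rw [inn_X_last hn, _root_.map_mul, _root_.map_inv, hρ, ρbar_eq hn, ← mul_assoc,
    show n - 1 = n - 2 + 1 by omega, key _ (by omega), show n - 2 + 1 = n - 1 by omega, xi]
  group

theorem map_range_inn_le_of_mem (hn : 2 ≤ n) {φ : MulAut (AbarB n)}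
    (h : φ (inn n (X n (n - 1))) ∈ (inn n).range) :
    (inn n).range.map φ.toMonoidHom ≤ (inn n).range := by
  have hX : ∀ i : Fin n, φ (inn n (FreeGroup.of i)) ∈ (inn n).range := fun i => by
    obtain ⟨g, hg⟩ := inn_X_eq_conj hn i.2
    rw [of_eq_X, hg, _root_.map_mul, _root_.map_mul, _root_.map_inv]
    exact (range_inn_normal hn).conj_mem _ h _
  rintro _ ⟨_, ⟨y, rfl⟩, rfl⟩
  show φ (inn n y) ∈ (inn n).range
  induction y using FreeGroup.induction_on with
  | C1 => rw [_root_.map_one, _root_.map_one]; exact one_mem _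
  | of i => exact hX i
  | inv_of i _ => rw [_root_.map_inv, _root_.map_inv]; exact inv_mem (hX i)
  | mul x y hx hy => rw [_root_.map_mul, _root_.map_mul]; exact mul_mem hx hy

end ArtinBAut

namespace ArtinBAut

variable {n : ℕ}

section Standard

variable {τ μ : MulAut (AbarB n)}

theorem tau_map_le (hn : 2 ≤ n)
    (hτ : τ (inn n (X n (n - 1))) = ρbar n * (inn n (X n (n - 1)))⁻¹ * (ρbar n)⁻¹) :
    (inn n).range.map τ.toMonoidHom ≤ (inn n).range := by
  refine map_range_inn_le_of_mem hn ?_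
  rw [hτ]
  exact (range_inn_normal hn).conj_mem _ (inv_mem ⟨_, rfl⟩) _

theorem mu_inn_X_not_mem (hn : 3 ≤ n)
    (hμ : ∃ γ, μ (inn n (X n (n - 1))) = γ * xi n * γ⁻¹) :
    μ (inn n (X n (n - 1))) ∉ (inn n).range := by
  obtain ⟨γ, hγ⟩ := hμ
  intro h
  rw [hγ] at h
  have := (range_inn_normal (show 2 ≤ n by omega)).conj_mem _ h γ⁻¹
  refine xi_not_mem hn ?_
  convert this using 1
  group

theorem tau_not_inner (hn : 2 ≤ n)
    (hτ : τ (inn n (X n (n - 1))) = ρbar n * (inn n (X n (n - 1)))⁻¹ * (ρbar n)⁻¹) :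
    τ ∉ (MulAut.conj : AbarB n →* MulAut (AbarB n)).range := by
  rintro ⟨γ, rfl⟩
  refine inn_X_conj_ne_inv hn ((ρbar n)⁻¹ * γ) ?_
  rw [MulAut.conj_apply] at hτ
  calc _ = (ρbar n)⁻¹ * (γ * inn n (X n (n - 1)) * γ⁻¹) * ρbar n := by group
    _ = _ := by rw [hτ]; group

theorem mem_range_conj_or_mul (hn : 5 ≤ n)
    (hτ : τ (inn n (X n (n - 1))) = ρbar n * (inn n (X n (n - 1)))⁻¹ * (ρbar n)⁻¹)
    (hμ : ∃ γ, μ (inn n (X n (n - 1))) = γ * xi n * γ⁻¹) {φ : MulAut (AbarB n)}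
    (h : (inn n).range.map φ.toMonoidHom ≤ (inn n).range) :
    φ ∈ (MulAut.conj : AbarB n →* MulAut (AbarB n)).range ∨
      φ * τ ∈ (MulAut.conj : AbarB n →* MulAut (AbarB n)).range := by
  have hn2 : 2 ≤ n := by omega
  refine (mem_range_conj_or hn (map_range_inn_eq hn hμ h)).imp_right fun ⟨γ, hγ⟩ => ?_
  have hle : (inn n).range.map (φ * τ).toMonoidHom ≤ (inn n).range := by
    rintro _ ⟨x, hx, rfl⟩
    exact h ⟨_, tau_map_le hn2 hτ ⟨x, hx, rfl⟩, rfl⟩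
  refine (mem_range_conj_or hn (map_range_inn_eq hn hμ hle)).resolve_right ?_
  rintro ⟨δ, hδ⟩
  rw [MulAut.mul_apply, hτ] at hδ
  simp only [_root_.map_mul, _root_.map_inv, hγ] at hδ
  refine inn_X_conj_ne_inv hn2 (δ⁻¹ * φ (ρbar n) * γ) ?_
  calc _ = δ⁻¹ * (φ (ρbar n) * (γ * (inn n (X n (n - 1)))⁻¹ * γ⁻¹)⁻¹ * (φ (ρbar n))⁻¹) * δ := by
        group
    _ = _ := by rw [hδ]; group

end Standard

end ArtinBAut

theorem quotient_aut_structure (n : ℕ) (hn : 5 ≤ n) (τb μb : MulAut (AbarB n))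
    (hτ : (∀ i < n, τb (tbar n i) = (tbar n (n - i))⁻¹) ∧ τb (ρbar n) = (ρbar n)⁻¹)
    (hμ : (∀ i < n, μb (tbar n i) = (tbar n i)⁻¹) ∧ μb (ρbar n) = ρbar n) :
    -- Aut(Ā) is generated by Inn(Ā) together with τ̄ and μ̄
    Subgroup.closure
      (↑(MulAut.conj : AbarB n →* MulAut (AbarB n)).range ∪ {τb, μb}) = ⊤ ∧
    -- τ̄ and μ̄ are commuting involutions
    τb ^ 2 = 1 ∧ μb ^ 2 = 1 ∧ τb * μb = μb * τb ∧
    -- ⟨τ̄, μ̄⟩ meets Inn(Ā) trivially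
    Subgroup.closure {τb, μb} ⊓
      (MulAut.conj : AbarB n →* MulAut (AbarB n)).range = ⊥ ∧
    -- Aut(Ā) ≅ Ā ⋊ (ℤ/2ℤ × ℤ/2ℤ)
    (∃ act : Multiplicative (ZMod 2 × ZMod 2) →* MulAut (AbarB n),
      Nonempty (MulAut (AbarB n) ≃*
        SemidirectProduct (AbarB n) (Multiplicative (ZMod 2 × ZMod 2)) act)) ∧
    -- Out(Ā) ≅ ℤ/2ℤ × ℤ/2ℤ, realized by a surjection with kernel Inn(Ā)
    ∃ f : MulAut (AbarB n) →* Multiplicative (ZMod 2 × ZMod 2),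
      Function.Surjective f ∧
      f.ker = (MulAut.conj : AbarB n →* MulAut (AbarB n)).range := by
  open ArtinBAut in
  have hn2 : 2 ≤ n := by omega
  have ht := tau_inn_X hn2 hτ.1 hτ.2
  have hm := mu_inn_X hn2 hμ.1 hμ.2
  have hτ2 : τb ^ 2 = 1 := mulAut_ext hn2
    (fun i hi => by
      rw [sq, MulAut.mul_apply, hτ.1 _ hi, _root_.map_inv, hτ.1 _ (by omega), inv_inv,
        MulAut.one_apply]
      congr 1
      omega)
    (by rw [sq, MulAut.mul_apply, hτ.2, _root_.map_inv, hτ.2, inv_inv, MulAut.one_apply])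
  have hμ2 : μb ^ 2 = 1 := mulAut_ext hn2
    (fun i hi => by
      rw [sq, MulAut.mul_apply, hμ.1 _ hi, _root_.map_inv, hμ.1 _ hi, inv_inv, MulAut.one_apply])
    (by rw [sq, MulAut.mul_apply, hμ.2, hμ.2, MulAut.one_apply])
  have hcomm : Commute τb μb := mulAut_ext hn2
    (fun i hi => by
      rw [MulAut.mul_apply, MulAut.mul_apply, hμ.1 _ hi, hτ.1 _ hi, _root_.map_inv, _root_.map_inv,
        hτ.1 _ hi, hμ.1 _ (by omega)])
    (by rw [MulAut.mul_apply, MulAut.mul_apply, hμ.2, hτ.2, _root_.map_inv, hμ.2])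
  have hττ : τb * τb = 1 := by rw [← sq, hτ2]
  have hμμ : μb * μb = 1 := by rw [← sq, hμ2]
  have conj_mem : ∀ γ y, MulAut.conj γ (inn n y) ∈ (inn n).range := fun γ y =>
    (range_inn_normal hn2).conj_mem _ ⟨y, rfl⟩ γ
  have hμ_not : μb ∉ (MulAut.conj : AbarB n →* MulAut (AbarB n)).range := by
    rintro ⟨γ, h⟩
    refine mu_inn_X_not_mem (by omega) hm ?_
    rw [← h]
    exact conj_mem _ _
  have hτμ_not : τb * μb ∉ (MulAut.conj : AbarB n →* MulAut (AbarB n)).range := by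
    rintro ⟨γ, h⟩
    refine mu_inn_X_not_mem (by omega) hm ?_
    rw [show μb = τb * MulAut.conj γ by rw [h, ← mul_assoc, hττ, one_mul]]
    exact tau_map_le hn2 ht ⟨_, conj_mem _ _, rfl⟩
  have hcov : ∀ φ : MulAut (AbarB n), ∃ x v, φ = MulAut.conj x * kleinHom hτ2 hμ2 hcomm v := by
    intro φ
    rcases map_range_inn_le_or hn φ μb hm with h | h <;>
    rcases mem_range_conj_or_mul hn ht hm h with ⟨x, hx⟩ | ⟨x, hx⟩
    · exact ⟨x, 1, by rw [hx, _root_.map_one, mul_one]⟩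
    · refine ⟨x, Multiplicative.ofAdd (1, 0), ?_⟩
      rw [hx, kleinHom_ofAdd, ZMod.val_one, ZMod.val_zero, pow_one, pow_zero, mul_one, mul_assoc,
        hττ, mul_one]
    · refine ⟨x, Multiplicative.ofAdd (0, 1), ?_⟩
      rw [hx, kleinHom_ofAdd, ZMod.val_one, ZMod.val_zero, pow_one, pow_zero, one_mul, mul_assoc,
        hμμ, mul_one]
    · refine ⟨x, Multiplicative.ofAdd (1, 1), ?_⟩
      rw [hx, kleinHom_ofAdd, ZMod.val_one, pow_one, pow_one, mul_assoc, ← mul_assoc τb, hττ,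
        one_mul, mul_assoc, hμμ, mul_one]
  obtain ⟨h1, h2, h3⟩ := mulAut_structure hτ2 hμ2 hcomm (conj_AbarB_injective hn2)
    (tau_not_inner hn2 ht) hμ_not hτμ_not hcov
  exact ⟨h1, hτ2, hμ2, hcomm, h2, h3⟩
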